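/- arXiv:2407.20374 — 4 statements merged into one kernel-verified Lean document; each statement's English description precedes it below -/
import Mathlib

section
/- Let p be an odd prime dividing n, and assume n is not of the form 2p^k with k ≥ 1 and not of the form 5·3^k with k ≥ 1 (in which case p would be 3). Then for every maximal ideal 𝔭 of O lying over p and every integer d ≥ 1, the reduction map mod 𝔭^d sends Δ onto all of SL₂(O/𝔭^d). -/
open Matrix
open scoped MatrixGroups

set_option synthInstance.maxHeartbeats 1000000
set_option maxHeartbeats 1000000

noncomputable section

/-- The ring `O = ℤ[ζ + ζ⁻¹]`, realized as a subalgebra of `ℂ`. -/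
abbrev Oring (ζ : ℂ) : Subalgebra ℤ ℂ := Algebra.adjoin ℤ {ζ + ζ⁻¹}

/-- The element `ζ + ζ⁻¹` of `O`. -/
def lamO (ζ : ℂ) : Oring ζ := ⟨ζ + ζ⁻¹, Algebra.subset_adjoin rfl⟩

/-- The matrix `T = [[1, 2 + ζ + ζ⁻¹], [0, 1]]` in `SL₂(O)`. -/
def Tmat (ζ : ℂ) : SL(2, Oring ζ) :=
  ⟨!![1, 2 + lamO ζ; 0, 1], by rw [Matrix.det_fin_two_of]; ring⟩

/-- The matrix `U = [[-1, 0], [1, -1]]` in `SL₂(O)`. -/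
def Umat (ζ : ℂ) : SL(2, Oring ζ) :=
  ⟨!![-1, 0; 1, -1], by rw [Matrix.det_fin_two_of]; ring⟩

/-- The matrix `R = U * T` in `SL₂(O)`. -/
def Rmat (ζ : ℂ) : SL(2, Oring ζ) := Umat ζ * Tmat ζ

/-- The triangle group `Δ = ⟨T, U⟩ ⊆ SL₂(O)`. -/
def Delta (ζ : ℂ) : Subgroup SL(2, Oring ζ) := Subgroup.closure {Tmat ζ, Umat ζ}

/-- Reduction mod the ideal `J`: the natural map `SL₂(O) → SL₂(O/J)`. -/
def SLred (ζ : ℂ) (J : Ideal (Oring ζ)) : SL(2, Oring ζ) →* SL(2, Oring ζ ⧸ J) :=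
  Matrix.SpecialLinearGroup.map (Ideal.Quotient.mk J)


set_option linter.unusedVariables false
set_option linter.unusedSectionVars false

/-- A set of `2 × 2` matrices (given by entries) which is a subgroup of `SL₂(F)` containing `-1`
and the elementary matrix `E₁₂(1)`. -/
structure GrpQ {F : Type*} [Field F] (Q : F → F → F → F → Prop) : Prop where
  det : ∀ {a b c d}, Q a b c d → a * d - b * c = 1
  mul : ∀ {a b c d a' b' c' d'}, Q a b c d → Q a' b' c' d' →
    Q (a * a' + b * c') (a * b' + b * d') (c * a' + d * c') (c * b' + d * d')
  inv : ∀ {a b c d}, Q a b c d → Q d (-b) (-c) a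
  neg : ∀ {a b c d}, Q a b c d → Q (-a) (-b) (-c) (-d)
  e1 : Q 1 1 0 1

namespace GrpQ

variable {F : Type*} [Field F] {Q : F → F → F → F → Prop}

theorem cast {a b c d a' b' c' d' : F} (h : Q a b c d) (ha : a = a') (hb : b = b') (hc : c = c')
    (hd : d = d') : Q a' b' c' d' := by
  subst ha hb hc hd; exact h

theorem one (hQ : GrpQ Q) : Q 1 0 0 1 :=
  cast (hQ.mul hQ.e1 (hQ.inv hQ.e1)) (by ring) (by ring) (by ring) (by ring)

theorem A_add (hQ : GrpQ Q) {x y : F} (hx : Q 1 x 0 1) (hy : Q 1 y 0 1) : Q 1 (x + y) 0 1 :=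
  cast (hQ.mul hx hy) (by ring) (by ring) (by ring) (by ring)

theorem A_neg (hQ : GrpQ Q) {x : F} (hx : Q 1 x 0 1) : Q 1 (-x) 0 1 :=
  cast (hQ.inv hx) (by ring) (by ring) (by ring) (by ring)

/-- The additive group of all `x` with `E₁₂(x)` in the group. -/
def A (hQ : GrpQ Q) : AddSubgroup F where
  carrier := {x | Q 1 x 0 1}
  zero_mem' := hQ.one
  add_mem' := fun hx hy => hQ.A_add hx hy
  neg_mem' := fun hx => hQ.A_neg hx

theorem mem_A (hQ : GrpQ Q) {x : F} : x ∈ hQ.A ↔ Q 1 x 0 1 := Iff.rfl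

/-- Two elements with the same lower row differ by some `E₁₂(a)`. -/
theorem same_row (hQ : GrpQ Q) {x y x' y' c w : F} (h : Q x y c w) (h' : Q x' y' c w) :
    ∃ a ∈ hQ.A, x' = x + a * c := by
  have d1 := hQ.det h
  have d2 := hQ.det h'
  refine ⟨y' * x - x' * y, ?_, ?_⟩
  · rw [mem_A]
    refine cast (hQ.mul h' (hQ.inv h)) ?_ ?_ ?_ ?_
    · linear_combination d2
    · ring
    · ring
    · linear_combination d1
  · linear_combination x * d2 - x' * d1

theorem D_sq (hQ : GrpQ Q) {α y : F} (hα : α ≠ 0) (h : Q α y 0 α⁻¹) {a : F} (ha : a ∈ hQ.A) :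
    α ^ 2 * a ∈ hQ.A := by
  rw [mem_A] at *
  refine cast (hQ.mul (hQ.mul h ha) (hQ.inv h)) ?_ ?_ ?_ ?_ <;> field_simp <;> ring

open Classical in
/-- Upper left entries of the stabilizer of infinity. -/
noncomputable def D [Fintype F] (Q : F → F → F → F → Prop) : Finset F :=
  Finset.univ.filter fun α => α ≠ 0 ∧ ∃ y, Q α y 0 α⁻¹

open Classical in
/-- The set of ratios of lower rows. -/
noncomputable def Om [Fintype F] (Q : F → F → F → F → Prop) : Finset F :=
  Finset.univ.filter fun ρ => ∃ x y c, c ≠ 0 ∧ Q x y c (ρ * c)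

open Classical in
/-- Lower rows of the elements of trace two not fixing infinity. -/
noncomputable def Z [Fintype F] (Q : F → F → F → F → Prop) : Finset (F × F) :=
  Finset.univ.filter fun t => t.1 ≠ 0 ∧ ∃ x y, Q x y t.1 t.2 ∧ x + t.2 = 2

open Classical in
/-- The elements of `Z` in the fibre over `ρ`. -/
noncomputable def Nf [Fintype F] (Q : F → F → F → F → Prop) (ρ : F) : Finset (F × F) :=
  (Z Q).filter fun t => t.2 / t.1 = ρ

theorem mem_D [Fintype F] {α : F} : α ∈ D Q ↔ α ≠ 0 ∧ ∃ y, Q α y 0 α⁻¹ := by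
  simp [D]

theorem mem_Om [Fintype F] {ρ : F} : ρ ∈ Om Q ↔ ∃ x y c, c ≠ 0 ∧ Q x y c (ρ * c) := by
  simp [Om]

theorem mem_Z [Fintype F] {t : F × F} :
    t ∈ Z Q ↔ t.1 ≠ 0 ∧ ∃ x y, Q x y t.1 t.2 ∧ x + t.2 = 2 := by
  simp [Z]

theorem mem_Nf [Fintype F] {ρ : F} {t : F × F} : t ∈ Nf Q ρ ↔ t ∈ Z Q ∧ t.2 / t.1 = ρ := by
  simp [Nf]

theorem mem_Om_of [Fintype F] {x y c w : F} (h : Q x y c w) (hc : c ≠ 0) : w / c ∈ Om Q := by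
  rw [mem_Om]
  exact ⟨x, y, c, hc, cast h rfl rfl rfl (by field_simp)⟩

theorem card_Z [Fintype F] : (Z Q).card = ∑ ρ ∈ Om Q, (Nf Q ρ).card := by
  classical
  refine (Finset.card_eq_sum_card_fiberwise (t := Om Q) (f := fun t : F × F => t.2 / t.1) ?_).trans ?_
  · intro t ht
    have := mem_Z.1 ht
    obtain ⟨h0, x, y, h, -⟩ := this
    exact mem_Om_of h h0
  · refine Finset.sum_congr rfl fun ρ _ => ?_
    unfold Nf
    congr

theorem lower [Fintype F] (hQ : GrpQ Q) :
    (Om Q).card * (Nat.card hQ.A - 1) ≤ ∑ ρ ∈ Om Q, (Nf Q ρ).card := by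
  classical
  rw [← card_Z]
  have hch : ∀ ρ : F, ∃ c : F, ρ ∈ Om Q → c ≠ 0 ∧ ∃ x y, Q x y c (ρ * c) := by
    intro ρ
    by_cases h : ρ ∈ Om Q
    · obtain ⟨x, y, c, hc, hq⟩ := mem_Om.1 h
      exact ⟨c, fun _ => ⟨hc, x, y, hq⟩⟩
    · exact ⟨0, fun h' => absurd h' h⟩
  choose c hc using hch
  let A0 : Finset F := Finset.univ.filter fun x => x ∈ hQ.A ∧ x ≠ 0
  have hA0 : A0.card = Nat.card hQ.A - 1 := by
    have h1 : A0 = (Finset.univ.filter fun x => x ∈ hQ.A).erase 0 := by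
      ext x; simp [A0, and_comm]
    rw [h1, Finset.card_erase_of_mem (by simp [hQ.A.zero_mem])]
    congr 1
    rw [Nat.card_eq_fintype_card, Fintype.card_subtype]
  rw [← hA0, ← Finset.card_product]
  refine Finset.card_le_card_of_injOn
    (fun t => (-(t.2 * c t.1 ^ 2), 1 - t.2 * t.1 * c t.1 ^ 2)) ?_ ?_
  · rintro ⟨ρ, a⟩ ht
    simp only [Finset.coe_product, Set.mem_prod, Finset.mem_coe] at ht
    obtain ⟨h1, h2⟩ := ht
    obtain ⟨hc0, x, y, hq⟩ := hc ρ h1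
    simp only [A0, Finset.mem_filter, Finset.mem_univ, true_and] at h2
    have ha := h2.1
    rw [mem_A] at ha
    simp only [Finset.mem_coe, mem_Z]
    refine ⟨by simp [h2.2, hc0], ?_⟩
    have := hQ.det hq
    refine ⟨1 + a * ρ * c ρ ^ 2, a * (ρ * c ρ) ^ 2, ?_, by ring⟩
    refine cast (hQ.mul (hQ.mul (hQ.inv hq) ha) hq) ?_ ?_ ?_ ?_
    · linear_combination this
    · ring
    · ring
    · linear_combination this
  · rintro ⟨ρ, a⟩ ht ⟨ρ', a'⟩ ht' heq
    simp only [Finset.coe_product, Set.mem_prod, Finset.mem_coe] at ht ht'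
    obtain ⟨h1, h2⟩ := ht
    obtain ⟨h1', h2'⟩ := ht'
    obtain ⟨hc0, -⟩ := hc ρ h1
    simp only [A0, Finset.mem_filter, Finset.mem_univ, true_and] at h2 h2'
    simp only [Prod.mk.injEq] at heq
    obtain ⟨e1, e2⟩ := heq
    have hρ : ρ = ρ' := by
      have h3 : a * c ρ ^ 2 ≠ 0 := mul_ne_zero h2.2 (pow_ne_zero _ hc0)
      apply mul_left_cancel₀ h3
      linear_combination (-1 : F) * e2 + ρ' * e1
    subst hρ
    have : a = a' := by
      apply mul_right_cancel₀ (pow_ne_zero 2 hc0)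
      linear_combination (-1 : F) * e1
    rw [this]

/-- The diagonal entry attached to two elements over the same ratio. -/
theorem ratio_mem_D [Fintype F] (hQ : GrpQ Q) {x y c w x' y' c' w' : F} (h : Q x y c w)
    (h' : Q x' y' c' w') (hc : c ≠ 0) (hc' : c' ≠ 0) (hr : w' / c' = w / c) : c / c' ∈ D Q := by
  rw [mem_D]
  have d1 := hQ.det h
  have d2 := hQ.det h'
  have hr' : w' * c = w * c' := by field_simp at hr; linear_combination hr
  refine ⟨div_ne_zero hc hc', ?_⟩
  refine ⟨-(x' * y) + y' * x, cast (hQ.mul h' (hQ.inv h)) ?_ (by ring) ?_ ?_⟩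
  · field_simp
    linear_combination c * d2 - x' * hr'
  · linear_combination -hr'
  · field_simp
    linear_combination c' * d1 + x * hr'

theorem Nf_le [Fintype F] (hQ : GrpQ Q) {ρ : F} (hρ : ρ ∈ Om Q) :
    (Nf Q ρ).card ≤ (D Q).card := by
  classical
  obtain ⟨x, y, c, hc, h⟩ := mem_Om.1 hρ
  refine Finset.card_le_card_of_injOn (fun t => c / t.1) ?_ ?_
  · intro t ht
    obtain ⟨h1, h2⟩ := mem_Nf.1 ht
    obtain ⟨h3, x', y', h4, -⟩ := mem_Z.1 h1
    exact hQ.ratio_mem_D h h4 hc h3 (by rw [h2]; field_simp)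
  · intro t ht t' ht' he
    obtain ⟨h1, h2⟩ := mem_Nf.1 ht
    obtain ⟨h1', h2'⟩ := mem_Nf.1 ht'
    have h3 := (mem_Z.1 h1).1
    have h3' := (mem_Z.1 h1').1
    have e1 : t.1 = t'.1 := by
      simp only at he
      field_simp at he
      exact he.symm
    have e2 : t.2 = t'.2 := by
      rw [div_eq_iff h3] at h2
      rw [div_eq_iff h3'] at h2'
      rw [h2, h2', e1]
    exact Prod.ext e1 e2

theorem D_ge [Fintype F] (hQ : GrpQ Q) {μ : F} (hμ : μ ≠ 0) (hs : Q 1 0 μ 1) :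
    Nat.card hQ.A - 1 ≤ (D Q).card := by
  have h1 := hQ.lower
  have h2 : ∑ ρ ∈ Om Q, (Nf Q ρ).card ≤ (Om Q).card * (D Q).card := by
    rw [← smul_eq_mul]
    exact Finset.sum_le_card_nsmul _ _ _ fun ρ hρ => hQ.Nf_le hρ
  have h3 : 0 < (Om Q).card := Finset.card_pos.2 ⟨_, mem_Om_of hs hμ⟩
  exact Nat.le_of_mul_le_mul_left (h1.trans h2) h3

end GrpQ


namespace GrpQ

variable {F : Type*} [Field F] {Q : F → F → F → F → Prop}

/-- Multipliers of `A`. -/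
def E (hQ : GrpQ Q) : AddSubgroup F where
  carrier := {x | ∀ a ∈ hQ.A, x * a ∈ hQ.A}
  zero_mem' := fun a _ => by rw [zero_mul]; exact hQ.A.zero_mem
  add_mem' := fun hx hy a ha => by rw [add_mul]; exact hQ.A.add_mem (hx a ha) (hy a ha)
  neg_mem' := fun hx a ha => by rw [neg_mul]; exact hQ.A.neg_mem (hx a ha)

theorem card_sq_fiber [Fintype F] [DecidableEq F] (S : Finset F) :
    S.card ≤ 2 * (S.image fun x => x ^ 2).card := by
  refine Finset.card_le_mul_card_image S 2 fun b hb => ?_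
  obtain ⟨a, -, rfl⟩ := Finset.mem_image.1 hb
  have : (S.filter fun x => x ^ 2 = a ^ 2) ⊆ {a, -a} := by
    intro x hx
    rw [Finset.mem_filter] at hx
    rcases sq_eq_sq_iff_eq_or_eq_neg.1 hx.2 with h | h <;> simp [h]
  exact (Finset.card_le_card this).trans Finset.card_le_two

theorem card_addSubgroup [Fintype F] [DecidableEq F] (S : AddSubgroup F) [DecidablePred (· ∈ S)] :
    (Finset.univ.filter fun x => x ∈ S ∧ x ≠ 0).card = Nat.card S - 1 := by
  have h1 : (Finset.univ.filter fun x => x ∈ S ∧ x ≠ 0)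
      = (Finset.univ.filter fun x => x ∈ S).erase 0 := by
    ext x; simp [and_comm]
  rw [h1, Finset.card_erase_of_mem (by simp [S.zero_mem])]
  congr 1
  rw [Nat.card_eq_fintype_card, Fintype.card_subtype]

theorem A_mul [Fintype F] (hQ : GrpQ Q) {μ : F} (hμ : μ ≠ 0) (hs : Q 1 0 μ 1) {x y : F}
    (hx : x ∈ hQ.A) (hy : y ∈ hQ.A) : x * y ∈ hQ.A := by
  classical
  have hle : hQ.E ≤ hQ.A := fun x hx => by
    have := hx 1 hQ.e1
    rwa [mul_one] at this
  have hD := hQ.D_ge hμ hs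
  have h1 := card_sq_fiber (D Q)
  have h2 : ((D Q).image fun x => x ^ 2).card ≤ Nat.card hQ.E - 1 := by
    rw [← card_addSubgroup]
    refine Finset.card_le_card fun b hb => ?_
    obtain ⟨a, ha, rfl⟩ := Finset.mem_image.1 hb
    obtain ⟨h0, y, hy⟩ := mem_D.1 ha
    simp only [Finset.mem_filter, Finset.mem_univ, true_and]
    exact ⟨fun z hz => hQ.D_sq h0 hy hz, pow_ne_zero _ h0⟩
  have h3 : Nat.card hQ.E ∣ Nat.card hQ.A := AddSubgroup.card_dvd_of_le hle
  have hE : 0 < Nat.card hQ.E := Nat.card_pos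
  have hA : 0 < Nat.card hQ.A := Nat.card_pos
  have h4 : Nat.card hQ.A = Nat.card hQ.E := by
    obtain ⟨m, hm⟩ := h3
    have : m < 2 := by
      by_contra hm2
      push Not at hm2
      have : Nat.card hQ.E * 2 ≤ Nat.card hQ.A := by rw [hm]; exact Nat.mul_le_mul_left _ hm2
      omega
    interval_cases m
    · omega
    · omega
  have h5 : hQ.E = hQ.A := AddSubgroup.eq_of_le_of_card_ge hle h4.le
  rw [← h5] at hx
  exact hx y hy

/-- `A` is a subfield. -/
def Af [Fintype F] (hQ : GrpQ Q) {μ : F} (hμ : μ ≠ 0) (hs : Q 1 0 μ 1) : Subfield F where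
  carrier := hQ.A
  zero_mem' := hQ.A.zero_mem
  one_mem' := hQ.e1
  add_mem' := hQ.A.add_mem
  neg_mem' := hQ.A.neg_mem
  mul_mem' := hQ.A_mul hμ hs
  inv_mem' := by
    intro x hx
    by_cases h0 : x = 0
    · rw [h0, _root_.inv_zero]; exact hQ.A.zero_mem
    have h1 : x ^ (Fintype.card F - 1) = 1 := FiniteField.pow_card_sub_one_eq_one x h0
    have h2 : 1 < Fintype.card F := Fintype.one_lt_card
    have h3 : x⁻¹ = x ^ (Fintype.card F - 2) := by
      refine inv_eq_of_mul_eq_one_left ?_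
      rw [← pow_succ, ← h1]
      congr 1
      omega
    rw [h3]
    have : ∀ n : ℕ, x ^ n ∈ hQ.A := by
      intro n
      induction n with
      | zero => rw [pow_zero]; exact hQ.e1
      | succ n ih => rw [pow_succ]; exact hQ.A_mul hμ hs ih hx
    exact this _

/-- If `μ ∉ A` then there are more diagonal entries than expected. -/
theorem D_gt [Fintype F] (hQ : GrpQ Q) (h2F : (2 : F) ≠ 0) {μ : F} (hμ : μ ≠ 0) (hs : Q 1 0 μ 1)
    (hμA : μ ∉ hQ.A) : Nat.card hQ.A - 1 < (D Q).card := by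
  classical
  refine lt_of_le_of_ne (hQ.D_ge hμ hs) fun heq => hμA ?_
  have h1 := hQ.lower
  have hρ := mem_Om_of hs hμ
  have h2 : ∀ ρ ∈ Om Q, (Nf Q ρ).card = (D Q).card := by
    have h3 : ∑ ρ ∈ Om Q, (Nf Q ρ).card = ∑ ρ ∈ Om Q, (D Q).card := by
      refine le_antisymm (Finset.sum_le_sum fun ρ h => hQ.Nf_le h) ?_
      rw [Finset.sum_const, smul_eq_mul, ← heq]
      exact h1
    exact (Finset.sum_eq_sum_iff_of_le fun ρ h => hQ.Nf_le h).1 h3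
  have h3 := h2 _ hρ
  -- the injection from the fibre to `D` is surjective
  have himg : (Nf Q (1 / μ)).image (fun t => μ / t.1) = D Q := by
    refine Finset.eq_of_subset_of_card_le ?_ ?_
    · intro α hα
      obtain ⟨t, ht, rfl⟩ := Finset.mem_image.1 hα
      obtain ⟨h1, h2⟩ := mem_Nf.1 ht
      obtain ⟨h3, x', y', h4, -⟩ := mem_Z.1 h1
      exact hQ.ratio_mem_D hs h4 hμ h3 h2
    · rw [← h3, Finset.card_image_of_injOn]
      intro t ht t' ht' he
      obtain ⟨h1, h2⟩ := mem_Nf.1 ht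
      obtain ⟨h1', h2'⟩ := mem_Nf.1 ht'
      have h3 := (mem_Z.1 h1).1
      have h3' := (mem_Z.1 h1').1
      have e1 : t.1 = t'.1 := by
        simp only at he
        field_simp at he
        exact he.symm
      have e2 : t.2 = t'.2 := by
        rw [div_eq_iff h3] at h2
        rw [div_eq_iff h3'] at h2'
        rw [h2, h2', e1]
      exact Prod.ext e1 e2
  have hm1 : (-1 : F) ∈ D Q := by
    rw [mem_D]
    exact ⟨neg_ne_zero.2 one_ne_zero, 0, cast (hQ.neg hQ.one) rfl (by ring) (by ring)
      (by rw [inv_neg, inv_one])⟩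
  rw [← himg] at hm1
  obtain ⟨t, ht, he⟩ := Finset.mem_image.1 hm1
  obtain ⟨h1, h2⟩ := mem_Nf.1 ht
  obtain ⟨h3, x', y', h4, h5⟩ := mem_Z.1 h1
  have e1 : t.1 = -μ := by
    rw [div_eq_iff h3] at he
    linear_combination he
  have e2 : t.2 = -1 := by
    rw [div_eq_iff h3, e1] at h2
    rw [h2]; field_simp
  rw [e1, e2] at h4
  rw [e2] at h5
  obtain ⟨a, ha, hx⟩ := hQ.same_row (cast (hQ.neg hs) rfl (neg_zero) rfl rfl) h4
  have h6 : a * μ = -4 := by linear_combination -h5 + hx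
  have h40 : (4 : F) ≠ 0 := by
    have : (4 : F) = 2 * 2 := by norm_num
    rw [this]; exact mul_ne_zero h2F h2F
  have ha0 : a ≠ 0 := by rintro rfl; apply h40; linear_combination h6
  have h7 : μ = -4 * a⁻¹ := by field_simp; linear_combination h6
  have h8 : (4 : F) ∈ hQ.Af hμ hs := by exact_mod_cast natCast_mem (hQ.Af hμ hs) 4
  rw [h7]
  exact (hQ.Af hμ hs).mul_mem (neg_mem h8) ((hQ.Af hμ hs).inv_mem ha)

/-- Structure of `D` if `μ ∉ A`. -/
theorem exists_eps [Fintype F] (hQ : GrpQ Q) (h2F : (2 : F) ≠ 0) {μ : F} (hμ : μ ≠ 0)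
    (hs : Q 1 0 μ 1) (hμA : μ ∉ hQ.A) :
    ∃ ε : F, ε ∉ hQ.A ∧ ε ^ 2 ∈ hQ.A ∧ (∃ y, Q ε y 0 ε⁻¹) ∧
      ∀ α : F, α ∈ D Q ↔ α ≠ 0 ∧ (α ∈ hQ.A ∨ ∃ e ∈ hQ.A, α = ε * e) := by
  classical
  set K := hQ.Af hμ hs with hK
  have hKA : ∀ x, x ∈ hQ.A ↔ x ∈ K := fun x => Iff.rfl
  have hgt := hQ.D_gt h2F hμ hs hμA
  have hsq := card_sq_fiber (D Q)
  let A0 : Finset F := Finset.univ.filter fun x => x ∈ hQ.A ∧ x ≠ 0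
  have hA0 : A0.card = Nat.card hQ.A - 1 := card_addSubgroup _
  have memA0 : ∀ x, x ∈ A0 ↔ x ∈ K ∧ x ≠ 0 := fun x => by simp [A0, ← hKA]
  have hsub : ((D Q).image fun x => x ^ 2) ⊆ A0 := by
    intro b hb
    obtain ⟨a, ha, rfl⟩ := Finset.mem_image.1 hb
    obtain ⟨h0, y, hy⟩ := mem_D.1 ha
    rw [memA0]
    have := hQ.D_sq h0 hy hQ.e1
    rw [mul_one] at this
    exact ⟨this, pow_ne_zero _ h0⟩
  have Dmul : ∀ {α β : F}, α ∈ D Q → β ∈ D Q → α * β ∈ D Q := by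
    intro α β ha hb
    rw [mem_D] at *
    obtain ⟨a0, y, hy⟩ := ha
    obtain ⟨b0, z, hz⟩ := hb
    exact ⟨mul_ne_zero a0 b0, _, cast (hQ.mul hy hz) (by ring) rfl (by ring) (by field_simp; ring)⟩
  have Dneg : ∀ {α : F}, α ∈ D Q → -α ∈ D Q := by
    intro α ha
    rw [mem_D] at *
    obtain ⟨a0, y, hy⟩ := ha
    exact ⟨neg_ne_zero.2 a0, _, cast (hQ.neg hy) rfl rfl (by ring) (by rw [inv_neg])⟩
  -- every element of `A0` is a square of an element of `D`
  have hall : ∀ e ∈ A0, ∃ α ∈ D Q, α ^ 2 = e := by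
    intro e he
    rw [memA0] at he
    let S := (D Q).image fun x => x ^ 2
    let S' := S.image fun x => e / x
    have hS' : S'.card = S.card := by
      refine Finset.card_image_of_injOn ?_
      intro x hx x' hx' hxx
      have h1 := ((memA0 _).1 (hsub hx)).2
      have h2 := ((memA0 _).1 (hsub hx')).2
      have h3 := he.2
      simp only at hxx
      field_simp at hxx
      exact hxx.symm
    have hS'A : S' ⊆ A0 := by
      intro x hx
      obtain ⟨y, hy, rfl⟩ := Finset.mem_image.1 hx
      have h1 := (memA0 _).1 (hsub hy)
      rw [memA0]
      exact ⟨K.div_mem he.1 h1.1, div_ne_zero he.2 h1.2⟩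
    have hne : (S ∩ S').Nonempty := by
      by_contra hcon
      rw [Finset.not_nonempty_iff_eq_empty, ← Finset.disjoint_iff_inter_eq_empty] at hcon
      have h1 := Finset.card_union_of_disjoint hcon
      have h2 := Finset.card_le_card (Finset.union_subset hsub hS'A)
      change (S ∪ S').card ≤ A0.card at h2
      change (D Q).card ≤ 2 * S.card at hsq
      omega
    obtain ⟨b, hb⟩ := hne
    rw [Finset.mem_inter] at hb
    obtain ⟨a, ha, rfl⟩ := Finset.mem_image.1 hb.1
    obtain ⟨d, hd, hd2⟩ := Finset.mem_image.1 hb.2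
    obtain ⟨f, hf, rfl⟩ := Finset.mem_image.1 hd
    refine ⟨a * f, Dmul ha hf, ?_⟩
    have hf0 := (mem_D.1 hf).1
    rw [div_eq_iff (pow_ne_zero _ hf0)] at hd2
    rw [mul_pow, hd2]
  have hAD : ∀ e ∈ A0, e ∈ D Q := by
    intro e he
    have h1 := (memA0 _).1 he
    obtain ⟨α, hα, h2⟩ := hall (e ^ 2) ((memA0 _).2 ⟨K.pow_mem h1.1 2, pow_ne_zero _ h1.2⟩)
    rcases sq_eq_sq_iff_eq_or_eq_neg.1 h2 with h | h
    · rwa [← h]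
    · have := Dneg hα
      rwa [h, neg_neg] at this
  -- existence of `ε`
  obtain ⟨ε, hε, hεA⟩ : ∃ ε ∈ D Q, ε ∉ A0 := by
    by_contra hcon
    push Not at hcon
    have := Finset.card_le_card (show D Q ⊆ A0 from hcon)
    omega
  obtain ⟨ε0, yε, hyε⟩ := mem_D.1 hε
  have hεK : ε ∉ K := fun h => hεA ((memA0 _).2 ⟨h, ε0⟩)
  have hε2 : ε ^ 2 ∈ K := ((memA0 _).1 (hsub (Finset.mem_image_of_mem _ hε))).1
  have hεD : ∀ e ∈ A0, ε * e ∈ D Q := fun e he => Dmul hε (hAD e he)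
  have hD : D Q = A0 ∪ A0.image fun e => ε * e := by
    refine (Finset.eq_of_subset_of_card_le ?_ ?_).symm
    · refine Finset.union_subset hAD ?_
      intro x hx
      obtain ⟨e, he, rfl⟩ := Finset.mem_image.1 hx
      exact hεD e he
    · rw [Finset.card_union_of_disjoint, Finset.card_image_of_injective _
        (mul_right_injective₀ ε0)]
      · have := Finset.card_le_card hsub
        omega
      · rw [Finset.disjoint_left]
        intro x hx hx'
        obtain ⟨e, he, rfl⟩ := Finset.mem_image.1 hx'
        have h1 := (memA0 _).1 hx
        have h2 := (memA0 _).1 he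
        apply hεK
        have := K.div_mem h1.1 h2.1
        rwa [mul_div_cancel_right₀ _ h2.2] at this
  refine ⟨ε, hεK, hε2, ⟨yε, hyε⟩, fun α => ?_⟩
  rw [hD, Finset.mem_union, memA0, Finset.mem_image]
  constructor
  · rintro (h | ⟨e, he, rfl⟩)
    · exact ⟨h.2, Or.inl h.1⟩
    · have := (memA0 _).1 he
      exact ⟨mul_ne_zero ε0 this.2, Or.inr ⟨e, this.1, rfl⟩⟩
  · rintro ⟨h0, h | ⟨e, he, rfl⟩⟩
    · exact Or.inl ⟨h, h0⟩
    · exact Or.inr ⟨e, (memA0 _).2 ⟨he, right_ne_zero_of_mul h0⟩, rfl⟩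

end GrpQ


namespace GrpQ

variable {F : Type*} [Field F] {Q : F → F → F → F → Prop}

open Classical in
/-- Nonzero `e ∈ K` with `e t - e² X - W ∈ K`. -/
noncomputable def Sol [Fintype F] (K : Subfield F) (t X W : F) : Finset F :=
  Finset.univ.filter fun e => (e ∈ K ∧ e ≠ 0) ∧ e * t - e ^ 2 * X - W ∈ K

theorem mem_Sol [Fintype F] {K : Subfield F} {t X W e : F} :
    e ∈ Sol K t X W ↔ (e ∈ K ∧ e ≠ 0) ∧ e * t - e ^ 2 * X - W ∈ K := by
  simp [Sol]

theorem mem_of_mul_mem {K : Subfield F} {e x : F} (he : e ∈ K) (h0 : e ≠ 0) (h : e * x ∈ K) :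
    x ∈ K := by
  have := K.mul_mem (K.inv_mem he) h
  rwa [inv_mul_cancel_left₀ h0] at this

/-- Consequence of having two distinct solutions. -/
theorem two_sol [Fintype F] {K : Subfield F} {t X W e f : F} (he : e ∈ Sol K t X W)
    (hf : f ∈ Sol K t X W) (hne : e ≠ f) : t - (e + f) * X ∈ K ∧ W - e * f * X ∈ K := by
  obtain ⟨⟨h1, h2⟩, h3⟩ := mem_Sol.1 he
  obtain ⟨⟨h1', h2'⟩, h3'⟩ := mem_Sol.1 hf
  have h4 : t - (e + f) * X ∈ K := by
    refine mem_of_mul_mem (K.sub_mem h1 h1') (sub_ne_zero.2 hne) ?_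
    have := K.sub_mem h3 h3'
    convert this using 1
    ring
  refine ⟨h4, ?_⟩
  have := K.sub_mem (K.mul_mem h1 h4) h3
  convert this using 1
  ring

theorem Sol_card_le_two [Fintype F] {K : Subfield F} {t X W : F} (ht : t ∉ K) :
    (Sol K t X W).card ≤ 2 := by
  by_contra hcon
  push Not at hcon
  obtain ⟨a, b, c, ha, hb, hc, hab, hac, hbc⟩ := Finset.two_lt_card_iff.1 hcon
  have h1 := (two_sol ha hb hab).1
  have h2 := (two_sol ha hc hac).1
  have hX : X ∈ K := by
    refine mem_of_mul_mem (K.sub_mem (mem_Sol.1 hb).1.1 (mem_Sol.1 hc).1.1) (sub_ne_zero.2 hbc) ?_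
    have := K.sub_mem h2 h1
    convert this using 1
    ring
  apply ht
  have := K.add_mem h1 (K.mul_mem (K.add_mem (mem_Sol.1 ha).1.1 (mem_Sol.1 hb).1.1) hX)
  convert this using 1
  ring

theorem Sol_card_le_two' [Fintype F] {K : Subfield F} {t X W : F} (ht : t ∈ K)
    (h : ¬ (X ∈ K ∧ W ∈ K)) : (Sol K t X W).card ≤ 2 := by
  by_contra hcon
  push Not at hcon
  obtain ⟨a, b, c, ha, hb, hc, hab, hac, hbc⟩ := Finset.two_lt_card_iff.1 hcon
  have h1 := two_sol ha hb hab
  have h2 := two_sol ha hc hac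
  have hX : X ∈ K := by
    refine mem_of_mul_mem (K.sub_mem (mem_Sol.1 hb).1.1 (mem_Sol.1 hc).1.1) (sub_ne_zero.2 hbc) ?_
    have := K.sub_mem h2.1 h1.1
    convert this using 1
    ring
  apply h
  refine ⟨hX, ?_⟩
  have := K.add_mem h1.2 (K.mul_mem (K.mul_mem (mem_Sol.1 ha).1.1 (mem_Sol.1 hb).1.1) hX)
  convert this using 1
  ring

theorem Sol_empty [Fintype F] {K : Subfield F} {t X W : F} (ht : t ∉ K)
    (hX : X ∈ K) (hW : W ∈ K) : (Sol K t X W).card = 0 := by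
  rw [Finset.card_eq_zero, Finset.eq_empty_iff_forall_notMem]
  intro e he
  obtain ⟨⟨h1, h2⟩, h3⟩ := mem_Sol.1 he
  apply ht
  refine mem_of_mul_mem h1 h2 ?_
  have := K.add_mem (K.add_mem h3 (K.mul_mem (K.pow_mem h1 2) hX)) hW
  convert this using 1
  ring

theorem Sol_card_le [Fintype F] {K : Subfield F} {t X W : F} :
    (Sol K t X W).card ≤ Nat.card K - 1 := by
  classical
  have : Nat.card K = Nat.card K.toSubring.toAddSubgroup := rfl
  rw [this, ← card_addSubgroup]
  refine Finset.card_le_card fun e he => ?_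
  have := (mem_Sol.1 he).1
  simpa using this

/-- The hypotheses of the second case. -/
structure Two [Fintype F] (Q : F → F → F → F → Prop) (K : Subfield F) (ε : F) : Prop where
  grp : GrpQ Q
  two : (2 : F) ≠ 0
  memK : ∀ x, x ∈ K ↔ Q 1 x 0 1
  eps : ε ∉ K
  eps2 : ε ^ 2 ∈ K
  diag : ∀ α ∈ D Q, Q α 0 0 α⁻¹
  memD : ∀ α, α ∈ D Q ↔ α ≠ 0 ∧ (α ∈ K ∨ ∃ e ∈ K, α = ε * e)

namespace Two

variable [Fintype F] {K : Subfield F} {ε : F}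

theorem eps0 (h : Two Q K ε) : ε ≠ 0 := by
  rintro rfl
  exact h.eps K.zero_mem

theorem card_eq (h : Two Q K ε) : Nat.card h.grp.A = Nat.card K :=
  Nat.card_congr (Equiv.subtypeEquivRight fun x => (h.memK x).symm)

theorem fib_le (h : Two Q K ε) {x y c w : F} (hq : Q x y c w) (hc : c ≠ 0) :
    (Nf Q (w / c)).card ≤ (Sol K (2 / c) (x / c) (w / c)).card +
      (Sol K (2 * ε / c) (ε ^ 2 * x / c) (w / c)).card := by
  classical
  have hinj : (Nf Q (w / c)).card = ((Nf Q (w / c)).image fun t => c / t.1).card := by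
    rw [Finset.card_image_of_injOn]
    intro t ht t' ht' he
    obtain ⟨h1, h2⟩ := mem_Nf.1 ht
    obtain ⟨h1', h2'⟩ := mem_Nf.1 ht'
    have h3 := (mem_Z.1 h1).1
    have h3' := (mem_Z.1 h1').1
    have e1 : t.1 = t'.1 := by
      simp only at he
      field_simp at he
      exact he.symm
    have e2 : t.2 = t'.2 := by
      rw [div_eq_iff h3] at h2
      rw [div_eq_iff h3'] at h2'
      rw [h2, h2', e1]
    exact Prod.ext e1 e2
  rw [hinj]
  have hsub : ((Nf Q (w / c)).image fun t => c / t.1) ⊆ Sol K (2 / c) (x / c) (w / c) ∪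
      (Sol K (2 * ε / c) (ε ^ 2 * x / c) (w / c)).image fun e => ε * e := by
    intro α hα
    obtain ⟨t, ht, rfl⟩ := Finset.mem_image.1 hα
    obtain ⟨h1, h2⟩ := mem_Nf.1 ht
    obtain ⟨h3, x', y', h4, h5⟩ := mem_Z.1 h1
    have hD := h.grp.ratio_mem_D hq h4 hc h3 h2
    generalize hα' : c / t.1 = α at hD
    have ht1 : t.1 = α⁻¹ * c := by rw [← hα']; field_simp
    have hα0 := ((h.memD α).1 hD).1
    have ht2 : t.2 = α⁻¹ * w := by
      rw [div_eq_iff h3, ht1] at h2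
      rw [h2]; field_simp
    rw [ht1, ht2] at h4
    rw [ht2] at h5
    obtain ⟨a, ha, hx⟩ := h.grp.same_row (c := α⁻¹ * c) (w := α⁻¹ * w)
      (cast (h.grp.mul (h.diag α hD) hq) rfl rfl (by ring) (by ring)) h4
    have haK : a ∈ K := (h.memK a).2 ha
    have key : α * (2 / c) - α ^ 2 * (x / c) - w / c = a := by
      field_simp
      field_simp at hx h5
      linear_combination hx - h5
    rw [Finset.mem_union]
    rcases ((h.memD α).1 hD).2 with hK | ⟨e, he, rfl⟩
    · left
      rw [mem_Sol, key]
      exact ⟨⟨hK, hα0⟩, haK⟩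
    · right
      refine Finset.mem_image.2 ⟨e, ?_, rfl⟩
      rw [mem_Sol]
      refine ⟨⟨he, right_ne_zero_of_mul hα0⟩, ?_⟩
      convert haK using 1
      rw [← key]
      ring
  exact (Finset.card_le_card hsub).trans ((Finset.card_union_le _ _).trans
    (Nat.add_le_add_left Finset.card_image_le _))

theorem mem_two_div (h : Two Q K ε) {z : F} (hz : 2 * z ∈ K) : z ∈ K := by
  refine mem_of_mul_mem (K := K) (e := 2) ?_ h.two hz
  exact_mod_cast natCast_mem K 2

theorem Sol_add_le (h : Two Q K ε) (hk : 5 ≤ Nat.card K) {x c w : F} (hc : c ≠ 0) :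
    (Sol K (2 / c) (x / c) (w / c)).card + (Sol K (2 * ε / c) (ε ^ 2 * x / c) (w / c)).card
      ≤ Nat.card K - 1 := by
  have h2K : (2 : F) ∈ K := by exact_mod_cast natCast_mem K 2
  have hXX : ε ^ 2 * x / c ∈ K ↔ x / c ∈ K := by
    rw [mul_div_assoc]
    exact ⟨fun hh => mem_of_mul_mem h.eps2 (pow_ne_zero _ h.eps0) hh, fun hh => K.mul_mem h.eps2 hh⟩
  by_cases h1 : 2 / c ∈ K
  · have h2 : 2 * ε / c ∉ K := by
      intro h2
      apply h.eps
      have := K.div_mem h2 h1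
      have h3 : (2 * ε / c) / (2 / c) = ε := by have := h.two; field_simp
      rwa [h3] at this
    by_cases hXW : x / c ∈ K ∧ w / c ∈ K
    · rw [Sol_empty h2 (hXX.2 hXW.1) hXW.2]
      exact Sol_card_le
    · have a := Sol_card_le_two' h1 hXW
      have b := Sol_card_le_two (X := ε ^ 2 * x / c) (W := w / c) h2
      omega
  · have a := Sol_card_le_two (X := x / c) (W := w / c) h1
    by_cases h2 : 2 * ε / c ∈ K
    · by_cases hXW : x / c ∈ K ∧ w / c ∈ K
      · rw [Sol_empty h1 hXW.1 hXW.2, zero_add]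
        exact Sol_card_le
      · have b := Sol_card_le_two' (X := ε ^ 2 * x / c) (W := w / c) h2 (by rwa [hXX])
        omega
    · have b := Sol_card_le_two (X := ε ^ 2 * x / c) (W := w / c) h2
      omega

theorem Sol_add_lt (h : Two Q K ε) (hk : 5 ≤ Nat.card K) (hk6 : Nat.card K ≠ 6) {x c w : F}
    (h1 : 2 / c ∉ K) (h2 : 2 * ε / c ∉ K) :
    (Sol K (2 / c) (x / c) (w / c)).card + (Sol K (2 * ε / c) (ε ^ 2 * x / c) (w / c)).card
      < Nat.card K - 1 := by
  have a := Sol_card_le_two (X := x / c) (W := w / c) h1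
  have b := Sol_card_le_two (X := ε ^ 2 * x / c) (W := w / c) h2
  by_contra hcon
  have hk5 : Nat.card K = 5 := by omega
  obtain ⟨e, e', he, he', hne⟩ := Finset.one_lt_card_iff.1
    (show 1 < (Sol K (2 / c) (x / c) (w / c)).card by omega)
  obtain ⟨f, f', hf, hf', hnf⟩ := Finset.one_lt_card_iff.1
    (show 1 < (Sol K (2 * ε / c) (ε ^ 2 * x / c) (w / c)).card by omega)
  have p1 := two_sol he he' hne
  have p2 := two_sol hf hf' hnf
  obtain ⟨ee, e0⟩ := (mem_Sol.1 he).1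
  obtain ⟨ee', e0'⟩ := (mem_Sol.1 he').1
  obtain ⟨ff, f0⟩ := (mem_Sol.1 hf).1
  obtain ⟨ff', f0'⟩ := (mem_Sol.1 hf').1
  have h4 : ∀ g ∈ K, g ≠ 0 → g ^ 4 = 1 := by
    intro g hg g0
    haveI : Fintype K := Fintype.ofFinite K
    have := FiniteField.pow_card_sub_one_eq_one (K := K) ⟨g, hg⟩
      (fun hh => g0 (congrArg Subtype.val hh))
    rw [← Nat.card_eq_fintype_card, hk5] at this
    exact congrArg Subtype.val this
  have hX : x / c ∉ K := by
    intro hX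
    apply h1
    have := K.add_mem p1.1 (K.mul_mem (K.add_mem ee ee') hX)
    rwa [sub_add_cancel] at this
  have hmul : e * e' = f * f' * ε ^ 2 := by
    by_contra hne'
    apply hX
    refine mem_of_mul_mem (e := e * e' - f * f' * ε ^ 2)
      (K.sub_mem (K.mul_mem ee ee') (K.mul_mem (K.mul_mem ff ff') h.eps2)) (sub_ne_zero.2 hne') ?_
    have := K.sub_mem p2.2 p1.2
    convert this using 1
    ring
  have hsum : ∀ {e e' t X : F}, t ∉ K → t - (e + e') * X ∈ K → e + e' ≠ 0 := by
    intro e e' t X ht hh h0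
    rw [h0, zero_mul, sub_zero] at hh
    exact ht hh
  have hsq : ∀ {e e' : F}, e ∈ K → e' ∈ K → e ≠ 0 → e' ≠ 0 → e ≠ e' → e + e' ≠ 0 →
      (e * e') ^ 2 = -1 := by
    intro e e' he he' h0 h0' hne hs
    have q1 := h4 e he h0
    have q2 := h4 e' he' h0'
    have q3 : (e - e') * (e + e') * (e ^ 2 + e' ^ 2) = 0 := by linear_combination q1 - q2
    have q4 : e ^ 2 + e' ^ 2 = 0 := by
      rcases mul_eq_zero.1 q3 with q | q
      · rcases mul_eq_zero.1 q with q | q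
        · exact absurd (sub_eq_zero.1 q) hne
        · exact absurd q hs
      · exact q
    linear_combination e ^ 2 * q4 - q1
  have r1 := hsq ee ee' e0 e0' hne (hsum h1 p1.1)
  have r2 := hsq ff ff' f0 f0' hnf (hsum h2 p2.1)
  have r3 : ε ^ 4 = 1 := by
    rw [hmul, mul_pow, r2] at r1
    linear_combination -r1
  have r4 : (ε ^ 2 - 1) * (ε ^ 2 + 1) = 0 := by linear_combination r3
  rcases mul_eq_zero.1 r4 with q | q
  · have : (ε - 1) * (ε + 1) = 0 := by linear_combination q
    rcases mul_eq_zero.1 this with q | q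
    · apply h.eps
      rw [sub_eq_zero.1 q]; exact K.one_mem
    · apply h.eps
      rw [eq_neg_of_add_eq_zero_left q]; exact K.neg_mem K.one_mem
  · -- `the square of the product = -1 = ε²`
    have : (ε - e * e') * (ε + e * e') = 0 := by linear_combination q - r1
    rcases mul_eq_zero.1 this with q | q
    · apply h.eps
      rw [sub_eq_zero.1 q]; exact K.mul_mem ee ee'
    · apply h.eps
      rw [eq_neg_of_add_eq_zero_left q]; exact K.neg_mem (K.mul_mem ee ee')

theorem big (h : Two Q K ε) (hk : 5 ≤ Nat.card K) (hk6 : Nat.card K ≠ 6) {x y c w : F}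
    (hq : Q x y c w) (hc : c ≠ 0) : 2 / c ∈ K ∨ 2 * ε / c ∈ K := by
  by_contra hcon
  push Not at hcon
  have h1 : (Nf Q (w / c)).card < Nat.card K - 1 :=
    (h.fib_le hq hc).trans_lt (h.Sol_add_lt hk hk6 hcon.1 hcon.2)
  have h2 : ∀ ρ ∈ Om Q, (Nf Q ρ).card ≤ Nat.card K - 1 := by
    intro ρ hρ
    obtain ⟨x, y, c, hc, hq⟩ := mem_Om.1 hρ
    have := (h.fib_le hq hc).trans (h.Sol_add_le hk hc)
    rwa [mul_div_cancel_right₀ _ hc] at this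
  have h3 := h.grp.lower
  rw [h.card_eq, ← smul_eq_mul, ← Finset.sum_const] at h3
  have := Finset.sum_lt_sum h2 ⟨_, mem_Om_of hq hc, h1⟩
  omega

theorem big_mem (h : Two Q K ε) (hk : 5 ≤ Nat.card K) (hk6 : Nat.card K ≠ 6) {x y μ w : F}
    (hq : Q x y μ w) (hμ : μ ≠ 0) (htr : x + w = 2) : μ ∈ K := by
  have h2K : (2 : F) ∈ K := by exact_mod_cast natCast_mem K 2
  have h20 := h.two
  by_contra hμK
  have hc : μ * (2 + μ) ≠ 0 := by
    refine mul_ne_zero hμ fun h0 => hμK ?_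
    rw [eq_neg_of_add_eq_zero_right h0]
    exact K.neg_mem h2K
  have hq' := cast (c' := μ * (2 + μ)) (h.grp.mul (h.grp.mul hq h.grp.e1) hq) rfl rfl
    (by linear_combination μ * htr) rfl
  have key : ∀ z : F, z ≠ 0 → ∀ θ : F, 2 * θ / z ∈ K → ∀ e : F, z = θ * e → e ∈ K := by
    rintro z hz θ hh e rfl
    have h1 : e ≠ 0 := right_ne_zero_of_mul hz
    have h2 : θ ≠ 0 := left_ne_zero_of_mul hz
    have h3 : 2 * θ / (θ * e) = 2 * e⁻¹ := by field_simp
    rw [h3] at hh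
    have := K.inv_mem (h.mem_two_div hh)
    rwa [inv_inv] at this
  rcases h.big hk hk6 hq hμ with h1 | h1
  · exact hμK (key μ hμ 1 (by rwa [mul_one]) μ (by ring))
  · have e0 := h.eps0
    have hs := key μ hμ ε h1 (μ / ε) (by field_simp)
    set s := μ / ε with hsdef
    have hμs : μ = ε * s := by rw [hsdef]; field_simp
    have hs0 : s ≠ 0 := fun h0 => hμ (by rw [hμs, h0, mul_zero])
    rcases h.big hk hk6 hq' hc with h3 | h3
    · have h4 := key _ hc 1 (by rwa [mul_one]) (μ * (2 + μ)) (by ring)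
      apply h.eps
      refine mem_of_mul_mem (e := 2 * s) (K.mul_mem h2K hs) (mul_ne_zero h20 hs0) ?_
      have := K.sub_mem h4 (K.mul_mem h.eps2 (K.pow_mem hs 2))
      convert this using 1
      rw [hμs]; ring
    · have h4 := key _ hc ε h3 (2 * s + ε * s ^ 2) (by rw [hμs]; ring)
      apply h.eps
      refine mem_of_mul_mem (e := s ^ 2) (K.pow_mem hs 2) (pow_ne_zero _ hs0) ?_
      have := K.sub_mem h4 (K.mul_mem h2K hs)
      convert this using 1
      ring

end Two

end GrpQ


namespace GrpQ

variable {F : Type*} [Field F] {Q : F → F → F → F → Prop}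

namespace Two

variable [Fintype F] {K : Subfield F} {ε : F}

theorem k3_cases (h : Two Q K ε) (hk : Nat.card K = 3) {x : F} (hx : x ∈ K) :
    x = 0 ∨ x = 1 ∨ x = -1 := by
  by_cases h0 : x = 0
  · exact Or.inl h0
  right
  have : Fintype K := Fintype.ofFinite K
  have h1 := FiniteField.pow_card_sub_one_eq_one (K := K) ⟨x, hx⟩
    (fun hh => h0 (congrArg Subtype.val hh))
  rw [← Nat.card_eq_fintype_card, hk] at h1
  have h2 : x ^ 2 = 1 := congrArg Subtype.val h1
  have h3 : (x - 1) * (x + 1) = 0 := by linear_combination h2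
  rcases mul_eq_zero.1 h3 with q | q
  · exact Or.inl (sub_eq_zero.1 q)
  · exact Or.inr (eq_neg_of_add_eq_zero_left q)

theorem k3_char (h : Two Q K ε) (hk : Nat.card K = 3) : (3 : F) = 0 := by
  have h2K : (2 : F) ∈ K := by exact_mod_cast natCast_mem K 2
  rcases h.k3_cases hk h2K with q | q | q
  · exact absurd q h.two
  · exfalso
    have : (1 : F) = 0 := by linear_combination q
    exact one_ne_zero this
  · linear_combination q

theorem k3_eps (h : Two Q K ε) (hk : Nat.card K = 3) : ε ^ 2 = -1 := by
  rcases h.k3_cases hk h.eps2 with q | q | q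
  · exact absurd (pow_eq_zero_iff (two_ne_zero)|>.1 q) h.eps0
  · exfalso
    have h3 : (ε - 1) * (ε + 1) = 0 := by linear_combination q
    apply h.eps
    rcases mul_eq_zero.1 h3 with q | q
    · rw [sub_eq_zero.1 q]; exact K.one_mem
    · rw [eq_neg_of_add_eq_zero_left q]; exact K.neg_mem K.one_mem
  · exact q

open Classical in
/-- Indicator. -/
noncomputable def ind (P : Prop) : ℕ := if P then 1 else 0

theorem ind_pos {P : Prop} (h : P) : ind P = 1 := by simp [ind, h]
theorem ind_neg {P : Prop} (h : ¬ P) : ind P = 0 := by simp [ind, h]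
theorem ind_le {P : Prop} : ind P ≤ 1 := by unfold ind; split_ifs <;> simp

theorem k3_Sol (h : Two Q K ε) (hk : Nat.card K = 3) {t X W : F} {P P' : Prop}
    (h1 : t - X - W ∈ K → P) (h2 : -t - X - W ∈ K → P') :
    (Sol K t X W).card ≤ ind P + ind P' := by
  classical
  have hs : Sol K t X W ⊆ (if P then {1} else ∅) ∪ (if P' then {-1} else ∅) := by
    intro e he
    obtain ⟨⟨e1, e2⟩, e3⟩ := mem_Sol.1 he
    rw [Finset.mem_union]
    rcases h.k3_cases hk e1 with q | q | q
    · exact absurd q e2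
    · left
      subst q
      rw [if_pos (h1 (by convert e3 using 1; ring))]; simp
    · right
      subst q
      rw [if_pos (h2 (by convert e3 using 1; ring))]; simp
  refine (Finset.card_le_card hs).trans ((Finset.card_union_le _ _).trans ?_)
  unfold ind
  split_ifs <;> simp

theorem k3_fib (h : Two Q K ε) (hk : Nat.card K = 3) {x y c w : F} (hq : Q x y c w) (hc : c ≠ 0) :
    (Nf Q (w / c)).card ≤ ind ((x + w + 1) / c ∈ K) + ind ((x + w - 1) / c ∈ K)
      + (ind ((x - w - ε) / c ∈ K) + ind ((x - w + ε) / c ∈ K)) := by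
  have h3 := h.k3_char hk
  have he := h.k3_eps hk
  refine (h.fib_le hq hc).trans (Nat.add_le_add (h.k3_Sol hk ?_ ?_) (h.k3_Sol hk ?_ ?_))
  · intro hh
    convert K.neg_mem hh using 1
    field_simp
    linear_combination h3
  · intro hh
    convert K.neg_mem hh using 1
    field_simp
    linear_combination -h3
  · intro hh
    convert hh using 1
    field_simp
    linear_combination -ε * h3 + x * he
  · intro hh
    convert hh using 1
    field_simp
    linear_combination ε * h3 + x * he

theorem k3_P1 (h : Two Q K ε) (hk : Nat.card K = 3) {t c : F} (hc : c ≠ 0)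
    (h1 : (t + 1) / c ∈ K) (h2 : (t - 1) / c ∈ K) : c ∈ K ∧ t ∈ K := by
  have h3 : c ∈ K := by
    have := K.inv_mem (h.mem_two_div (z := 1 / c) (by convert K.sub_mem h1 h2 using 1; ring))
    rwa [one_div, inv_inv] at this
  refine ⟨h3, ?_⟩
  convert K.sub_mem (K.mul_mem h1 h3) K.one_mem using 1
  field_simp
  ring

theorem k3_P2 (h : Two Q K ε) (hk : Nat.card K = 3) {t c : F} (hc : c ≠ 0)
    (h1 : (t - ε) / c ∈ K) (h2 : (t + ε) / c ∈ K) : ε * c ∈ K ∧ ε * t ∈ K := by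
  have he := h.k3_eps hk
  have e0 := h.eps0
  have h4 : ε / c ∈ K := h.mem_two_div (z := ε / c) (by convert K.sub_mem h2 h1 using 1; ring)
  have h3 : ε * c ∈ K := by
    have := K.neg_mem (K.inv_mem h4)
    convert this using 1
    field_simp
    linear_combination he
  refine ⟨h3, ?_⟩
  convert K.add_mem (K.mul_mem h1 h3) h.eps2 using 1
  field_simp
  ring

/-- The subfield of all `x` with `x ^ 9 = x`. -/
def K9 (h : Two Q K ε) (hk : Nat.card K = 3) : Subfield F where
  carrier := {x | x ^ 9 = x}
  zero_mem' := by simp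
  one_mem' := by simp
  add_mem' := by
    intro a b ha hb
    simp only [Set.mem_ofPred_eq] at *
    have h3 := h.k3_char hk
    have : (a + b) ^ 9 = a ^ 9 + b ^ 9 := by
      linear_combination (3*a^8*b + 12*a^7*b^2 + 28*a^6*b^3 + 42*a^5*b^4 + 42*a^4*b^5
        + 28*a^3*b^6 + 12*a^2*b^7 + 3*a*b^8) * h3
    rw [this, ha, hb]
  neg_mem' := by
    intro a ha
    simp only [Set.mem_ofPred_eq] at *
    linear_combination -ha
  mul_mem' := by
    intro a b ha hb
    simp only [Set.mem_ofPred_eq] at *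
    rw [mul_pow, ha, hb]
  inv_mem' := by
    intro a ha
    simp only [Set.mem_ofPred_eq] at *
    rw [inv_pow, ha]

theorem mem_K9 (h : Two Q K ε) (hk : Nat.card K = 3) {x : F} : x ∈ h.K9 hk ↔ x ^ 9 = x := Iff.rfl

theorem K_le (h : Two Q K ε) (hk : Nat.card K = 3) {x : F} (hx : x ∈ K) : x ∈ h.K9 hk := by
  rcases h.k3_cases hk hx with rfl | rfl | rfl
  · exact zero_mem _
  · exact one_mem _
  · exact neg_mem (one_mem _)

theorem eps_K9 (h : Two Q K ε) (hk : Nat.card K = 3) : ε ∈ h.K9 hk := by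
  rw [mem_K9]
  have he := h.k3_eps hk
  have : ε ^ 9 = (ε ^ 2) ^ 4 * ε := by ring
  rw [this, he]; ring

theorem K_le_eps (h : Two Q K ε) (hk : Nat.card K = 3) {x : F} (hx : ε * x ∈ K) : x ∈ h.K9 hk := by
  have h1 := (h.K9 hk).div_mem (h.K_le hk hx) (h.eps_K9 hk)
  have e0 := h.eps0
  rwa [mul_div_cancel_left₀ _ e0] at h1

/-- Generic elements. -/
theorem k3_generic (h : Two Q K ε) (hk : Nat.card K = 3) {x y c w : F} (hq : Q x y c w)
    (hc : c ∉ K) (hc' : ε * c ∉ K) : (Nf Q (w / c)).card ≤ 2 ∧ ((Nf Q (w / c)).card = 2 →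
      ((x + w + 1) / c ∈ K ∨ (x + w - 1) / c ∈ K) ∧
      ((x - w - ε) / c ∈ K ∨ (x - w + ε) / c ∈ K)) := by
  have c0 : c ≠ 0 := by rintro rfl; exact hc K.zero_mem
  have h1 := h.k3_fib hk hq c0
  have p1 : ¬ ((x + w + 1) / c ∈ K ∧ (x + w - 1) / c ∈ K) := fun hh =>
    hc (h.k3_P1 hk c0 hh.1 hh.2).1
  have p2 : ¬ ((x - w - ε) / c ∈ K ∧ (x - w + ε) / c ∈ K) := fun hh =>
    hc' (h.k3_P2 hk c0 hh.1 hh.2).1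
  generalize ((x + w + 1) / c ∈ K) = P1 at *
  generalize ((x + w - 1) / c ∈ K) = P2 at *
  generalize ((x - w - ε) / c ∈ K) = P3 at *
  generalize ((x - w + ε) / c ∈ K) = P4 at *
  generalize (Nf Q (w / c)).card = N at *
  clear hq c0
  unfold ind at h1
  split_ifs at h1 <;> grind

theorem k3_three (h : Two Q K ε) (hk : Nat.card K = 3) {x y c w : F} (hq : Q x y c w)
    (c0 : c ≠ 0) : (Nf Q (w / c)).card ≤ 2 ∨ (Nf Q (w / c)).card = 3 ∧
      ((c ∈ K ∧ x + w ∈ K ∧ ((x - w - ε) / c ∈ K ∨ (x - w + ε) / c ∈ K)) ∨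
      (ε * c ∈ K ∧ ε * (x - w) ∈ K ∧ ((x + w + 1) / c ∈ K ∨ (x + w - 1) / c ∈ K))) := by
  have h1 := h.k3_fib hk hq c0
  have p1 : ((x + w + 1) / c ∈ K ∧ (x + w - 1) / c ∈ K) → c ∈ K ∧ x + w ∈ K := fun hh =>
    (h.k3_P1 hk c0 hh.1 hh.2)
  have p2 : ((x - w - ε) / c ∈ K ∧ (x - w + ε) / c ∈ K) → ε * c ∈ K ∧ ε * (x - w) ∈ K := fun hh =>
    (h.k3_P2 hk c0 hh.1 hh.2)
  have p3 : ¬ (c ∈ K ∧ ε * c ∈ K) := by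
    rintro ⟨a, b⟩
    apply h.eps
    refine mem_of_mul_mem a c0 ?_
    rwa [mul_comm]
  generalize ((x + w + 1) / c ∈ K) = P1 at *
  generalize ((x + w - 1) / c ∈ K) = P2 at *
  generalize ((x - w - ε) / c ∈ K) = P3 at *
  generalize ((x - w + ε) / c ∈ K) = P4 at *
  generalize (c ∈ K) = P5 at *
  generalize (ε * c ∈ K) = P6 at *
  generalize (Nf Q (w / c)).card = N at *
  clear hq c0
  unfold ind at h1
  split_ifs at h1 <;> grind

end Two

end GrpQ


namespace GrpQ

variable {F : Type*} [Field F] {Q : F → F → F → F → Prop}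

namespace Two

variable [Fintype F] {K : Subfield F} {ε : F}

theorem k3_lower (h : Two Q K ε) (hk : Nat.card K = 3) :
    ∑ ρ ∈ Om Q, 2 ≤ ∑ ρ ∈ Om Q, (Nf Q ρ).card := by
  have h3 := h.grp.lower
  rw [h.card_eq, hk] at h3
  simpa using h3

theorem k3_noIII (h : Two Q K ε) (hk : Nat.card K = 3)
    (hN : ∀ ρ ∈ Om Q, (Nf Q ρ).card ≤ 2) {x y μ w : F} (hq : Q x y μ w) (hμ : μ ≠ 0)
    (htr : x + w = 2) : μ ∈ h.K9 hk := by
  have h3 := h.k3_char hk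
  have hdet := h.grp.det hq
  have hall : ∀ ρ ∈ Om Q, (Nf Q ρ).card = 2 := by
    have h1 := h.k3_lower hk
    have h2 := (Finset.sum_eq_sum_iff_of_le hN).1 (le_antisymm (Finset.sum_le_sum hN) h1)
    exact h2
  by_contra hcon
  have hμK : μ ∉ K := fun hh => hcon (h.K_le hk hh)
  have key : ∀ l : F, Q 1 l 0 1 → (l = 1 ∨ l = -1) → μ * (2 + l * μ) ∈ h.K9 hk := by
    intro l hl hl1
    have hlK : l ∈ K := by rcases hl1 with rfl | rfl; exacts [K.one_mem, K.neg_mem K.one_mem]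
    have hll : l * l = 1 := by rcases hl1 with rfl | rfl <;> ring
    have hμ' : ∀ {z}, z ∈ K → l * μ = z → μ ∈ K := by
      intro z hz hh
      have := K.mul_mem hlK hz
      convert this using 1
      linear_combination l * hh - μ * hll
    have hc0 : 2 + l * μ ≠ 0 := by
      intro h0
      refine hμK (hμ' (K.one_mem) ?_)
      linear_combination h0 - h3
    have hprod := h.grp.mul (h.grp.mul hq hl) hq
    have hcc : (μ * 1 + w * 0) * x + (μ * l + w * 1) * μ = μ * (2 + l * μ) := by
      linear_combination μ * htr
    rw [hcc] at hprod
    by_contra hnot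
    have g := h.k3_generic hk hprod (fun hh => hnot (h.K_le hk hh))
      (fun hh => hnot (h.K_le_eps hk hh))
    have htrace : (x * 1 + y * 0) * x + (x * l + y * 1) * μ + ((μ * 1 + w * 0) * y + (μ * l + w * 1) * w)
        = 2 + 2 * l * μ := by
      linear_combination (x + w + 2 + l * μ) * htr - 2 * hdet
    rcases (g.2 (hall _ (mem_Om_of hprod (mul_ne_zero hμ hc0)))).1 with g | g
    · rw [htrace] at g
      apply hμK
      have e : (2 + 2 * l * μ + 1) / (μ * (2 + l * μ)) = (-l) / (2 + l * μ) := by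
        field_simp
        linear_combination (1 + μ * l) * h3
      rw [e] at g
      have l0 : l ≠ 0 := by rintro rfl; simp at hll
      have g1 := K.inv_mem (mem_of_mul_mem (K.neg_mem hlK) (neg_ne_zero.2 l0)
        (by rwa [div_eq_mul_inv] at g))
      rw [inv_inv] at g1
      refine hμ' (K.add_mem g1 K.one_mem) ?_
      linear_combination -h3
    · rw [htrace] at g
      apply hμK
      have e : (2 + 2 * l * μ - 1) / (μ * (2 + l * μ)) = - μ⁻¹ := by
        field_simp
        linear_combination (1 + μ * l) * h3
      rw [e] at g
      have := K.inv_mem (K.neg_mem g)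
      rwa [neg_neg, inv_inv] at this
  have k1 := key 1 h.grp.e1 (Or.inl rfl)
  have k2 := key (-1) ((h.grp).A_neg h.grp.e1) (Or.inr rfl)
  apply hcon
  convert (h.K9 hk).add_mem k1 k2 using 1
  linear_combination -μ * h3

theorem k3_normal (h : Two Q K ε) (hk : Nat.card K = 3) {ρ : F} (hρ : ρ ∈ Om Q)
    (hN : ¬ (Nf Q ρ).card ≤ 2) : (Nf Q ρ).card = 3 ∧ ∃ x y w, Q x y 1 w ∧ ρ = w ∧
      x + w ∈ K ∧ (x - w - ε ∈ K ∨ x - w + ε ∈ K) := by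
  have he := h.k3_eps hk
  have e0 := h.eps0
  obtain ⟨x, y, c, c0, hq⟩ := mem_Om.1 hρ
  set w := ρ * c with hw
  have hρ' : w / c = ρ := by rw [hw]; field_simp
  -- reduction to `c ∈ K`
  have red : (Nf Q ρ).card = 3 ∧ ∃ x y c w, c ≠ 0 ∧ Q x y c w ∧ ρ = w / c ∧ c ∈ K ∧ x + w ∈ K ∧
      (x - w - ε ∈ K ∨ x - w + ε ∈ K) := by
    have h1 := h.k3_three hk hq c0
    rw [hρ'] at h1
    rcases h1 with h1 | ⟨h1, ⟨hc, hs, hd⟩ | ⟨hc, hs, hd⟩⟩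
    · exact absurd h1 hN
    · refine ⟨h1, x, y, c, w, c0, hq, hρ'.symm, hc, hs, ?_⟩
      have : ∀ {z}, z / c ∈ K → z ∈ K := by
        intro z hz
        have := K.mul_mem hz hc
        rwa [div_mul_cancel₀ _ c0] at this
      exact hd.imp this this
    · refine ⟨h1, ?_⟩
      have hεD : -ε ∈ D Q := (h.memD _).2 ⟨neg_ne_zero.2 e0, Or.inr ⟨-1, K.neg_mem K.one_mem, by ring⟩⟩
      have hinv : (-ε)⁻¹ = ε := by
        rw [inv_eq_iff_eq_inv]
        field_simp
        linear_combination -he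
      have hm := h.grp.mul (h.diag _ hεD) hq
      rw [hinv] at hm
      refine ⟨_, _, ε * c, ε * w, mul_ne_zero e0 c0, cast hm rfl rfl (by ring) (by ring), ?_, hc, ?_, ?_⟩
      · rw [← hρ']; field_simp
      · convert K.neg_mem hs using 1; ring
      · have : ∀ {z}, z / c ∈ K → -(ε * z) ∈ K := by
          intro z hz
          have := K.neg_mem (K.mul_mem hz hc)
          convert this using 1
          field_simp
        rcases hd with hd | hd
        · left
          convert this hd using 1
          ring
        · right
          convert this hd using 1
          ring
  obtain ⟨h1, x, y, c, w, c0, hq, hρ, hc, hs, hd⟩ := red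
  refine ⟨h1, ?_⟩
  have : c = 1 ∨ c = -1 := (h.k3_cases hk hc).resolve_left c0
  rcases this with rfl | rfl
  · exact ⟨x, y, w, hq, by rw [hρ, div_one], hs, hd⟩
  · refine ⟨-x, -y, -w, cast (h.grp.neg hq) rfl rfl (by ring) rfl, by rw [hρ]; ring, ?_, ?_⟩
    · convert K.neg_mem hs using 1; ring
    · rcases hd with hd | hd
      · right
        convert K.neg_mem hd using 1; ring
      · left
        convert K.neg_mem hd using 1; ring

theorem k3_lowerE (h : Two Q K ε) (hk : Nat.card K = 3) {x y w : F} (hq : Q x y 1 w)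
    (hs : x + w ∈ K) (hd : x - w - ε ∈ K ∨ x - w + ε ∈ K) : Q 1 0 ε 1 := by
  have he := h.k3_eps hk
  have e0 := h.eps0
  have hdet := h.grp.det hq
  -- with a sign
  have gen : ∀ η : F, η = ε ∨ η = -ε → x - w - η ∈ K → Q 1 0 η 1 := by
    intro η hη hd
    have hη2 : η ^ 2 = -1 := by rcases hη with rfl | rfl; exacts [he, by rw [neg_sq, he]]
    have hη0 : η ≠ 0 := by rcases hη with rfl | rfl; exacts [e0, neg_ne_zero.2 e0]
    have h3 := h.k3_char hk
    have hx : -(x + η) ∈ K := by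
      convert K.neg_mem (K.neg_mem (K.add_mem hs hd)) using 1
      linear_combination -x * h3
    have hw : -(w - η) ∈ K := by
      convert (K.sub_mem hs hd) using 1
      linear_combination -w * h3
    have q1 := h.grp.mul (h.grp.mul ((h.memK _).1 hx) hq) ((h.memK _).1 hw)
    have q2 : Q (-η) 0 1 η := by
      refine cast q1 ?_ ?_ ?_ ?_
      · ring
      · linear_combination -hdet - hη2
      · ring
      · ring
    have hηD : η ∈ D Q := by
      refine (h.memD _).2 ⟨hη0, Or.inr ?_⟩
      rcases hη with rfl | rfl
      · exact ⟨1, K.one_mem, by ring⟩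
      · exact ⟨-1, K.neg_mem K.one_mem, by ring⟩
    have hinv : η⁻¹ = -η := by
      field_simp
      linear_combination hη2
    have q3 := h.diag _ hηD
    rw [hinv] at q3
    refine cast (h.grp.mul q2 q3) ?_ ?_ ?_ ?_
    · linear_combination -hη2
    · ring
    · ring
    · linear_combination -hη2
  rcases hd with hd | hd
  · exact gen ε (Or.inl rfl) hd
  · have := gen (-ε) (Or.inr rfl) (by rwa [sub_neg_eq_add])
    exact cast (h.grp.inv this) rfl (by ring) (by ring) rfl

/-- The fibres over `K`. -/
theorem k3_zero (h : Two Q K ε) (hk : Nat.card K = 3) (hE : Q 1 0 ε 1) {l : F} (hl : l ∈ K) :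
    l ∈ Om Q ∧ (Nf Q l).card = 0 := by
  have he := h.k3_eps hk
  have h3 := h.k3_char hk
  have e1 : 1 + ε ≠ 0 := by
    intro h0
    apply h.eps
    rw [eq_neg_of_add_eq_zero_right h0]; exact K.neg_mem K.one_mem
  have hc : -(1 + ε) ≠ 0 := neg_ne_zero.2 e1
  have q0 := h.grp.mul hE h.grp.e1
  have q1 := h.grp.mul (h.grp.mul q0 q0) ((h.memK l).1 hl)
  have q2 : Q (1 + ε) ((1 + ε) * l + 2 + ε) (-(1 + ε)) (-(1 + ε) * l) := by
    refine cast q1 ?_ ?_ ?_ ?_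
    · ring
    · ring
    · linear_combination he + ε * h3
    · linear_combination (l + 1) * he + (l * ε + ε) * h3
  have hd : -(1 + ε) * l / (-(1 + ε)) = l := by field_simp
  have h1 := h.k3_fib hk q2 hc
  have hO := mem_Om_of q2 hc
  rw [hd] at h1 hO
  refine ⟨hO, ?_⟩
  have hA : ∀ e : F, e = 1 ∨ e = -1 → ¬ ((1 + ε + -(1 + ε) * l + e) / (-(1 + ε)) ∈ K) := by
    intro e hee hh
    have eK : e ∈ K := by rcases hee with rfl | rfl; exacts [K.one_mem, K.neg_mem K.one_mem]
    have ee : e ≠ 0 := by rcases hee with rfl | rfl <;> simp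
    have : e * (1 + ε)⁻¹ ∈ K := by
      convert K.sub_mem (K.sub_mem hl K.one_mem) hh using 1
      field_simp
      ring
    have := K.inv_mem (mem_of_mul_mem eK ee this)
    rw [inv_inv] at this
    apply h.eps
    convert K.sub_mem this K.one_mem using 1
    ring
  have hB : ∀ e : F, e = 1 ∨ e = -1 → ¬ ((1 + ε - -(1 + ε) * l + e * ε) / (-(1 + ε)) ∈ K) := by
    intro e hee hh
    have eK : e ∈ K := by rcases hee with rfl | rfl; exacts [K.one_mem, K.neg_mem K.one_mem]
    have ee : e ≠ 0 := by rcases hee with rfl | rfl <;> simp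
    have : e * (ε / (1 + ε)) ∈ K := by
      convert K.sub_mem (K.sub_mem (K.neg_mem hl) K.one_mem) hh using 1
      field_simp
      ring
    have := K.inv_mem (mem_of_mul_mem eK ee this)
    apply h.eps
    convert K.sub_mem K.one_mem this using 1
    have e0 := h.eps0
    field_simp
    linear_combination he
  rw [ind_neg (hA 1 (Or.inl rfl)), ind_neg, ind_neg, ind_neg] at h1
  · omega
  · have := hB 1 (Or.inl rfl)
    rwa [one_mul] at this
  · have := hB (-1) (Or.inr rfl)
    rwa [neg_one_mul, ← sub_eq_add_neg] at this
  · have := hA (-1) (Or.inr rfl)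
    rwa [← sub_eq_add_neg] at this

theorem k3_outside (h : Two Q K ε) (hk : Nat.card K = 3) (hE : Q 1 0 ε 1) {ρ : F} (hρ : ρ ∈ Om Q)
    (hρ9 : ρ ∉ h.K9 hk) : (Nf Q ρ).card = 2 := by
  classical
  have h3 := h.k3_char hk
  let S6 : Finset F := {ε, ε + 1, ε - 1, -ε, -ε + 1, -ε - 1}
  let K3 : Finset F := {0, 1, -1}
  have hK3 : ∀ x, x ∈ K3 → x ∈ K := by
    intro x hx
    simp only [K3, Finset.mem_insert, Finset.mem_singleton] at hx
    rcases hx with rfl | rfl | rfl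
    exacts [K.zero_mem, K.one_mem, K.neg_mem K.one_mem]
  have cK3 : K3.card = 3 := by
    have a1 : (1 : F) ≠ -1 := by
      intro hh
      apply h.two
      linear_combination hh
    simp [K3, a1]
  have cS6 : S6.card ≤ 6 := Finset.card_le_six
  have hbound : ∀ ρ ∈ Om Q, (Nf Q ρ).card + 2 * (if ρ ∈ K3 then 1 else 0)
      ≤ 2 + (if ρ ∈ S6 then 1 else 0) := by
    intro ρ hρ
    by_cases hK : ρ ∈ K3
    · rw [(h.k3_zero hk hE (hK3 _ hK)).2, if_pos hK]
      omega
    · rw [if_neg hK]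
      by_cases hN : (Nf Q ρ).card ≤ 2
      · omega
      · obtain ⟨hN3, x, y, w, hq, rfl, hs, hd⟩ := h.k3_normal hk hρ hN
        have : ρ ∈ S6 := by
          have gen : ∀ η, x - ρ - η ∈ K → ρ = η ∨ ρ = η + 1 ∨ ρ = η - 1 := by
            intro η hη
            have := K.sub_mem hs hη
            have h5 : ρ - η ∈ K := by
              convert K.neg_mem this using 1
              linear_combination ρ * h3
            rcases h.k3_cases hk h5 with q | q | q
            · left; linear_combination q
            · right; left; linear_combination q
            · right; right; linear_combination q
          simp only [S6, Finset.mem_insert, Finset.mem_singleton]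
          rcases hd with hd | hd
          · have := gen ε hd
            tauto
          · have := gen (-ε) (by rwa [sub_neg_eq_add])
            tauto
        rw [if_pos this, hN3]
  have hsum := Finset.sum_le_sum hbound
  have hlow := h.k3_lower hk
  have e1 : ∑ ρ ∈ Om Q, 2 * (if ρ ∈ K3 then 1 else 0) = 6 := by
    rw [← Finset.mul_sum, Finset.sum_boole, Finset.filter_mem_eq_inter,
      Finset.inter_eq_right.2 (fun x hx => (h.k3_zero hk hE (hK3 x hx)).1), cK3]
    norm_num
  have e2 : ∑ ρ ∈ Om Q, (if ρ ∈ S6 then 1 else 0) ≤ 6 := by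
    rw [Finset.sum_boole, Finset.filter_mem_eq_inter]
    exact (Finset.card_le_card Finset.inter_subset_right).trans cS6
  have heq := (Finset.sum_eq_sum_iff_of_le hbound).1 (by
    refine le_antisymm hsum ?_
    rw [Finset.sum_add_distrib, Finset.sum_add_distrib, e1]
    omega) ρ hρ
  have n1 : ρ ∉ K3 := fun hh => hρ9 (h.K_le hk (hK3 _ hh))
  have n2 : ρ ∉ S6 := by
    intro hh
    apply hρ9
    have a := h.eps_K9 hk
    have b := (h.K9 hk).one_mem
    simp only [S6, Finset.mem_insert, Finset.mem_singleton] at hh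
    rcases hh with rfl | rfl | rfl | rfl | rfl | rfl
    · exact a
    · exact add_mem a b
    · exact sub_mem a b
    · exact neg_mem a
    · exact add_mem (neg_mem a) b
    · exact sub_mem (neg_mem a) b
  rw [if_neg n1, if_neg n2] at heq
  omega

theorem k3_split (h : Two Q K ε) (hk : Nat.card K = 3) (hE : Q 1 0 ε 1) {x y c w : F}
    (hq : Q x y c w) (hc : c ∉ h.K9 hk) (hr : w / c ∉ h.K9 hk) :
    ∃ θ ∈ h.K9 hk, ∃ j ∈ K, w = θ + c * j := by
  have h3 := h.k3_char hk
  have c0 : c ≠ 0 := by rintro rfl; exact hc (zero_mem _)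
  have h2 := h.k3_outside hk hE (mem_Om_of hq c0) hr
  have g := (h.k3_generic hk hq (fun hh => hc (h.K_le hk hh)) (fun hh => hc (h.K_le_eps hk hh))).2 h2
  have a := h.eps_K9 hk
  have b := (h.K9 hk).one_mem
  have gen : ∀ e e' : F, e ∈ h.K9 hk → e' ∈ h.K9 hk → (x + w + e) / c ∈ K → (x - w - e') / c ∈ K →
      ∃ θ ∈ h.K9 hk, ∃ j ∈ K, w = θ + c * j := by
    intro e e' he he' g1 g2
    refine ⟨e + e', add_mem he he', _, K.sub_mem g2 g1, ?_⟩
    field_simp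
    linear_combination w * h3
  have g1 : ∃ e ∈ h.K9 hk, (x + w + e) / c ∈ K := by
    rcases g.1 with g | g
    · exact ⟨1, b, g⟩
    · exact ⟨-1, neg_mem b, by rwa [← sub_eq_add_neg]⟩
  have g2 : ∃ e ∈ h.K9 hk, (x - w - e) / c ∈ K := by
    rcases g.2 with g | g
    · exact ⟨ε, a, g⟩
    · exact ⟨-ε, neg_mem a, by rwa [sub_neg_eq_add]⟩
  obtain ⟨e, he, g1⟩ := g1
  obtain ⟨e', he', g2⟩ := g2
  exact gen e e' he he' g1 g2

theorem k3_ratio (h : Two Q K ε) (hk : Nat.card K = 3) (hE : Q 1 0 ε 1) {x y c w : F}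
    (hq : Q x y c w) (c0 : c ≠ 0) : w / c ∈ h.K9 hk := by
  have a := h.eps_K9 hk
  have b := (h.K9 hk).one_mem
  have e0 := h.eps0
  -- it suffices to treat `c ∉ K9`
  have main : ∀ {x y c w : F}, Q x y c w → c ∉ h.K9 hk → w / c ∈ h.K9 hk := by
    intro x y c w hq hc
    have c0 : c ≠ 0 := by rintro rfl; exact hc (zero_mem _)
    by_contra hr
    obtain ⟨θ, hθ, j, hj, hw⟩ := h.k3_split hk hE hq hc hr
    have q1 := h.grp.mul hq ((h.memK _).1 (K.neg_mem hj))
    have q2 := h.grp.mul q1 (h.grp.mul h.grp.e1 hE)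
    have q3 := cast q2 (c' := c * (1 + ε) + ε * θ) (d' := c + θ) rfl rfl
      (by rw [hw]; ring) (by rw [hw]; ring)
    have e1 : 1 + ε ≠ 0 := by
      intro h0
      apply h.eps
      rw [eq_neg_of_add_eq_zero_right h0]; exact K.neg_mem K.one_mem
    have hθ0 : θ ≠ 0 := by
      rintro rfl
      apply hr
      rw [hw]
      have : (0 + c * j) / c = j := by field_simp; ring
      rw [this]
      exact h.K_le hk hj
    have lin : ∀ u v : F, u ∈ h.K9 hk → v ∈ h.K9 hk → c * u = v → u = 0 := by
      intro u v hu hv huv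
      by_contra u0
      apply hc
      convert div_mem hv hu using 1
      field_simp
      exact huv
    have hc' : c * (1 + ε) + ε * θ ∉ h.K9 hk := by
      intro hh
      exact e1 (lin (1 + ε) _ (add_mem b a) (sub_mem hh (mul_mem a hθ)) (by ring))
    have c0' : c * (1 + ε) + ε * θ ≠ 0 := fun h0 => hc' (by rw [h0]; exact zero_mem _)
    have hr' : (c + θ) / (c * (1 + ε) + ε * θ) ∉ h.K9 hk := by
      intro hh
      set r := (c + θ) / (c * (1 + ε) + ε * θ) with hrdef
      have e : c + θ = r * (c * (1 + ε) + ε * θ) := by rw [hrdef, div_mul_cancel₀ _ c0']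
      have z := lin (1 - r * (1 + ε)) (θ * (r * ε - 1)) (sub_mem b (mul_mem hh (add_mem b a)))
        (mul_mem hθ (sub_mem (mul_mem hh a) b)) (by linear_combination e)
      have z2 : θ * (r * ε - 1) = 0 := by linear_combination c * z - e
      have z3 := (mul_eq_zero.1 z2).resolve_left hθ0
      have r0 : r = 0 := by linear_combination -z3 - z
      rw [r0] at z3
      simp at z3
    obtain ⟨θ', hθ', j', hj', hw'⟩ := h.k3_split hk hE q3 hc' hr'
    have j9 := h.K_le hk hj'
    have z := lin (1 - j' * (1 + ε)) (θ' + j' * ε * θ - θ) (sub_mem b (mul_mem j9 (add_mem b a)))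
      (sub_mem (add_mem hθ' (mul_mem (mul_mem j9 a) hθ)) hθ) (by linear_combination hw')
    apply h.eps
    have j0 : j' ≠ 0 := by rintro rfl; simp at z
    refine mem_of_mul_mem hj' j0 ?_
    convert K.sub_mem K.one_mem hj' using 1
    linear_combination -z
  by_cases hc : c ∈ h.K9 hk
  · by_contra hr
    have hw : w ∉ h.K9 hk := fun hh => hr (div_mem hh hc)
    have w0 : w ≠ 0 := by rintro rfl; exact hw (zero_mem _)
    have q := cast (h.grp.mul hq hE) (c' := c + w * ε) (d' := w) rfl rfl (by ring) (by ring)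
    have hcc : c + w * ε ∉ h.K9 hk := by
      intro hh
      apply hw
      have := div_mem (sub_mem hh hc) a
      convert this using 1
      field_simp
      ring
    have cc0 : c + w * ε ≠ 0 := fun h0 => hcc (by rw [h0]; exact zero_mem _)
    have h1 := main q hcc
    apply hr
    have := inv_mem (sub_mem (inv_mem h1) a)
    convert this using 1
    rw [inv_div]
    have : (c + w * ε) / w - ε = c / w := by field_simp; ring
    rw [this, inv_div]
  · exact main hq hc

theorem small_mem (h : Two Q K ε) (hk : Nat.card K = 3) {x y μ w : F}
    (hq : Q x y μ w) (hμ : μ ≠ 0) (htr : x + w = 2) : μ ^ 9 = μ := by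
  rw [← h.mem_K9 hk]
  by_cases hN : ∀ ρ ∈ Om Q, (Nf Q ρ).card ≤ 2
  · exact h.k3_noIII hk hN hq hμ htr
  · push Not at hN
    obtain ⟨ρ, hρ, hN⟩ := hN
    obtain ⟨-, x', y', w', hq', -, hs, hd⟩ := h.k3_normal hk hρ (not_le.2 hN)
    have hE := h.k3_lowerE hk hq' hs hd
    have r1 := h.k3_ratio hk hE hq hμ
    have r2 := h.k3_ratio hk hE (h.grp.inv hq) (neg_ne_zero.2 hμ)
    have h3 := h.k3_char hk
    have := inv_mem (sub_mem r2 r1)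
    convert this using 1
    have : x / -μ - w / μ = μ⁻¹ := by
      field_simp
      linear_combination -htr - h3
    rw [this, inv_inv]

end Two

end GrpQ


namespace GrpQ

variable {F : Type*} [Field F] {Q : F → F → F → F → Prop}

/-- Conjugate of the group by `E₁₂(z)`. -/
def shift (Q : F → F → F → F → Prop) (z : F) : F → F → F → F → Prop := fun a b c d =>
  Q (a + z * c) (b + z * d - z * (a + z * c)) c (d - z * c)

theorem shift_of {z a b c d a' b' c' d' : F} (h : Q a' b' c' d') (ha : a' = a + z * c)
    (hb : b' = b + z * d - z * (a + z * c)) (hc : c' = c) (hd : d' = d - z * c) :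
    shift Q z a b c d := by
  subst ha hb hc hd; exact h

theorem shift_grp (hQ : GrpQ Q) (z : F) : GrpQ (shift Q z) where
  det := by
    intro a b c d h
    linear_combination hQ.det h
  mul := by
    intro a b c d a' b' c' d' h h'
    refine shift_of (hQ.mul h h') ?_ ?_ ?_ ?_ <;> ring
  inv := by
    intro a b c d h
    refine shift_of (hQ.inv h) ?_ ?_ ?_ ?_ <;> ring
  neg := by
    intro a b c d h
    refine shift_of (hQ.neg h) ?_ ?_ ?_ ?_ <;> ring
  e1 := by
    refine shift_of (hQ.e1) ?_ ?_ ?_ ?_ <;> ring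

theorem shift_E (hQ : GrpQ Q) (z x : F) : shift Q z 1 x 0 1 ↔ Q 1 x 0 1 :=
  ⟨fun h => cast h (by ring) (by ring) (by ring) (by ring),
   fun h => shift_of h (by ring) (by ring) (by ring) (by ring)⟩

theorem shift_D [Fintype F] (hQ : GrpQ Q) (z α : F) : α ∈ D (shift Q z) ↔ α ∈ D Q := by
  rw [mem_D, mem_D]
  refine and_congr_right fun _ => ⟨?_, ?_⟩
  · rintro ⟨y, h⟩
    exact ⟨_, cast h (by ring) rfl (by ring) (by ring)⟩
  · rintro ⟨y, h⟩
    exact ⟨y - (z * α⁻¹ - z * α), shift_of h (by ring) (by ring) (by ring) (by ring)⟩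

theorem dickson [Fintype F] (hQ : GrpQ Q) (h2F : (2 : F) ≠ 0) {μ : F} (hμ : μ ≠ 0)
    (hs : Q 1 0 μ 1) (hex : ¬ ((3 : F) = 0 ∧ μ ^ 2 = -1)) : μ ∈ hQ.A := by
  by_contra hμA
  obtain ⟨ε, hε, hε2, ⟨y0, hy0⟩, hD⟩ := hQ.exists_eps h2F hμ hs hμA
  set K := hQ.Af hμ hs with hK
  have hKA : ∀ x, x ∈ hQ.A ↔ x ∈ K := fun x => Iff.rfl
  have e0 : ε ≠ 0 := by rintro rfl; exact hε hQ.A.zero_mem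
  have e1 : 1 - ε ^ 2 ≠ 0 := by
    intro h0
    have : (ε - 1) * (ε + 1) = 0 := by linear_combination -h0
    rcases mul_eq_zero.1 this with q | q
    · exact hε (by rw [sub_eq_zero.1 q]; exact hQ.e1)
    · exact hε (by rw [eq_neg_of_add_eq_zero_left q]; exact hQ.A.neg_mem hQ.e1)
  set z := y0 * ε / (1 - ε ^ 2) with hz
  have hde : shift Q z ε 0 0 ε⁻¹ := by
    refine shift_of hy0 ?_ ?_ ?_ ?_
    · ring
    · rw [hz]; field_simp; ring
    · ring
    · ring
  have hG := hQ.shift_grp z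
  have T : Two (shift Q z) K ε :=
    { grp := hG
      two := h2F
      memK := fun x => by rw [← hKA, mem_A, hQ.shift_E]
      eps := hε
      eps2 := hε2
      diag := by
        intro α hα
        obtain ⟨α0, y, h⟩ := mem_D.1 hα
        have hm := hG.mul (hG.mul (hG.mul hde h) (hG.inv hde)) (hG.inv h)
        have hm' : shift Q z 1 ((ε ^ 2 - 1) * (y * α)) 0 1 := by
          refine cast hm ?_ ?_ ?_ ?_ <;> field_simp <;> ring
        have hm2 : (ε ^ 2 - 1) * (y * α) ∈ K := (hQ.shift_E z _).1 hm'
        have hm3 : y * α ∈ K := mem_of_mul_mem (K.sub_mem hε2 K.one_mem)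
          (by intro h0; apply e1; linear_combination -h0) hm2
        have hm4 : shift Q z 1 (-(y * α)) 0 1 := (hQ.shift_E z _).2 (K.neg_mem hm3)
        refine cast (hG.mul hm4 h) ?_ ?_ ?_ ?_ <;> field_simp <;> ring
      memD := fun α => by rw [hQ.shift_D, hD]; rfl }
  have hq : shift Q z (1 - z * μ) (-z ^ 2 * μ) μ (1 + z * μ) := by
    refine shift_of hs ?_ ?_ ?_ ?_ <;> ring
  have htr : (1 - z * μ) + (1 + z * μ) = 2 := by ring
  have hμK : μ ∉ K := hμA
  have hodd : Odd (Nat.card K) := by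
    have : Fintype K := Fintype.ofFinite K
    rw [Nat.card_eq_fintype_card, Nat.odd_iff]
    refine FiniteField.odd_card_of_char_ne_two fun hc => h2F ?_
    have : ((2 : ℕ) : K) = 0 := (ringChar.spec K 2).2 (by rw [hc])
    have := congrArg K.subtype this
    rw [map_natCast, map_zero] at this
    exact_mod_cast this
  have hk1 : Nat.card K ≠ 1 := by
    have := Finite.one_lt_card (α := K)
    omega
  by_cases hk5 : 5 ≤ Nat.card K
  · refine hμK (T.big_mem hk5 ?_ hq hμ htr)
    intro h6
    rw [h6] at hodd
    exact absurd hodd (by decide)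
  have hk3 : Nat.card K = 3 := by
    obtain ⟨r, hr⟩ := hodd
    omega
  have h9 := T.small_mem hk3 hq hμ htr
  have h3 := T.k3_char hk3
  have h8 : (μ - 1) * ((μ + 1) * ((μ ^ 2 + 1) * ((μ ^ 2 + μ - 1) * (μ ^ 2 - μ - 1)))) = 0 := by
    have : μ * ((μ - 1) * ((μ + 1) * ((μ ^ 2 + 1) * ((μ ^ 2 + μ - 1) * (μ ^ 2 - μ - 1))))) = 0 := by
      linear_combination h9 + (- μ ^ 7 + μ ^ 3) * h3
    exact (mul_eq_zero.1 this).resolve_left hμ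
  have x := hQ.e1
  have X := hQ.inv x
  have Y := hQ.inv hs
  rcases mul_eq_zero.1 h8 with q | q
  · exact hμK (by rw [sub_eq_zero.1 q]; exact K.one_mem)
  rcases mul_eq_zero.1 q with q | q
  · exact hμK (by rw [eq_neg_of_add_eq_zero_left q]; exact K.neg_mem K.one_mem)
  rcases mul_eq_zero.1 q with q | q
  · exact hex ⟨h3, by linear_combination q⟩
  rcases mul_eq_zero.1 q with q | q
  · apply hμA
    have w := hQ.neg (hQ.mul (hQ.mul (hQ.mul (hQ.mul (hQ.mul (hQ.mul hs X) Y) x) Y) X) hs)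
    refine cast w ?_ ?_ ?_ ?_
    · linear_combination ((2) * μ ^ 0 + (-1) * μ ^ 1) * q + ((-1) * μ ^ 1) * h3
    · linear_combination ((-1) * μ ^ 0) * q + 0 * h3
    · linear_combination ((-6) * μ ^ 0 + (3) * μ ^ 1 + (-1) * μ ^ 2) * q + ((-2) * μ ^ 0 + (3) * μ ^ 1) * h3
    · linear_combination ((2) * μ ^ 0 + (-1) * μ ^ 1) * q + ((-1) * μ ^ 1) * h3
  · apply hμA
    have w := hQ.neg (hQ.mul (hQ.mul (hQ.mul (hQ.mul (hQ.mul (hQ.mul hs x) Y) X) Y) x) hs)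
    refine cast w ?_ ?_ ?_ ?_
    · linear_combination ((2) * μ ^ 0 + (1) * μ ^ 1) * q + ((1) * μ ^ 1) * h3
    · linear_combination ((1) * μ ^ 0) * q + 0 * h3
    · linear_combination ((6) * μ ^ 0 + (3) * μ ^ 1 + (1) * μ ^ 2) * q + ((2) * μ ^ 0 + (3) * μ ^ 1) * h3
    · linear_combination ((2) * μ ^ 0 + (1) * μ ^ 1) * q + ((1) * μ ^ 1) * h3

end GrpQ



namespace Lift

variable {R : Type*} [CommRing R]

/-- Matrices with entries in the ideal `I`. -/
def MI (I : Ideal R) : AddSubgroup (Matrix (Fin 2) (Fin 2) R) where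
  carrier := {X | ∀ i k, X i k ∈ I}
  zero_mem' := fun i k => I.zero_mem
  add_mem' := fun hX hY i k => I.add_mem (hX i k) (hY i k)
  neg_mem' := fun hX i k => I.neg_mem (hX i k)

theorem mem_MI {I : Ideal R} {X : Matrix (Fin 2) (Fin 2) R} : X ∈ MI I ↔ ∀ i k, X i k ∈ I := Iff.rfl

theorem mem_MI' {I : Ideal R} {a b c d : R} (ha : a ∈ I) (hb : b ∈ I) (hc : c ∈ I) (hd : d ∈ I) :
    !![a, b; c, d] ∈ MI I := by
  intro i k
  fin_cases i <;> fin_cases k <;> simpa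

theorem MI_mono {I J : Ideal R} (h : I ≤ J) {X : Matrix (Fin 2) (Fin 2) R} (hX : X ∈ MI I) :
    X ∈ MI J := fun i k => h (hX i k)

theorem MI_mul {I J : Ideal R} {X Y : Matrix (Fin 2) (Fin 2) R} (hX : X ∈ MI I) (hY : Y ∈ MI J) :
    X * Y ∈ MI (I * J) := by
  intro i k
  rw [Matrix.mul_apply]
  exact Ideal.sum_mem _ fun l _ => Ideal.mul_mem_mul (hX i l) (hY l k)

theorem MI_left {I : Ideal R} {X : Matrix (Fin 2) (Fin 2) R} (Y : Matrix (Fin 2) (Fin 2) R)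
    (hX : X ∈ MI I) : Y * X ∈ MI I := by
  intro i k
  rw [Matrix.mul_apply]
  exact Ideal.sum_mem _ fun l _ => I.mul_mem_left _ (hX l k)

theorem MI_right {I : Ideal R} {X : Matrix (Fin 2) (Fin 2) R} (Y : Matrix (Fin 2) (Fin 2) R)
    (hX : X ∈ MI I) : X * Y ∈ MI I := by
  intro i k
  rw [Matrix.mul_apply]
  exact Ideal.sum_mem _ fun l _ => I.mul_mem_right _ (hX i l)

/-- The underlying matrix. -/
def m (g : SL(2, R)) : Matrix (Fin 2) (Fin 2) R := g.1

theorem m_mul (g h : SL(2, R)) : m (g * h) = m g * m h := Matrix.SpecialLinearGroup.coe_mul g h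
theorem m_one : m (1 : SL(2, R)) = 1 := Matrix.SpecialLinearGroup.coe_one
theorem m_apply (g : SL(2, R)) (i k : Fin 2) : m g i k = g i k := rfl

theorem inv_mul_coe (g : SL(2, R)) : (m (g⁻¹)) * m g = 1 := by
  rw [← m_mul, inv_mul_cancel, m_one]

theorem mul_inv_coe (g : SL(2, R)) : (m g) * m (g⁻¹) = 1 := by
  rw [← m_mul, mul_inv_cancel, m_one]

theorem inv_sub_mem {I : Ideal R} {g h : SL(2, R)}
    (H : (m g - m h : Matrix (Fin 2) (Fin 2) R) ∈ MI I) :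
    (m (g⁻¹) - m (h⁻¹) : Matrix (Fin 2) (Fin 2) R) ∈ MI I := by
  have := neg_mem (MI_right (m (h⁻¹))
    (MI_left (m (g⁻¹)) H))
  convert this using 1
  rw [mul_sub, sub_mul, inv_mul_coe, mul_assoc, mul_inv_coe]
  simp

/-- The upper elementary matrix. -/
def EU (x : R) : SL(2, R) := ⟨!![1, x; 0, 1], by simp [Matrix.det_fin_two_of]⟩
/-- The lower elementary matrix. -/
def EL (x : R) : SL(2, R) := ⟨!![1, 0; x, 1], by simp [Matrix.det_fin_two_of]⟩
/-- The Weyl element. -/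
def WE : SL(2, R) := ⟨!![0, 1; -1, 0], by simp [Matrix.det_fin_two_of]⟩

/-- The graded pieces. -/
def L (P : Ideal R) (Δ : Subgroup SL(2, R)) (j : ℕ) (hj : 1 ≤ j) :
    AddSubgroup (Matrix (Fin 2) (Fin 2) R) where
  carrier := {X | X ∈ MI (P ^ j) ∧ ∃ δ ∈ Δ, (m δ - 1 - X : Matrix (Fin 2) (Fin 2) R) ∈ MI (P ^ (j + 1))}
  zero_mem' := ⟨zero_mem _, 1, Δ.one_mem, by rw [m_one]; simp [zero_mem]⟩
  add_mem' := by
    rintro X Y ⟨hX, δ, hδ, h1⟩ ⟨hY, δ', hδ', h2⟩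
    refine ⟨add_mem hX hY, δ * δ', Δ.mul_mem hδ hδ', ?_⟩
    have e1 : (m δ - 1 : Matrix (Fin 2) (Fin 2) R) ∈ MI (P ^ j) := by
      have := add_mem (MI_mono (Ideal.pow_le_pow_right (Nat.le_succ j)) h1) hX
      convert this using 1; abel
    have e2 : (m δ' - 1 : Matrix (Fin 2) (Fin 2) R) ∈ MI (P ^ j) := by
      have := add_mem (MI_mono (Ideal.pow_le_pow_right (Nat.le_succ j)) h2) hY
      convert this using 1; abel
    have e3 := MI_mul e1 e2
    rw [← pow_add] at e3
    have e4 := add_mem (add_mem h1 h2) (MI_mono (Ideal.pow_le_pow_right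
      (show j + 1 ≤ j + j by omega)) e3)
    convert e4 using 1
    rw [m_mul]
    noncomm_ring
  neg_mem' := by
    rintro X ⟨hX, δ, hδ, h1⟩
    refine ⟨neg_mem hX, δ⁻¹, Δ.inv_mem hδ, ?_⟩
    have e1 : (m δ - 1 : Matrix (Fin 2) (Fin 2) R) ∈ MI (P ^ j) := by
      have := add_mem (MI_mono (Ideal.pow_le_pow_right (Nat.le_succ j)) h1) hX
      convert this using 1; abel
    have e3 := MI_mul e1 hX
    rw [← pow_add] at e3
    have e4 := MI_left (m (δ⁻¹)) (sub_mem (MI_mono (Ideal.pow_le_pow_right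
      (show j + 1 ≤ j + j by omega)) e3) h1)
    convert e4 using 1
    have := inv_mul_coe δ
    have q : (m (δ⁻¹)) * ((m δ - 1) * X - (m δ - 1 - X)) =
      (m (δ⁻¹) * m δ) * X - (m (δ⁻¹) * m δ) + m (δ⁻¹) := by noncomm_ring
    rw [q, this]
    noncomm_ring

theorem mem_L {P : Ideal R} {Δ : Subgroup SL(2, R)} {j : ℕ} {hj : 1 ≤ j}
    {X : Matrix (Fin 2) (Fin 2) R} : X ∈ L P Δ j hj ↔ X ∈ MI (P ^ j) ∧
      ∃ δ ∈ Δ, (m δ - 1 - X : Matrix (Fin 2) (Fin 2) R) ∈ MI (P ^ (j + 1)) := Iff.rfl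

theorem L_of_next {P : Ideal R} {Δ : Subgroup SL(2, R)} {j : ℕ} {hj : 1 ≤ j}
    {X : Matrix (Fin 2) (Fin 2) R} (hX : X ∈ MI (P ^ (j + 1))) : X ∈ L P Δ j hj := by
  refine mem_L.2 ⟨MI_mono (Ideal.pow_le_pow_right (Nat.le_succ j)) hX, 1, Δ.one_mem, ?_⟩
  convert neg_mem hX using 1
  rw [m_one]
  simp

theorem L_conj {P : Ideal R} {Δ : Subgroup SL(2, R)} {j : ℕ} {hj : 1 ≤ j}
    (hs : ∀ g : SL(2, R), ∃ δ ∈ Δ, (m g - m δ : Matrix (Fin 2) (Fin 2) R) ∈ MI P)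
    {X : Matrix (Fin 2) (Fin 2) R} (hX : X ∈ L P Δ j hj) (g : SL(2, R)) :
    (m g * X * m (g⁻¹) : Matrix (Fin 2) (Fin 2) R) ∈ L P Δ j hj := by
  obtain ⟨hX, δ, hδ, h1⟩ := mem_L.1 hX
  obtain ⟨γ, hγ, hg⟩ := hs g
  have a1 : (m γ * X * m (γ⁻¹) : Matrix (Fin 2) (Fin 2) R) ∈ L P Δ j hj := by
    refine mem_L.2 ⟨MI_right _ (MI_left _ hX), γ * δ * γ⁻¹, Δ.mul_mem (Δ.mul_mem hγ hδ) (Δ.inv_mem hγ), ?_⟩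
    have := MI_right (m (γ⁻¹)) (MI_left (m γ) h1)
    convert this using 1
    rw [m_mul, m_mul, mul_sub, mul_sub,
      sub_mul, sub_mul, mul_one, mul_inv_coe]
  have a2 : ((m g - m γ) * X * m (g⁻¹) : Matrix (Fin 2) (Fin 2) R) ∈ MI (P ^ (j + 1)) := by
    have := MI_right (m (g⁻¹)) (MI_mul hg hX)
    rwa [← pow_succ'] at this
  have a3 : (m γ * X * (m (g⁻¹) - m (γ⁻¹)) : Matrix (Fin 2) (Fin 2) R) ∈ MI (P ^ (j + 1)) := by
    have := MI_mul (MI_left (m γ) hX) (inv_sub_mem hg)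
    rwa [← pow_succ] at this
  have := add_mem (add_mem (L_of_next (hj := hj) a2) (L_of_next (hj := hj) a3)) a1
  convert this using 1
  noncomm_ring

theorem L_comm {P : Ideal R} {Δ : Subgroup SL(2, R)} {j : ℕ} {hj : 1 ≤ j}
    {X Y : Matrix (Fin 2) (Fin 2) R} (hX : X ∈ L P Δ 1 le_rfl) (hY : Y ∈ L P Δ j hj) :
    X * Y - Y * X ∈ L P Δ (j + 1) (by omega) := by
  obtain ⟨hX, δ, hδ, h1⟩ := mem_L.1 hX
  obtain ⟨hY, γ, hγ, h2⟩ := mem_L.1 hY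
  rw [pow_one] at hX
  have c1 : X * Y - Y * X ∈ MI (P ^ (j + 1)) := by
    have a := MI_mul hX hY
    have b := MI_mul hY hX
    rw [← pow_succ'] at a
    rw [← pow_succ] at b
    exact sub_mem a b
  refine mem_L.2 ⟨c1, δ * γ * δ⁻¹ * γ⁻¹, Δ.mul_mem (Δ.mul_mem (Δ.mul_mem hδ hγ) (Δ.inv_mem hδ)) (Δ.inv_mem hγ), ?_⟩
  have e1 : (m δ - 1 : Matrix (Fin 2) (Fin 2) R) ∈ MI P := by
    have := add_mem (MI_mono (Ideal.pow_le_self (by omega)) h1) hX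
    convert this using 1; abel
  have e2 : (m γ - 1 : Matrix (Fin 2) (Fin 2) R) ∈ MI (P ^ j) := by
    have := add_mem (MI_mono (Ideal.pow_le_pow_right (Nat.le_succ j)) h2) hY
    convert this using 1; abel
  have e2' := MI_mono (Ideal.pow_le_self (show j ≠ 0 by omega)) e2
  -- the commutator of the matrices
  have c2 : (m δ * m γ - m γ * m δ - (X * Y - Y * X) : Matrix (Fin 2) (Fin 2) R) ∈ MI (P ^ (j + 1 + 1)) := by
    have a1 := MI_mul h1 e2
    have a2 := MI_mul e2 h1
    have a3 := MI_mul hX h2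
    have a4 := MI_mul h2 hX
    rw [← pow_add, show 1 + 1 + j = j + 1 + 1 by omega] at a1
    rw [← pow_add, show j + (1 + 1) = j + 1 + 1 by omega] at a2
    rw [← pow_succ'] at a3
    rw [← pow_succ] at a4
    convert add_mem (sub_mem a1 a2) (sub_mem a3 a4) using 1
    noncomm_ring
  have c3 : (m (δ⁻¹) * m (γ⁻¹) - 1 : Matrix (Fin 2) (Fin 2) R) ∈ MI P := by
    have h5 : (m (γ * δ) - m (1 : SL(2, R)) : Matrix (Fin 2) (Fin 2) R) ∈ MI P := by
      have := add_mem (MI_left (m γ) e1) e2'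
      convert this using 1
      rw [m_mul, m_one]
      noncomm_ring
    have := inv_sub_mem h5
    rwa [inv_one, _root_.mul_inv_rev, m_mul, m_one] at this
  have c4 := MI_mul c1 c3
  rw [← pow_succ] at c4
  have := add_mem c4 (MI_right (m (δ⁻¹) * m (γ⁻¹) : Matrix (Fin 2) (Fin 2) R) c2)
  convert this using 1
  have q : (m δ * m γ * m (δ⁻¹) * m (γ⁻¹) - 1 : Matrix (Fin 2) (Fin 2) R) =
      (m δ * m γ - m γ * m δ) * (m (δ⁻¹) * m (γ⁻¹)) := by
    have r : (m γ * m δ : Matrix (Fin 2) (Fin 2) R) * (m (δ⁻¹) * m (γ⁻¹)) = 1 := by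
      rw [mul_assoc, ← mul_assoc (m δ), mul_inv_coe, one_mul, mul_inv_coe]
    rw [sub_mul, r]
    noncomm_ring
  rw [m_mul, m_mul,
    m_mul, q]
  noncomm_ring

theorem det_trace {I : Ideal R} {g : SL(2, R)} (h : (m g - 1 : Matrix (Fin 2) (Fin 2) R) ∈ MI I) :
    g 0 0 - 1 + (g 1 1 - 1) ∈ I * I := by
  have h00 := h 0 0
  have h01 := h 0 1
  have h10 := h 1 0
  have h11 := h 1 1
  simp [m_apply] at h00 h01 h10 h11
  have hd := g.2
  rw [Matrix.det_fin_two] at hd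
  have := sub_mem (Ideal.mul_mem_mul h01 h10) (Ideal.mul_mem_mul h00 h11)
  convert this using 1
  linear_combination hd

end Lift



namespace Lift

variable {R : Type*} [CommRing R]

theorem m_EU (x : R) : m (EU x) = !![1, x; 0, 1] := rfl
theorem m_EL (x : R) : m (EL x) = !![1, 0; x, 1] := rfl
theorem m_WE : m (WE : SL(2, R)) = !![0, 1; -1, 0] := rfl

theorem m_inv (g : SL(2, R)) : m (g⁻¹) = !![m g 1 1, - m g 0 1; - m g 1 0, m g 0 0] := by
  rw [m, Matrix.SpecialLinearGroup.coe_inv, Matrix.adjugate_fin_two]; rfl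

theorem conj_EU (x a b c d : R) : m (EU x) * !![a, b; c, d] * m ((EU x)⁻¹) =
    !![a + x * c, b + x * d - x * (a + x * c); c, d - x * c] := by
  rw [m_inv, m_EU]
  ext i k
  fin_cases i <;> fin_cases k <;> simp <;> ring

theorem conj_EL (x a b c d : R) : m (EL x) * !![a, b; c, d] * m ((EL x)⁻¹) =
    !![a - x * b, b; c + x * a - x * (d + x * b), d + x * b] := by
  rw [m_inv, m_EL]
  ext i k
  fin_cases i <;> fin_cases k <;> simp <;> ring

theorem conj_WE (a b c d : R) : m (WE : SL(2, R)) * !![a, b; c, d] * m ((WE)⁻¹) =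
    !![d, -c; -b, a] := by
  rw [m_inv, m_WE]
  ext i k
  fin_cases i <;> fin_cases k <;> simp

theorem exists_inv {P : Ideal R} (hP : P.IsMaximal) {u : R} (hu : u ∉ P) :
    ∃ y, y * u - 1 ∈ P := by
  obtain ⟨y, i, hi, h⟩ := hP.exists_inv hu
  refine ⟨y, ?_⟩
  convert P.neg_mem hi using 1
  linear_combination h

section
variable {P : Ideal R} {Δ : Subgroup SL(2, R)}

/-- Entries of the first layer. -/
def gI (P : Ideal R) (Δ : Subgroup SL(2, R)) : Ideal R where
  carrier := {t | ∀ y, !![0, y * t; 0, 0] ∈ L P Δ 1 le_rfl}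
  zero_mem' := by
    intro y
    have : (!![0, y * 0; 0, 0] : Matrix (Fin 2) (Fin 2) R) = 0 := by
      ext i k; fin_cases i <;> fin_cases k <;> simp
    rw [this]; exact zero_mem _
  add_mem' := by
    intro a b ha hb y
    have := add_mem (ha y) (hb y)
    convert this using 1
    ext i k; fin_cases i <;> fin_cases k <;> simp [mul_add]
  smul_mem' := by
    intro c x hx y
    have := hx (y * c)
    rwa [mul_assoc] at this

theorem mem_gI {t : R} : t ∈ gI P Δ ↔ ∀ y, !![0, y * t; 0, 0] ∈ L P Δ 1 le_rfl := Iff.rfl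

theorem sq_le_gI : P ^ 2 ≤ gI P Δ := by
  intro t ht y
  refine L_of_next (mem_MI' (zero_mem _) ?_ (zero_mem _) (zero_mem _))
  exact Ideal.mul_mem_left _ _ ht

theorem gI_le : gI P Δ ≤ P := by
  intro t ht
  have := (mem_L.1 (ht 1)).1 0 1
  simpa using this

theorem gI_div (hP : P.IsMaximal) {u x : R} (hu : u ∉ P) (hx : x ∈ P) (h : u * x ∈ gI P Δ) :
    x ∈ gI P Δ := by
  obtain ⟨y, hy⟩ := exists_inv hP hu
  have h1 : (y * u - 1) * x ∈ gI P Δ := sq_le_gI (by rw [pow_two]; exact Ideal.mul_mem_mul hy hx)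
  convert sub_mem (Ideal.mul_mem_left _ y h) h1 using 1
  ring

theorem low_mem (hs : ∀ g : SL(2, R), ∃ δ ∈ Δ, m g - m δ ∈ MI P)
    (hP : P.IsMaximal) (h2 : (2 : R) ∉ P) {a b c d : R}
    (hX : !![a, b; c, d] ∈ L P Δ 1 le_rfl) : c ∈ gI P Δ := by
  have hc : c ∈ P := by
    have := (mem_L.1 hX).1 1 0
    simpa using this
  have h8 : (8 : R) ∉ P := by
    intro h
    rw [show (8 : R) = 2 ^ 3 by norm_num] at h
    exact h2 (hP.isPrime.mem_of_pow_mem _ h)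
  have sq : ∀ y : R, !![0, 2 * y ^ 2 * c; 0, 0] ∈ L P Δ 1 le_rfl := by
    intro y
    have a1 := L_conj hs hX (EU y)
    have a2 := L_conj hs hX (EU (-y))
    rw [conj_EU] at a1 a2
    convert sub_mem (add_mem hX hX) (add_mem a1 a2) using 1
    ext i k; fin_cases i <;> fin_cases k <;> simp <;> ring
  refine gI_div hP h8 hc fun y => ?_
  convert sub_mem (sq (y + 1)) (sq (y - 1)) using 1
  ext i k; fin_cases i <;> fin_cases k <;> simp <;> ring

theorem entries_mem (hs : ∀ g : SL(2, R), ∃ δ ∈ Δ, m g - m δ ∈ MI P)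
    (hP : P.IsMaximal) (h2 : (2 : R) ∉ P) {a b c d : R}
    (hX : !![a, b; c, d] ∈ L P Δ 1 le_rfl) (htr : a + d ∈ P ^ 2) :
    a ∈ gI P Δ ∧ b ∈ gI P Δ ∧ c ∈ gI P Δ ∧ d ∈ gI P Δ := by
  have hd : d ∈ P := by
    have := (mem_L.1 hX).1 1 1
    simpa using this
  have hc := low_mem hs hP h2 hX
  have hb : b ∈ gI P Δ := by
    have := L_conj hs hX WE
    rw [conj_WE] at this
    have := neg_mem (low_mem hs hP h2 this)
    rwa [neg_neg] at this
  have htr' : a + d ∈ gI P Δ := sq_le_gI htr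
  have hdd : d ∈ gI P Δ := by
    have := L_conj hs hX (EL 1)
    rw [conj_EL] at this
    have h3 := low_mem hs hP h2 this
    refine gI_div hP h2 hd ?_
    convert sub_mem (sub_mem (add_mem htr' hc) h3) hb using 1
    ring
  refine ⟨?_, hb, hc, hdd⟩
  convert sub_mem htr' hdd using 1
  ring

theorem delta_entries (hs : ∀ g : SL(2, R), ∃ δ ∈ Δ, m g - m δ ∈ MI P)
    (hP : P.IsMaximal) (h2 : (2 : R) ∉ P) {δ : SL(2, R)} (hδ : δ ∈ Δ)
    (h : m δ - 1 ∈ MI P) : m δ - 1 ∈ MI (gI P Δ) := by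
  have hX : m δ - 1 ∈ L P Δ 1 le_rfl := by
    refine mem_L.2 ⟨by rwa [pow_one], δ, hδ, ?_⟩
    rw [sub_self]; exact zero_mem _
  have htr := det_trace h
  rw [← pow_two] at htr
  have e : m δ - 1 = !![δ 0 0 - 1, δ 0 1; δ 1 0, δ 1 1 - 1] := by
    ext i k; fin_cases i <;> fin_cases k <;> simp [m_apply]
  rw [e] at hX ⊢
  obtain ⟨h1, h2, h3, h4⟩ := entries_mem hs hP h2 hX htr
  exact mem_MI' h1 h2 h3 h4

/-- All matrices of trace zero are in the `j`-th layer. -/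
theorem layer_of_EU {j : ℕ} {hj : 1 ≤ j}
    (hs : ∀ g : SL(2, R), ∃ δ ∈ Δ, m g - m δ ∈ MI P)
    (hfull : ∀ t ∈ P ^ j, !![0, t; 0, 0] ∈ L P Δ j hj)
    {a b c : R} (ha : a ∈ P ^ j) (hb : b ∈ P ^ j) (hc : c ∈ P ^ j) :
    !![a, b; c, -a] ∈ L P Δ j hj := by
  have lo : ∀ t ∈ P ^ j, !![0, 0; t, 0] ∈ L P Δ j hj := by
    intro t ht
    have := L_conj hs (hfull (-t) (neg_mem ht)) WE
    rw [conj_WE] at this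
    convert this using 1
    ext i k; fin_cases i <;> fin_cases k <;> simp
  have di : ∀ t ∈ P ^ j, !![t, 0; 0, -t] ∈ L P Δ j hj := by
    intro t ht
    have := L_conj hs (hfull (-t) (neg_mem ht)) (EL 1)
    rw [conj_EL] at this
    convert sub_mem this (add_mem (hfull (-t) (neg_mem ht)) (lo t ht)) using 1
    ext i k; fin_cases i <;> fin_cases k <;> simp
  convert add_mem (add_mem (di a ha) (hfull b hb)) (lo c hc) using 1
  ext i k; fin_cases i <;> fin_cases k <;> simp

theorem full_succ (hP : P.IsMaximal) (h2 : (2 : R) ∉ P)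
    (hs : ∀ g : SL(2, R), ∃ δ ∈ Δ, m g - m δ ∈ MI P)
    (hfull1 : ∀ t ∈ P ^ 1, !![0, t; 0, 0] ∈ L P Δ 1 le_rfl) {j : ℕ} {hj : 1 ≤ j}
    (hfull : ∀ t ∈ P ^ j, !![0, t; 0, 0] ∈ L P Δ j hj) :
    ∀ t ∈ P ^ (j + 1), !![0, t; 0, 0] ∈ L P Δ (j + 1) (by omega) := by
  have two : ∀ t ∈ P ^ (j + 1), !![0, 2 * t; 0, 0] ∈ L P Δ (j + 1) (by omega) := by
    intro t ht
    rw [pow_succ'] at ht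
    refine Submodule.mul_induction_on ht ?_ ?_
    · intro s hs' u hu
      have h1 := layer_of_EU (hj := le_rfl) hs hfull1 (a := s) (by rwa [pow_one]) (zero_mem _) (zero_mem _)
      have := L_comm h1 (hfull u hu)
      convert this using 1
      ext i k; fin_cases i <;> fin_cases k <;> simp; ring
    · intro x y hx hy
      convert add_mem hx hy using 1
      ext i k; fin_cases i <;> fin_cases k <;> simp; ring
  intro t ht
  obtain ⟨y, hy⟩ := exists_inv hP h2
  have h1 : !![0, (y * 2 - 1) * t; 0, 0] ∈ L P Δ (j + 1) (by omega) := by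
    refine L_of_next (mem_MI' (zero_mem _) ?_ (zero_mem _) (zero_mem _))
    rw [pow_succ' P (j + 1)]
    exact Ideal.mul_mem_mul hy ht
  convert sub_mem (two (y * t) (Ideal.mul_mem_left _ _ ht)) h1 using 1
  ext i k; fin_cases i <;> fin_cases k <;> simp; ring

theorem approx (hP : P.IsMaximal) (h2 : (2 : R) ∉ P)
    (hs : ∀ g : SL(2, R), ∃ δ ∈ Δ, m g - m δ ∈ MI P) (hg : P ≤ gI P Δ) (g : SL(2, R)) (j : ℕ)
    (hj : 1 ≤ j) : ∃ δ ∈ Δ, m g - m δ ∈ MI (P ^ j) := by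
  have hfull1 : ∀ t ∈ P ^ 1, !![0, t; 0, 0] ∈ L P Δ 1 le_rfl := by
    intro t ht
    rw [pow_one] at ht
    have := mem_gI.1 (hg ht) 1
    rwa [one_mul] at this
  have hfull : ∀ j : ℕ, ∀ hj : 1 ≤ j, ∀ t ∈ P ^ j, !![0, t; 0, 0] ∈ L P Δ j hj := by
    intro j hj
    induction j, hj using Nat.le_induction with
    | base => exact hfull1
    | succ j hj ih => exact full_succ hP h2 hs hfull1 ih
  induction j, hj using Nat.le_induction with
  | base =>
    rw [pow_one]; exact hs g
  | succ j hj ih =>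
    obtain ⟨δ, hδ, h⟩ := ih
    have h1 : m (g * δ⁻¹) - 1 ∈ MI (P ^ j) := by
      have := MI_right (m (δ⁻¹)) h
      rwa [sub_mul, mul_inv_coe, ← m_mul] at this
    have htr := det_trace h1
    rw [← pow_add] at htr
    have htr' := Ideal.pow_le_pow_right (show j + 1 ≤ j + j by omega) htr
    generalize hk : g * δ⁻¹ = k at h1 htr htr'
    have a00 := h1 0 0
    have a01 := h1 0 1
    have a10 := h1 1 0
    simp [m_apply] at a00 a01 a10
    obtain ⟨-, γ, hγ, h5⟩ := mem_L.1 (layer_of_EU hs (hfull j hj) a00 a01 a10)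
    refine ⟨γ * δ, Δ.mul_mem hγ hδ, ?_⟩
    have h6 : m k - m γ ∈ MI (P ^ (j + 1)) := by
      have h7 : !![0, 0; 0, k 0 0 - 1 + (k 1 1 - 1)] ∈ MI (P ^ (j + 1)) :=
        mem_MI' (zero_mem _) (zero_mem _) (zero_mem _) htr'
      convert sub_mem h7 h5 using 1
      ext i k; fin_cases i <;> fin_cases k <;> simp [m_apply]; ring
    have h8 := MI_right (m δ) h6
    rwa [sub_mul, ← m_mul, ← m_mul, ← hk, inv_mul_cancel_right] at h8

end

end Lift



namespace Lift

theorem frob_mat {B : Type*} [CommRing B] (p : ℕ) [Fact p.Prime] [CharP B p] (hodd : Odd p) (f : ℕ)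
    (G : Matrix (Fin 2) (Fin 2) B) (t : B) (hG : G * G = t • G - 1) :
    (2 : B) • G ^ (p ^ f) = (t ^ (p ^ f)) • (1 : Matrix (Fin 2) (Fin 2) B)
      + ((t ^ 2 - 4) ^ ((p ^ f - 1) / 2)) • ((2 : B) • G - t • 1) := by
  have h1 : ((2 : B) • G - t • 1) ^ (p ^ f) = ((2 : B) • G) ^ (p ^ f) - (t • 1) ^ (p ^ f) := by
    refine sub_pow_char_pow_of_commute _ _ ?_
    exact ((Commute.one_right _).smul_right _)
  have h2 : ((2 : B) • G - t • 1) ^ 2 = (t ^ 2 - 4) • (1 : Matrix (Fin 2) (Fin 2) B) := by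
    have : ((2 : B) • G - t • 1) ^ 2 = (4 : B) • (G * G) - (4 * t) • G + (t ^ 2) • 1 := by
      rw [pow_two]
      simp only [sub_mul, mul_sub, smul_mul_assoc, mul_smul_comm, one_mul, mul_one]
      module
    rw [this, hG]
    module
  have hq : p ^ f = 2 * ((p ^ f - 1) / 2) + 1 := by
    have := hodd.pow (n := f)
    obtain ⟨c, hc⟩ := this
    omega
  have h3 : ((2 : B) • G - t • 1) ^ (p ^ f) =
      ((t ^ 2 - 4) ^ ((p ^ f - 1) / 2)) • ((2 : B) • G - t • 1) := by
    conv_lhs => rw [hq, pow_succ, pow_mul, h2]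
    rw [smul_pow, one_pow, smul_mul_assoc, one_mul]
  have h4 : (2 : B) ^ (p ^ f) = 2 := by
    have := map_ofNat (iterateFrobenius B p f) 2
    rwa [iterateFrobenius_def] at this
  rw [← h3, h1, smul_pow, smul_pow, h4, one_pow]
  module

theorem mem_MI_iff_map {R : Type*} [CommRing R] {I : Ideal R} {X : Matrix (Fin 2) (Fin 2) R} :
    X ∈ MI I ↔ (Ideal.Quotient.mk I).mapMatrix X = 0 := by
  constructor
  · intro h
    ext i k
    simpa using Ideal.Quotient.eq_zero_iff_mem.2 (h i k)
  · intro h i k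
    have := congrFun (congrFun h i) k
    exact Ideal.Quotient.eq_zero_iff_mem.1 (by simpa using this)

theorem m_pow {R : Type*} [CommRing R] (g : SL(2, R)) (k : ℕ) : m (g ^ k) = m g ^ k :=
  Matrix.SpecialLinearGroup.coe_pow g k

theorem EU_pow {R : Type*} [CommRing R] (x : R) (k : ℕ) : EU x ^ k = EU (k * x) := by
  induction k with
  | zero => 
    rw [pow_zero]
    ext i k; fin_cases i <;> fin_cases k <;> simp [EU]
  | succ k ih =>
    rw [pow_succ, ih]
    ext i k
    rw [← m_apply, m_mul, ← m_apply, m_EU, m_EU, m_EU]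
    fin_cases i <;> fin_cases k <;> simp
    ring

theorem cayley {R : Type*} [CommRing R] (g : SL(2, R)) :
    m g * m g = (g 0 0 + g 1 1) • m g - 1 := by
  have hd := g.det_coe
  rw [Matrix.det_fin_two] at hd
  ext i k
  fin_cases i <;> fin_cases k <;> simp [Matrix.mul_apply, m_apply]
  · linear_combination -hd
  · ring
  · ring
  · linear_combination -hd

theorem frob_trace {R : Type*} [CommRing R] {P : Ideal R} {Δ : Subgroup SL(2, R)}
    (hs : ∀ g : SL(2, R), ∃ δ ∈ Δ, m g - m δ ∈ MI P)
    (hP : P.IsMaximal) (h2 : (2 : R) ∉ P) (p : ℕ) [Fact p.Prime] (hodd : Odd p)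
    (hpP : (p : R) ∈ P) (hpg : (p : R) ∈ gI P Δ) [Finite (R ⧸ P)] (f : ℕ) 
    (hf : Nat.card (R ⧸ P) = p ^ f) (g : SL(2, R)) (hg : g ∈ Δ)
    (ht : (g 0 0 + g 1 1) ^ 2 - 4 ∉ P) :
    (g 0 0 + g 1 1) ^ (p ^ f) - (g 0 0 + g 1 1) ∈ gI P Δ := by
  set t := g 0 0 + g 1 1 with htdef
  let _ : Field (R ⧸ P) := Ideal.Quotient.field P
  have _ : Fintype (R ⧸ P) := Fintype.ofFinite _
  have hcard : Fintype.card (R ⧸ P) = p ^ f := by rw [← hf, Nat.card_eq_fintype_card]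
  have _ : CharP (R ⧸ P) p := (CharP.charP_iff_prime_eq_zero Fact.out).2 (by
    rw [← map_natCast (Ideal.Quotient.mk P)]; exact Ideal.Quotient.eq_zero_iff_mem.2 hpP)
  have hgne : gI P Δ ≠ ⊤ := fun h => hP.ne_top (top_le_iff.1 (h ▸ gI_le))
  have _ : Nontrivial (R ⧸ gI P Δ) := Ideal.Quotient.nontrivial_iff.2 hgne
  have _ : CharP (R ⧸ gI P Δ) p := (CharP.charP_iff_prime_eq_zero Fact.out).2 (by
    rw [← map_natCast (Ideal.Quotient.mk _)]; exact Ideal.Quotient.eq_zero_iff_mem.2 hpg)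
  have h2F : (2 : R ⧸ P) ≠ 0 := by
    intro h
    apply h2
    rw [← Ideal.Quotient.eq_zero_iff_mem]
    simp only [map_sub, map_pow, map_ofNat]
    exact h
  have cayl : ∀ I : Ideal R, (Ideal.Quotient.mk I).mapMatrix (m g) * (Ideal.Quotient.mk I).mapMatrix (m g)
      = (Ideal.Quotient.mk I t) • (Ideal.Quotient.mk I).mapMatrix (m g) - 1 := by
    intro I
    rw [← map_mul, cayley, map_sub, map_one]
    congr 1
  have hF := frob_mat p hodd f _ _ (cayl P)
  have hB := frob_mat p hodd f _ _ (cayl (gI P Δ))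
  have htq : (Ideal.Quotient.mk P t) ^ (p ^ f) = Ideal.Quotient.mk P t := by
    rw [← hcard]; exact FiniteField.pow_card _
  have hD : (Ideal.Quotient.mk P t) ^ 2 - 4 ≠ 0 := by
    intro h
    apply ht
    rw [← Ideal.Quotient.eq_zero_iff_mem]
    simp only [map_sub, map_pow, map_ofNat]
    exact h
  have hdi := FiniteField.pow_dichotomy (F := R ⧸ P) (by
    intro h
    rw [ringChar.eq (R ⧸ P) p] at h
    rw [h] at hodd
    exact absurd hodd (by decide)) hD
  have hdiv : Fintype.card (R ⧸ P) / 2 = (p ^ f - 1) / 2 := by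
    obtain ⟨c, hc⟩ := hodd.pow (n := f)
    rw [hcard]; omega
  rw [hdiv] at hdi
  have key : ∃ k : SL(2, R), k ∈ Δ ∧ k 0 0 + k 1 1 = t ∧ m (g ^ (p ^ f)) - m k ∈ MI P := by
    rcases hdi with h | h
    · refine ⟨g, hg, rfl, ?_⟩
      rw [mem_MI_iff_map, map_sub, sub_eq_zero, m_pow, map_pow]
      rw [h, htq] at hF
      refine smul_right_injective _ h2F ?_
      show (2 : R ⧸ P) • _ = (2 : R ⧸ P) • _
      rw [hF]
      module
    · refine ⟨g⁻¹, Δ.inv_mem hg, ?_, ?_⟩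
      · rw [← m_apply, ← m_apply, m_inv, htdef]; simp [m_apply, add_comm]
      rw [mem_MI_iff_map, map_sub, sub_eq_zero, m_pow, map_pow]
      rw [h, htq] at hF
      have hinv : (Ideal.Quotient.mk P).mapMatrix (m g⁻¹) = (Ideal.Quotient.mk P t) • 1 -
          (Ideal.Quotient.mk P).mapMatrix (m g) := by
        rw [m_inv]
        ext i k
        fin_cases i <;> fin_cases k <;> simp [htdef, m_apply]
      refine smul_right_injective _ h2F ?_
      show (2 : R ⧸ P) • _ = (2 : R ⧸ P) • _
      rw [hF, hinv]
      module
  obtain ⟨k, hk, hkt, hkP⟩ := key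
  have h5 : m (g ^ (p ^ f) * k⁻¹) - 1 ∈ MI P := by
    have := MI_right (m (k⁻¹)) hkP
    rwa [sub_mul, mul_inv_coe, ← m_mul] at this
  have h6 := delta_entries hs hP h2 (Δ.mul_mem (Δ.pow_mem hg _) (Δ.inv_mem hk)) h5
  have h7 : m (g ^ (p ^ f)) - m k ∈ MI (gI P Δ) := by
    have := MI_right (m k) h6
    rwa [sub_mul, ← m_mul, inv_mul_cancel_right, one_mul] at this
  rw [mem_MI_iff_map, map_sub, sub_eq_zero, m_pow, map_pow] at h7
  rw [h7] at hB
  have h8 : 2 * (Ideal.Quotient.mk (gI P Δ) t) = 2 * (Ideal.Quotient.mk (gI P Δ) t) ^ (p ^ f) := by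
    have a := congrFun (congrFun hB 0) 0
    have b := congrFun (congrFun hB 1) 1
    simp [m_apply] at a b
    have hk' := congrArg (Ideal.Quotient.mk (gI P Δ)) hkt
    have ht' := congrArg (Ideal.Quotient.mk (gI P Δ)) htdef
    simp only [map_add] at hk' ht'
    linear_combination a + b - 2 * hk' - 2 * ((Ideal.Quotient.mk (gI P Δ) t) ^ 2 - 4) ^ ((p ^ f - 1) / 2) * ht'
  refine gI_div hP h2 ?_ ?_
  · rw [← Ideal.Quotient.eq_zero_iff_mem, map_sub, map_pow, htq, sub_self]
  · rw [← Ideal.Quotient.eq_zero_iff_mem, map_mul, map_sub, map_pow]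
    simp only [map_ofNat]
    linear_combination -h8

end Lift



namespace Lift

/-- The matrix `U`. -/
def UU {R : Type*} [CommRing R] : SL(2, R) := ⟨!![-1, 0; 1, -1], by simp [Matrix.det_fin_two_of]⟩

theorem P_le_gI {R : Type*} [CommRing R] {P : Ideal R} {Δ : Subgroup SL(2, R)}
    (hs : ∀ g : SL(2, R), ∃ δ ∈ Δ, m g - m δ ∈ MI P)
    (hP : P.IsMaximal) (h2 : (2 : R) ∉ P) (p : ℕ) [Fact p.Prime] (hodd : Odd p)
    (hpP : (p : R) ∈ P) [Finite (R ⧸ P)] {τ : R} (hτ : τ ∉ P)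
    (hgen : ∀ S : Subring R, τ ∈ S → S = ⊤) (hT : EU τ ∈ Δ) (hU : UU ∈ Δ) : P ≤ gI P Δ := by
  have hpg : (p : R) ∈ gI P Δ := by
    have h1 : EU (p * τ) ∈ Δ := by rw [← EU_pow]; exact Δ.pow_mem hT _
    have h3 : m (EU (p * τ)) - 1 ∈ MI P := by
      have e : m (EU ((p : R) * τ)) - 1 = !![0, p * τ; 0, 0] := by
        rw [m_EU]; ext i k; fin_cases i <;> fin_cases k <;> simp
      rw [e]
      exact mem_MI' (zero_mem _) (Ideal.mul_mem_right _ _ hpP) (zero_mem _) (zero_mem _)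
    have h4 := delta_entries hs hP h2 h1 h3 0 1
    rw [m_EU] at h4
    simp at h4
    refine gI_div hP hτ hpP ?_
    rwa [mul_comm]
  let _ : Field (R ⧸ P) := Ideal.Quotient.field P
  have _ : Fintype (R ⧸ P) := Fintype.ofFinite _
  have _ : CharP (R ⧸ P) p := (CharP.charP_iff_prime_eq_zero Fact.out).2 (by
    rw [← map_natCast (Ideal.Quotient.mk P)]; exact Ideal.Quotient.eq_zero_iff_mem.2 hpP)
  have hgne : gI P Δ ≠ ⊤ := fun h => hP.ne_top (top_le_iff.1 (h ▸ gI_le))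
  have _ : Nontrivial (R ⧸ gI P Δ) := Ideal.Quotient.nontrivial_iff.2 hgne
  have _ : CharP (R ⧸ gI P Δ) p := (CharP.charP_iff_prime_eq_zero Fact.out).2 (by
    rw [← map_natCast (Ideal.Quotient.mk _)]; exact Ideal.Quotient.eq_zero_iff_mem.2 hpg)
  obtain ⟨f, -, hf⟩ := FiniteField.card (R ⧸ P) p
  obtain ⟨f, hf0⟩ := f
  simp only [PNat.mk_coe] at hf
  have hcard : Nat.card (R ⧸ P) = p ^ f := by rw [Nat.card_eq_fintype_card, hf]
  have hfrob : ∀ t : R, t ^ (p ^ f) - t ∈ P := by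
    intro t
    rw [← Ideal.Quotient.eq_zero_iff_mem, map_sub, map_pow, ← hf, FiniteField.pow_card, sub_self]
  -- the subring fixed by the Frobenius
  let S : Subring R := ((iterateFrobenius (R ⧸ gI P Δ) p f).comp (Ideal.Quotient.mk _)).eqLocus
    (Ideal.Quotient.mk (gI P Δ))
  have hS : ∀ x : R, x ∈ S ↔ x ^ (p ^ f) - x ∈ gI P Δ := by
    intro x
    rw [← Ideal.Quotient.eq_zero_iff_mem, map_sub, map_pow, sub_eq_zero]
    change (iterateFrobenius (R ⧸ gI P Δ) p f) _ = _ ↔ _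
    rw [iterateFrobenius_def]
  have hk : ∀ k : ℕ, (k * τ) * (k * τ - 4) ∉ P → (k : R) * τ ∈ S := by
    intro k hk
    have h5 := frob_trace hs hP h2 p hodd hpP hpg f hcard (EU τ ^ k * UU)
      (Δ.mul_mem (Δ.pow_mem hT k) hU)
    have e : (EU τ ^ k * UU : SL(2, R)) 0 0 + (EU τ ^ k * UU : SL(2, R)) 1 1 = k * τ - 2 := by
      rw [EU_pow, ← m_apply, ← m_apply, m_mul, m_EU]
      simp [UU, m]
      ring
    rw [e] at h5
    have h6 := (hS _).2 (h5 (by convert hk using 2; ring))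
    have h7 := add_mem h6 (natCast_mem S 2)
    convert h7 using 1
    push_cast
    ring
  have h4 : (4 : R) ∉ P := by
    intro h
    rw [show (4 : R) = 2 * 2 by norm_num] at h
    exact (hP.isPrime.mem_or_mem h).elim h2 h2
  have hτS : τ ∈ S := by
    by_cases h : τ - 4 ∈ P
    · have h3 : ((2 : ℕ) : R) * τ ∈ S := by
        refine hk 2 fun h' => ?_
        push_cast at h'
        rcases hP.isPrime.mem_or_mem h' with h' | h'
        · exact (hP.isPrime.mem_or_mem h').elim h2 hτ
        · have := sub_mem h' (Ideal.mul_mem_left _ 2 h)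
          apply h4
          convert this using 1
          ring
      rw [hS] at h3 ⊢
      refine gI_div hP h2 (hfrob τ) ?_
      have h22 := (hS _).1 (natCast_mem S 2)
      have := sub_mem h3 (Ideal.mul_mem_right (τ ^ (p ^ f)) _ h22)
      convert this using 1
      push_cast
      ring
    · have h3 := hk 1 (by
        rw [Nat.cast_one, one_mul]
        exact fun h' => (hP.isPrime.mem_or_mem h').elim hτ h)
      rwa [Nat.cast_one, one_mul] at h3
  have htop := hgen S hτS
  intro x hx
  have h8 : x ^ (p ^ f) - x ∈ gI P Δ := (hS x).1 (htop ▸ Subring.mem_top x)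
  have h9 : x ^ (p ^ f) ∈ gI P Δ := by
    refine sq_le_gI ?_
    refine Ideal.pow_le_pow_right ?_ (Ideal.pow_mem_pow hx (p ^ f))
    calc 2 ≤ p := (Fact.out : p.Prime).two_le
      _ ≤ p ^ f := Nat.le_self_pow (by omega) p
  convert sub_mem h9 h8 using 1
  ring

end Lift



namespace Lift

theorem elem_gen {R : Type*} [CommRing R] [IsLocalRing R] (H : Subgroup SL(2, R))
    (hU : ∀ x, EU x ∈ H) (hL : ∀ x, EL x ∈ H) : H = ⊤ := by
  have main : ∀ g : SL(2, R), IsUnit (g 1 0) → g ∈ H := by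
    intro g hg
    obtain ⟨e, he⟩ := hg.exists_right_inv
    have hd := g.det_coe
    rw [Matrix.det_fin_two] at hd
    have : g = EU ((g 0 0 - 1) * e) * EL (g 1 0) * EU ((g 1 1 - 1) * e) := by
      ext i k
      rw [← m_apply, ← m_apply, m_mul, m_mul, m_EU, m_EU, m_EL]
      fin_cases i <;> fin_cases k <;> simp [m_apply]
      · linear_combination (1 - g 0 0) * he
      · linear_combination (-g 0 1 - (g 0 0 - 1) * (g 1 1 - 1) * e) * he + (- e) * hd
      · linear_combination (1 - g 1 1) * he
    rw [this]
    exact H.mul_mem (H.mul_mem (hU _) (hL _)) (hU _)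
  rw [eq_top_iff]
  intro g _
  by_cases hc : IsUnit (g 1 0)
  · exact main g hc
  have hd := g.det_coe
  rw [Matrix.det_fin_two] at hd
  have ha : IsUnit (g 0 0) := by
    have h1 : g 0 0 * g 1 1 + (- (g 0 1)) * g 1 0 = 1 := by linear_combination hd
    rcases IsLocalRing.isUnit_or_isUnit_of_add_one h1 with h | h
    · exact isUnit_of_mul_isUnit_left h
    · exact absurd (isUnit_of_mul_isUnit_right h) hc
  obtain ⟨e, he⟩ := ha.exists_right_inv
  have h2 : EL (e * (1 - g 1 0)) * g ∈ H := by
    apply main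
    have : (EL (e * (1 - g 1 0)) * g) 1 0 = 1 := by
      rw [← m_apply, m_mul, m_EL]
      simp [m_apply, Matrix.mul_apply]
      linear_combination (1 - g 1 0) * he
    rw [this]; exact isUnit_one
  have := H.mul_mem (H.inv_mem (hL (e * (1 - g 1 0)))) h2
  rwa [inv_mul_cancel_left] at this

theorem map_EU {R S : Type*} [CommRing R] [CommRing S] (π : R →+* S) (x : R) :
    Matrix.SpecialLinearGroup.map π (EU x) = EU (π x) := by
  apply Subtype.ext
  change π.mapMatrix !![1, x; 0, 1] = !![1, π x; 0, 1]
  ext i k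
  fin_cases i <;> fin_cases k <;> simp

theorem map_EL {R S : Type*} [CommRing R] [CommRing S] (π : R →+* S) (x : R) :
    Matrix.SpecialLinearGroup.map π (EL x) = EL (π x) := by
  apply Subtype.ext
  change π.mapMatrix !![1, 0; x, 1] = !![1, 0; π x, 1]
  ext i k
  fin_cases i <;> fin_cases k <;> simp

theorem map_UU {R S : Type*} [CommRing R] [CommRing S] (π : R →+* S) :
    Matrix.SpecialLinearGroup.map π UU = UU := by
  apply Subtype.ext
  change π.mapMatrix !![-1, 0; 1, -1] = !![-1, 0; 1, -1]
  ext i k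
  fin_cases i <;> fin_cases k <;> simp

theorem EL_pow {R : Type*} [CommRing R] (x : R) (k : ℕ) : EL x ^ k = EL (k * x) := by
  induction k with
  | zero =>
    rw [pow_zero]
    ext i k; fin_cases i <;> fin_cases k <;> simp [EL]
  | succ k ih =>
    rw [pow_succ, ih]
    ext i k
    rw [← m_apply, m_mul, ← m_apply, m_EL, m_EL, m_EL]
    fin_cases i <;> fin_cases k <;> simp
    ring

theorem UU_eq {R : Type*} [CommRing R] : (UU : SL(2, R)) = - EL (-1) := by
  apply Subtype.ext
  rw [Matrix.SpecialLinearGroup.coe_neg]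
  change !![-1, 0; 1, -1] = - !![1, 0; -1, 1]
  ext i k
  fin_cases i <;> fin_cases k <;> simp

theorem field_gen {F : Type*} [Field F] [Fintype F] (p : ℕ) [CharP F p] (hodd : Odd p)
    (h2 : (2 : F) ≠ 0) (H : Subgroup SL(2, F)) {τ : F} (hτ : τ ≠ 0)
    (hgen : ∀ S : Subring F, τ ∈ S → S = ⊤) (hT : EU τ ∈ H) (hU : UU ∈ H)
    (hex : ¬ ((3 : F) = 0 ∧ τ ^ 2 = -1)) : H = ⊤ := by
  have hneg : (-1 : SL(2, F)) ∈ H := by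
    have h := H.pow_mem hU p
    rw [UU_eq, hodd.neg_pow, EL_pow, CharP.cast_eq_zero, zero_mul] at h
    have e : (EL 0 : SL(2, F)) = 1 := by
      ext i k; fin_cases i <;> fin_cases k <;> simp [EL]
    rwa [e] at h
  have hE : EL (-1) ∈ H := by
    have := H.mul_mem hneg hU
    rwa [UU_eq, neg_mul_neg, one_mul] at this
  let Q : F → F → F → F → Prop := fun a b c d =>
    ∃ g ∈ H, g 0 0 = d ∧ g 0 1 = -c ∧ g 1 0 = -b ∧ g 1 1 = a
  have hQ : GrpQ Q :=
    { det := by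
        rintro a b c d ⟨g, hg, h1, h2, h3, h4⟩
        have hd := g.det_coe
        rw [Matrix.det_fin_two, h1, h2, h3, h4] at hd
        linear_combination hd
      mul := by
        rintro a b c d a' b' c' d' ⟨g, hg, h1, h2, h3, h4⟩ ⟨g', hg', h1', h2', h3', h4'⟩
        refine ⟨g * g', H.mul_mem hg hg', ?_, ?_, ?_, ?_⟩ <;>
          rw [Matrix.SpecialLinearGroup.coe_mul, Matrix.mul_apply, Fin.sum_univ_two] <;>
          simp only [h1, h2, h3, h4, h1', h2', h3', h4'] <;> ring
      inv := by
        rintro a b c d ⟨g, hg, h1, h2, h3, h4⟩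
        refine ⟨g⁻¹, H.inv_mem hg, ?_, ?_, ?_, ?_⟩ <;>
          rw [Matrix.SpecialLinearGroup.coe_inv, Matrix.adjugate_fin_two] <;>
          simp [h1, h2, h3, h4]
      neg := by
        rintro a b c d ⟨g, hg, h1, h2, h3, h4⟩
        refine ⟨-1 * g, H.mul_mem hneg hg, ?_, ?_, ?_, ?_⟩ <;>
          rw [neg_one_mul, Matrix.SpecialLinearGroup.coe_neg] <;>
          simp [h1, h2, h3, h4]
      e1 := ⟨EL (-1), hE, by simp [EL], by simp [EL], by simp [EL], by simp [EL]⟩ }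
  have hμ : -τ ≠ 0 := neg_ne_zero.2 hτ
  have hs : Q 1 0 (-τ) 1 := ⟨EU τ, hT, by simp [EU], by simp [EU], by simp [EU], by simp [EU]⟩
  have hA := hQ.dickson h2 hμ hs (by rwa [neg_sq])
  have hK : τ ∈ (hQ.Af hμ hs).toSubring := by
    have : -τ ∈ (hQ.Af hμ hs).toSubring := hA
    have := neg_mem this
    rwa [neg_neg] at this
  have htop := hgen _ hK
  have hL : ∀ x, EL x ∈ H := by
    intro x
    have h1 : -x ∈ (hQ.Af hμ hs).toSubring := htop ▸ Subring.mem_top _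
    obtain ⟨g, hg, h1, h2, h3, h4⟩ : Q 1 (-x) 0 1 := h1
    convert hg using 1
    ext i k
    fin_cases i <;> fin_cases k <;> simp [EL, h1, h2, h3, h4]
  refine elem_gen H ?_ hL
  intro x
  -- conjugate by the Weyl element
  have hw := H.mul_mem (H.mul_mem (hL (-τ⁻¹)) hT) (hL (-τ⁻¹))
  have := H.mul_mem (H.mul_mem hw (hL (- x * τ⁻¹ ^ 2))) (H.inv_mem hw)
  convert this using 1
  ext i k
  simp only [_root_.mul_inv_rev, ← m_apply, m_mul, m_inv, m_EL, m_EU]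
  fin_cases i <;> fin_cases k <;> simp <;> field_simp <;> ring

theorem surj_mod {R : Type*} [CommRing R] {P : Ideal R} {Δ : Subgroup SL(2, R)}
    (hP : P.IsMaximal) (h2 : (2 : R) ∉ P) (p : ℕ) [Fact p.Prime] (hodd : Odd p)
    (hpP : (p : R) ∈ P) [Finite (R ⧸ P)] {τ : R} (hτ : τ ∉ P)
    (hgen : ∀ S : Subring R, τ ∈ S → S = ⊤) (hT : EU τ ∈ Δ) (hU : UU ∈ Δ)
    (hex : ¬ ((3 : R) ∈ P ∧ τ ^ 2 + 1 ∈ P)) (g : SL(2, R)) : ∃ δ ∈ Δ, m g - m δ ∈ MI P := by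
  let _ : Field (R ⧸ P) := Ideal.Quotient.field P
  have _ : Fintype (R ⧸ P) := Fintype.ofFinite _
  have _ : CharP (R ⧸ P) p := (CharP.charP_iff_prime_eq_zero Fact.out).2 (by
    rw [← map_natCast (Ideal.Quotient.mk P)]; exact Ideal.Quotient.eq_zero_iff_mem.2 hpP)
  let π := Ideal.Quotient.mk P
  have hπ : ∀ x, π x = 0 ↔ x ∈ P := fun x => Ideal.Quotient.eq_zero_iff_mem
  have hH := field_gen (F := R ⧸ P) p hodd (by
      intro h
      apply h2
      rw [← hπ, map_ofNat]; exact h)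
    (Δ.map (Matrix.SpecialLinearGroup.map π)) (τ := π τ) (by rwa [Ne, hπ])
    (by
      intro S hS
      have := hgen (S.comap π) hS
      rw [eq_top_iff]
      intro x _
      obtain ⟨y, rfl⟩ := Ideal.Quotient.mk_surjective x
      have hy : y ∈ S.comap π := this ▸ Subring.mem_top y
      exact hy)
    (by
      refine ⟨EU τ, hT, map_EU _ _⟩)
    (by
      refine ⟨UU, hU, map_UU _⟩)
    (by
      rintro ⟨h3, h4⟩
      refine hex ⟨?_, ?_⟩
      · rw [← hπ, map_ofNat]; exact h3
      · rw [← hπ, map_add, map_pow, h4, map_one]; simp)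
  have hg : Matrix.SpecialLinearGroup.map π g ∈ Δ.map (Matrix.SpecialLinearGroup.map π) :=
    hH ▸ Subgroup.mem_top _
  obtain ⟨δ, hδ, h⟩ := hg
  refine ⟨δ, hδ, mem_MI_iff_map.2 ?_⟩
  rw [map_sub, sub_eq_zero]
  exact (congrArg Subtype.val h).symm

theorem local_quot {R : Type*} [CommRing R] {P : Ideal R} (hP : P.IsMaximal) (d : ℕ)
    (hd : 1 ≤ d) : IsLocalRing (R ⧸ P ^ d) := by
  have hne : P ^ d ≠ ⊤ := fun h => hP.ne_top (top_le_iff.1 (h ▸ Ideal.pow_le_self (by omega)))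
  have _ : Nontrivial (R ⧸ P ^ d) := Ideal.Quotient.nontrivial_iff.2 hne
  have key : ∀ x : R, x ∉ P → IsUnit (Ideal.Quotient.mk (P ^ d) x) := by
    intro x hx
    obtain ⟨y, hy⟩ := exists_inv hP hx
    have h1 : IsNilpotent (Ideal.Quotient.mk (P ^ d) (y * x - 1)) :=
      ⟨d, by rw [← map_pow]; exact Ideal.Quotient.eq_zero_iff_mem.2 (Ideal.pow_mem_pow hy d)⟩
    have h2 := h1.isUnit_one_add
    rw [← map_one (Ideal.Quotient.mk (P ^ d)), ← map_add, add_sub_cancel, map_mul] at h2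
    exact isUnit_of_mul_isUnit_right h2
  refine IsLocalRing.of_isUnit_or_isUnit_one_sub_self fun a => ?_
  obtain ⟨x, rfl⟩ := Ideal.Quotient.mk_surjective a
  by_cases hx : x ∈ P
  · right
    rw [← map_one (Ideal.Quotient.mk (P ^ d)), ← map_sub]
    refine key _ fun h => hP.ne_top ((Ideal.eq_top_iff_one _).2 ?_)
    convert add_mem h hx using 1
    ring
  · left; exact key _ hx

theorem final_surj {R : Type*} [CommRing R] {P : Ideal R} {Δ : Subgroup SL(2, R)}
    (hP : P.IsMaximal) (h2 : (2 : R) ∉ P) (p : ℕ) [Fact p.Prime] (hodd : Odd p)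
    (hpP : (p : R) ∈ P) [Finite (R ⧸ P)] {τ : R} (hτ : τ ∉ P)
    (hgen : ∀ S : Subring R, τ ∈ S → S = ⊤) (hT : EU τ ∈ Δ) (hU : UU ∈ Δ)
    (hex : ¬ ((3 : R) ∈ P ∧ τ ^ 2 + 1 ∈ P)) (d : ℕ) (hd : 1 ≤ d) :
    Δ.map (Matrix.SpecialLinearGroup.map (Ideal.Quotient.mk (P ^ d))) = ⊤ := by
  have hs := surj_mod hP h2 p hodd hpP hτ hgen hT hU hex
  have hg := P_le_gI hs hP h2 p hodd hpP hτ hgen hT hU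
  have key : ∀ g : SL(2, R), Matrix.SpecialLinearGroup.map (Ideal.Quotient.mk (P ^ d)) g ∈
      Δ.map (Matrix.SpecialLinearGroup.map (Ideal.Quotient.mk (P ^ d))) := by
    intro g
    obtain ⟨δ, hδ, h⟩ := approx hP h2 hs hg g d hd
    refine ⟨δ, hδ, ?_⟩
    rw [mem_MI_iff_map, map_sub, sub_eq_zero] at h
    exact Subtype.ext h.symm
  have _ := local_quot hP d hd
  refine elem_gen _ ?_ ?_
  · intro x
    obtain ⟨y, rfl⟩ := Ideal.Quotient.mk_surjective x
    rw [← map_EU]; exact key _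
  · intro x
    obtain ⟨y, rfl⟩ := Ideal.Quotient.mk_surjective x
    rw [← map_EL]; exact key _

end Lift
theorem Oring_gen (ζ : ℂ) (S : Subring (Oring ζ)) (hS : 2 + lamO ζ ∈ S) : S = ⊤ := by
  have hl : lamO ζ ∈ S := by
    have := sub_mem hS (natCast_mem S 2)
    convert this using 1
    push_cast
    ring
  rw [eq_top_iff]
  rintro ⟨x, hx⟩ -
  induction hx using Algebra.adjoin_induction with
  | mem x hx =>
    rw [Set.mem_singleton_iff] at hx
    subst hx
    exact hl
  | algebraMap r => exact intCast_mem S r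
  | add x y hx hy h1 h2 => exact S.add_mem h1 h2
  | mul x y hx hy h1 h2 => exact S.mul_mem h1 h2

theorem Oring_finite (n : ℕ) (hn : 3 ≤ n) (ζ : ℂ) (hζ : IsPrimitiveRoot ζ n)
    (P : Ideal (Oring ζ)) (hP : P ≠ ⊥) : Finite (Oring ζ ⧸ P) := by
  have h1 : IsIntegral ℤ ζ := hζ.isIntegral (by omega)
  have h2 : IsIntegral ℤ ζ⁻¹ := hζ.inv.isIntegral (by omega)
  have h3 : (Oring ζ).toSubmodule.FG := (h1.add h2).fg_adjoin_singleton
  have : Module.Finite ℤ (Oring ζ) := Module.Finite.iff_fg.2 h3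
  exact Ideal.finiteQuotientOfFreeOfNeBot P hP

/-- A primitive root of unity in an extension of the residue field. -/
theorem exists_omega (n : ℕ) (hn : 3 ≤ n) (ζ : ℂ) (hζ : IsPrimitiveRoot ζ n)
    (p : ℕ) (hp : p.Prime) (a m : ℕ) (hm : ¬ p ∣ m) (hnm : n = p ^ a * m)
    (P : Ideal (Oring ζ)) (hP : P.IsMaximal) (hpP : (p : Oring ζ) ∈ P) :
    ∃ (L : Type) (_ : Field L) (_ : CharP L p) (φ : Oring ζ →+* L) (ω : L),
      (∀ x ∈ P, φ x = 0) ∧ IsPrimitiveRoot ω m ∧ φ (lamO ζ) * ω = ω ^ 2 + 1 := by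
  have hζi : IsIntegral (Oring ζ) ζ := (hζ.isIntegral (by omega)).tower_top
  obtain ⟨Q, hQ, hQP⟩ := Ideal.exists_ideal_over_maximal_of_isIntegral
    (S := integralClosure (Oring ζ) ℂ) P (by
      rw [(RingHom.injective_iff_ker_eq_bot _).1
        (FaithfulSMul.algebraMap_injective (Oring ζ) (integralClosure (Oring ζ) ℂ))]
      exact bot_le)
  let z : integralClosure (Oring ζ) ℂ := ⟨ζ, hζi⟩
  let _ : Field (integralClosure (Oring ζ) ℂ ⧸ Q) := Ideal.Quotient.field Q
  let φ : Oring ζ →+* (integralClosure (Oring ζ) ℂ ⧸ Q) :=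
    (Ideal.Quotient.mk Q).comp (algebraMap _ _)
  have hφ : ∀ x ∈ P, φ x = 0 := by
    intro x hx
    rw [← hQP] at hx
    exact Ideal.Quotient.eq_zero_iff_mem.2 hx
  have hch : CharP (integralClosure (Oring ζ) ℂ ⧸ Q) p :=
    (CharP.charP_iff_prime_eq_zero hp).2 (by rw [← map_natCast φ]; exact hφ _ hpP)
  refine ⟨_, inferInstance, hch, φ, Ideal.Quotient.mk Q z, hφ, ?_, ?_⟩
  · have _ : Fact p.Prime := ⟨hp⟩
    have _ : NeZero (m : integralClosure (Oring ζ) ℂ ⧸ Q) :=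
      ⟨fun h => hm ((CharP.cast_eq_zero_iff _ p m).1 h)⟩
    have h1 : (Polynomial.cyclotomic n (integralClosure (Oring ζ) ℂ)).eval z = 0 := by
      have h2 : (Polynomial.cyclotomic n ℂ).eval ζ = 0 := hζ.isRoot_cyclotomic (by omega)
      have hinj : Function.Injective (algebraMap (integralClosure (Oring ζ) ℂ) ℂ) :=
        Subtype.val_injective
      apply hinj
      rw [map_zero, ← h2, ← Polynomial.map_cyclotomic n (algebraMap (integralClosure (Oring ζ) ℂ) ℂ),
        Polynomial.eval_map]
      exact (Polynomial.eval₂_at_apply (algebraMap (integralClosure (Oring ζ) ℂ) ℂ) z).symm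
    have h3 : (Polynomial.cyclotomic n (integralClosure (Oring ζ) ℂ ⧸ Q)).IsRoot
        (Ideal.Quotient.mk Q z) := by
      rw [Polynomial.IsRoot, ← Polynomial.map_cyclotomic n (Ideal.Quotient.mk Q),
        Polynomial.eval_map_apply, h1, map_zero]
    rw [hnm] at h3
    exact (Polynomial.isRoot_cyclotomic_prime_pow_mul_iff_of_charP).1 h3
  · have h0 : ζ ≠ 0 := hζ.ne_zero (by omega)
    have : algebraMap (Oring ζ) (integralClosure (Oring ζ) ℂ) (lamO ζ) * z = z ^ 2 + 1 := by
      apply Subtype.ext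
      change (ζ + ζ⁻¹) * ζ = ζ ^ 2 + 1
      field_simp
    have h4 := congrArg (Ideal.Quotient.mk Q) this
    rwa [map_mul, map_add, map_pow, map_one] at h4

theorem surjective_mod_prime_power_ramified
    (n : ℕ) (hn : 3 ≤ n) (ζ : ℂ) (hζ : IsPrimitiveRoot ζ n)
    (p : ℕ) (hp : p.Prime) (hpodd : Odd p) (hpn : p ∣ n)
    (h1 : ∀ k : ℕ, 1 ≤ k → n ≠ 2 * p ^ k)
    (h2 : ∀ k : ℕ, 1 ≤ k → n ≠ 5 * 3 ^ k)
    (𝔭 : Ideal (Oring ζ)) (h𝔭 : 𝔭.IsMaximal) (hp𝔭 : (p : Oring ζ) ∈ 𝔭)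
    (d : ℕ) (hd : 1 ≤ d) :
    (Delta ζ).map (SLred ζ (𝔭 ^ d)) = ⊤ := by
  obtain ⟨a, m, hm, hnm⟩ := Nat.exists_eq_pow_mul_and_not_dvd (n := n) (by omega) p hp.ne_one
  have ha : 1 ≤ a := by
    rcases Nat.eq_zero_or_pos a with rfl | h
    · rw [pow_zero, one_mul] at hnm
      exact absurd (hnm ▸ hpn) hm
    · exact h
  obtain ⟨L, _, _, φ, ω, hφ, hω, hlam⟩ := exists_omega n hn ζ hζ p hp a m hm hnm 𝔭 h𝔭 hp𝔭
  have hp2 : p ≠ 2 := by rintro rfl; exact absurd hpodd (by decide)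
  have h2L : (2 : L) ≠ 0 := by
    intro h
    have h' : ((2 : ℕ) : L) = 0 := by exact_mod_cast h
    rw [CharP.cast_eq_zero_iff L p] at h'
    exact hp2 ((Nat.prime_dvd_prime_iff_eq hp Nat.prime_two).1 h')
  have _ : Fact p.Prime := ⟨hp⟩
  have _ : Finite (Oring ζ ⧸ 𝔭) := by
    refine Oring_finite n hn ζ hζ 𝔭 fun h => ?_
    rw [h, Ideal.mem_bot] at hp𝔭
    exact hp.ne_zero (by exact_mod_cast hp𝔭)
  refine Lift.final_surj (τ := 2 + lamO ζ) h𝔭 ?_ p hpodd hp𝔭 ?_ (Oring_gen ζ) ?_ ?_ ?_ d hd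
  · intro h
    have := hφ _ h
    rw [map_ofNat] at this
    exact h2L this
  · intro h
    have h3 := hφ _ h
    rw [map_add, map_ofNat] at h3
    have h4 : (ω + 1) ^ 2 = 0 := by linear_combination ω * h3 - hlam
    have h5 : ω = -1 := eq_neg_of_add_eq_zero_left (pow_eq_zero_iff (two_ne_zero)|>.1 h4)
    have h6 : m = 2 := by
      rw [hω.eq_orderOf, h5, orderOf_neg_one, if_neg]
      rw [ringChar.eq L p]; exact hp2
    exact h1 a ha (by rw [hnm, h6, mul_comm])
  · exact Subgroup.subset_closure (Or.inl rfl)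
  · exact Subgroup.subset_closure (Or.inr rfl)
  · rintro ⟨h3, h4⟩
    have h3 := hφ _ h3
    have h4 := hφ _ h4
    rw [map_ofNat] at h3
    rw [map_add, map_pow, map_add, map_ofNat, map_one] at h4
    have hp3 : p = 3 := by
      have h' : ((3 : ℕ) : L) = 0 := by exact_mod_cast h3
      rw [CharP.cast_eq_zero_iff L p] at h'
      exact (Nat.prime_dvd_prime_iff_eq hp Nat.prime_three).1 h'
    have h5 : ω ^ 4 + ω ^ 3 + ω ^ 2 + ω + 1 = 0 := by
      linear_combination ω ^ 2 * h4 - (φ (lamO ζ) * ω + ω ^ 2 + 1 + 4 * ω) * hlam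
        - (ω ^ 3 + 2 * ω ^ 2 + ω) * h3
    have h6 : ω ^ 5 = 1 := by linear_combination (ω - 1) * h5
    have h7 : m ∣ 5 := hω.dvd_of_pow_eq_one 5 h6
    rcases (Nat.dvd_prime Nat.prime_five).1 h7 with h | h
    · rw [h, IsPrimitiveRoot.one_right_iff] at hω
      rw [hω] at h5
      exact h2L (by linear_combination h5 - h3)
    · exact h2 a ha (by rw [hnm, h, hp3, mul_comm])

end
end

section
/- Let m > 1 be an odd integer, let ω be a primitive m-th root of unity in an algebraic closure of 𝔽₂, set t = ω + ω⁻¹, and let F = 𝔽₂(t), a finite field of characteristic 2. Let D be the subgroup of SL₂(F) generated by the two matrices [[1, t], [0, 1]] and [[1, 0], [1, 1]], and let Q = {[[b + c, b·t], [c, b + c]] : b, c ∈ F}, an additive subgroup of the 2×2 matrices over F. Then Q is stable under conjugation by D, and the only additive subgroups of Q that are stable under conjugation by every element of D are {0} and Q itself. -/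
open Matrix
open scoped MatrixGroups

set_option synthInstance.maxHeartbeats 1000000
set_option maxHeartbeats 1000000

noncomputable section

/-- The field `F = 𝔽₂(t)` where `t = ω + ω⁻¹`. -/
abbrev Ffield (ω : AlgebraicClosure (ZMod 2)) :
    IntermediateField (ZMod 2) (AlgebraicClosure (ZMod 2)) :=
  IntermediateField.adjoin (ZMod 2) {ω + ω⁻¹}

/-- The element `t = ω + ω⁻¹` of `F`. -/
def tF (ω : AlgebraicClosure (ZMod 2)) : Ffield ω :=
  ⟨ω + ω⁻¹, IntermediateField.subset_adjoin _ _ rfl⟩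

/-- The dihedral subgroup `D` of `SL₂(F)` generated by `[[1, t], [0, 1]]` and `[[1, 0], [1, 1]]`. -/
def Dgrp (ω : AlgebraicClosure (ZMod 2)) : Subgroup SL(2, Ffield ω) :=
  Subgroup.closure
    {⟨!![1, tF ω; 0, 1], by rw [Matrix.det_fin_two_of]; ring⟩,
     ⟨!![1, 0; 1, 1], by rw [Matrix.det_fin_two_of]; ring⟩}

/-- The set `Q` of matrices `[[b + c, b·t], [c, b + c]]`. -/
def Qset (ω : AlgebraicClosure (ZMod 2)) : Set (Matrix (Fin 2) (Fin 2) (Ffield ω)) :=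
  {A | ∃ b c : Ffield ω, A = !![b + c, b * tF ω; c, b + c]}

theorem aux_sq_mem {K : Type*} [Field K] [Finite K] [CharP K 2] (t : K) (S : Subring K)
    (h : t * t ∈ S) : t ∈ S := by
  have := Fintype.ofFinite K
  obtain ⟨n, hp, hc⟩ := FiniteField.card K 2
  have h1 := FiniteField.pow_card t
  rw [hc] at h1
  obtain ⟨k, hk⟩ : ∃ k, (n : ℕ) = k + 1 := ⟨n - 1, by have := n.pos; omega⟩
  rw [hk, pow_succ', pow_mul, pow_two] at h1
  rw [← h1]
  exact S.pow_mem h _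

theorem aux_top {K : Type*} [Field K] [Finite K] [CharP K 2] (t : K) (ht : t ≠ 0)
    (hgen : ∀ S : Subring K, t ∈ S → ∀ x, x ∈ S) (V : AddSubgroup (K × K))
    (h1 : ∀ b c, (b, c) ∈ V → (b + t * c, c) ∈ V)
    (h2 : ∀ b c, (b, c) ∈ V → (b, c + t * b) ∈ V)
    (b0 c0 : K) (h0 : (b0, c0) ∈ V) (hne : b0 ≠ 0 ∨ c0 ≠ 0) (x y : K) : (x, y) ∈ V := by
  have g1 : ∀ b c, (b, c) ∈ V → (t * c, 0) ∈ V := fun b c h => by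
    simpa using V.sub_mem (h1 b c h) h
  have g2 : ∀ b c, (b, c) ∈ V → (0, t * b) ∈ V := fun b c h => by
    simpa using V.sub_mem (h2 b c h) h
  let S : Subring K :=
    { carrier := {x | ∀ s, (s, (0 : K)) ∈ V → (x * s, (0 : K)) ∈ V}
      mul_mem' := fun {a b} ha hb s hs => by
        rw [mul_assoc]; exact ha _ (hb _ hs)
      one_mem' := fun s hs => by simpa using hs
      add_mem' := fun {a b} ha hb s hs => by
        simpa [add_mul] using V.add_mem (ha _ hs) (hb _ hs)
      zero_mem' := fun s hs => by
        rw [zero_mul]; exact V.zero_mem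
      neg_mem' := fun {a} ha s hs => by
        simpa using V.neg_mem (ha _ hs) }
  have hS : ∀ x, x ∈ S := hgen S (aux_sq_mem t S (fun s hs => by
    rw [mul_assoc]; exact g1 _ _ (g2 _ _ hs)))
  obtain ⟨s, hs0, hs⟩ : ∃ s, s ≠ 0 ∧ (s, (0 : K)) ∈ V := by
    rcases hne with h | h
    · exact ⟨t * (t * b0), by simp [ht, h], g1 _ _ (g2 _ _ h0)⟩
    · exact ⟨t * c0, by simp [ht, h], g1 _ _ h0⟩
  have hx : ∀ x, (x, (0 : K)) ∈ V := fun x => by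
    have := hS (x / s) s hs
    rwa [div_mul_cancel₀ _ hs0] at this
  have hy : ((0 : K), y) ∈ V := by
    have := g2 _ _ (hx (y / t))
    rwa [mul_div_cancel₀ _ ht] at this
  simpa using V.add_mem (hx x) hy

theorem aux_conj1 {K : Type*} [Field K] [CharP K 2] (t b c : K) (g : SL(2, K))
    (h : (g : Matrix (Fin 2) (Fin 2) K) = !![1, t; 0, 1]) :
    (g : Matrix (Fin 2) (Fin 2) K) * !![b + c, b * t; c, b + c] *
      ((g⁻¹ : SL(2, K)) : Matrix (Fin 2) (Fin 2) K) =
      !![(b + t * c) + c, (b + t * c) * t; c, (b + t * c) + c] := by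
  have h2 : (2 : K) = 0 := CharTwo.two_eq_zero
  rw [Matrix.SpecialLinearGroup.coe_inv, h]
  ext i j
  fin_cases i <;> fin_cases j <;> simp [Matrix.adjugate_fin_two, Matrix.mul_apply] <;> grind

theorem aux_conj2 {K : Type*} [Field K] [CharP K 2] (t b c : K) (g : SL(2, K))
    (h : (g : Matrix (Fin 2) (Fin 2) K) = !![1, 0; 1, 1]) :
    (g : Matrix (Fin 2) (Fin 2) K) * !![b + c, b * t; c, b + c] *
      ((g⁻¹ : SL(2, K)) : Matrix (Fin 2) (Fin 2) K) =
      !![b + (c + t * b), b * t; c + t * b, b + (c + t * b)] := by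
  have h2 : (2 : K) = 0 := CharTwo.two_eq_zero
  rw [Matrix.SpecialLinearGroup.coe_inv, h]
  ext i j
  fin_cases i <;> fin_cases j <;> simp [Matrix.adjugate_fin_two, Matrix.mul_apply] <;> grind

theorem aux_inv {K : Type*} [Field K] [CharP K 2] (s u : K) (g : SL(2, K))
    (h : (g : Matrix (Fin 2) (Fin 2) K) = !![1, s; u, 1]) : g⁻¹ = g := by
  apply Subtype.ext
  rw [Matrix.SpecialLinearGroup.coe_inv, h]
  ext i j
  fin_cases i <;> fin_cases j <;> simp [Matrix.adjugate_fin_two, CharTwo.neg_eq]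

/-- The parametrisation of `Q`. -/
def auxQ {K : Type*} [Field K] (t : K) : K × K →+ Matrix (Fin 2) (Fin 2) K where
  toFun p := !![p.1 + p.2, p.1 * t; p.2, p.1 + p.2]
  map_zero' := by ext i j; fin_cases i <;> fin_cases j <;> simp
  map_add' p q := by
    ext i j; fin_cases i <;> fin_cases j <;> simp <;> ring

theorem aux_gen (ω : AlgebraicClosure (ZMod 2)) (S : Subring (Ffield ω)) (h : tF ω ∈ S)
    (x : Ffield ω) : x ∈ S := by
  have hint : IsIntegral (ZMod 2) (ω + ω⁻¹) := Algebra.IsIntegral.isIntegral _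
  have hx : (x : AlgebraicClosure (ZMod 2)) ∈ Algebra.adjoin (ZMod 2) {ω + ω⁻¹} := by
    rw [← IntermediateField.adjoin_simple_toSubalgebra_of_isAlgebraic hint.isAlgebraic]
    exact x.2
  have key : ∀ y ∈ Algebra.adjoin (ZMod 2) {ω + ω⁻¹}, ∃ z ∈ S, (z : AlgebraicClosure (ZMod 2)) = y := by
    intro y hy
    induction hy using Algebra.adjoin_induction with
    | mem y hy => exact ⟨tF ω, h, by rw [Set.mem_singleton_iff.1 hy]; rfl⟩
    | algebraMap r =>
      refine ⟨(r.val : Ffield ω), natCast_mem S _, ?_⟩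
      conv_rhs => rw [← ZMod.natCast_zmod_val r]
      rw [map_natCast]
      rfl
    | add a b _ _ ha hb =>
      obtain ⟨a', ha, rfl⟩ := ha
      obtain ⟨b', hb, rfl⟩ := hb
      exact ⟨a' + b', S.add_mem ha hb, rfl⟩
    | mul a b _ _ ha hb =>
      obtain ⟨a', ha, rfl⟩ := ha
      obtain ⟨b', hb, rfl⟩ := hb
      exact ⟨a' * b', S.mul_mem ha hb, rfl⟩
  obtain ⟨z, hz, hzx⟩ := key _ hx
  rwa [← Subtype.ext hzx]

theorem aux_finite (ω : AlgebraicClosure (ZMod 2)) : Finite (Ffield ω) := by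
  have hint : IsIntegral (ZMod 2) (ω + ω⁻¹) := Algebra.IsIntegral.isIntegral _
  have := IntermediateField.adjoin.finiteDimensional hint
  exact Module.finite_of_finite (ZMod 2)

theorem aux_t_ne (m : ℕ) (hm1 : 1 < m) (hmodd : Odd m)
    (ω : AlgebraicClosure (ZMod 2)) (hω : IsPrimitiveRoot ω m) : tF ω ≠ 0 := by
  intro h
  have h1 : ω + ω⁻¹ = 0 := congrArg Subtype.val h
  have h0 : ω ≠ 0 := hω.ne_zero (by omega)
  have : CharP (AlgebraicClosure (ZMod 2)) 2 := charP_of_injective_algebraMap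
    (algebraMap (ZMod 2) (AlgebraicClosure (ZMod 2))).injective 2
  have h2 : ω ^ 2 = 1 := by
    rw [CharTwo.add_eq_zero] at h1
    rw [pow_two]
    nth_rewrite 2 [h1]
    exact mul_inv_cancel₀ h0
  have h3 := (Nat.dvd_prime Nat.prime_two).1 (hω.dvd_of_pow_eq_one 2 h2)
  rcases h3 with h3 | h3
  · omega
  · subst h3; exact absurd hmodd (by decide)

theorem Qset_conj_stable_and_irreducible
    (m : ℕ) (hm1 : 1 < m) (hmodd : Odd m)
    (ω : AlgebraicClosure (ZMod 2)) (hω : IsPrimitiveRoot ω m) :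
    (∀ g ∈ Dgrp ω, ∀ A ∈ Qset ω,
      (g : Matrix (Fin 2) (Fin 2) (Ffield ω)) * A *
        ((g⁻¹ : SL(2, Ffield ω)) : Matrix (Fin 2) (Fin 2) (Ffield ω)) ∈ Qset ω) ∧
    (∀ W : AddSubgroup (Matrix (Fin 2) (Fin 2) (Ffield ω)),
      (W : Set (Matrix (Fin 2) (Fin 2) (Ffield ω))) ⊆ Qset ω →
      (∀ g ∈ Dgrp ω, ∀ A ∈ W,
        (g : Matrix (Fin 2) (Fin 2) (Ffield ω)) * A *
          ((g⁻¹ : SL(2, Ffield ω)) : Matrix (Fin 2) (Fin 2) (Ffield ω)) ∈ W) →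
      (W : Set (Matrix (Fin 2) (Fin 2) (Ffield ω))) = {0} ∨
      (W : Set (Matrix (Fin 2) (Fin 2) (Ffield ω))) = Qset ω) := by
  have hch : CharP (Ffield ω) 2 := charP_of_injective_algebraMap
    (algebraMap (ZMod 2) (Ffield ω)).injective 2
  have hfin := aux_finite ω
  constructor
  · intro g hg
    unfold Dgrp at hg
    have hinv : ∀ s ∈ ({⟨!![1, tF ω; 0, 1], by rw [Matrix.det_fin_two_of]; ring⟩,
        ⟨!![1, 0; 1, 1], by rw [Matrix.det_fin_two_of]; ring⟩} : Set SL(2, Ffield ω)),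
        s⁻¹ = s := by
      rintro s (rfl | rfl)
      · exact aux_inv _ _ _ rfl
      · exact aux_inv _ _ _ rfl
    have hgen : ∀ s ∈ ({⟨!![1, tF ω; 0, 1], by rw [Matrix.det_fin_two_of]; ring⟩,
        ⟨!![1, 0; 1, 1], by rw [Matrix.det_fin_two_of]; ring⟩} : Set SL(2, Ffield ω)),
        ∀ A ∈ Qset ω, (s : Matrix (Fin 2) (Fin 2) (Ffield ω)) * A *
        ((s⁻¹ : SL(2, Ffield ω)) : Matrix (Fin 2) (Fin 2) (Ffield ω)) ∈ Qset ω := by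
      rintro s (rfl | rfl) A ⟨b, c, rfl⟩
      · exact ⟨_, _, aux_conj1 _ b c _ rfl⟩
      · exact ⟨_, _, aux_conj2 _ b c _ rfl⟩
    have hmul : ∀ x y : SL(2, Ffield ω), ∀ A : Matrix (Fin 2) (Fin 2) (Ffield ω),
        ((x * y : SL(2, Ffield ω)) : Matrix (Fin 2) (Fin 2) (Ffield ω)) * A *
          (((x * y)⁻¹ : SL(2, Ffield ω)) : Matrix (Fin 2) (Fin 2) (Ffield ω)) =
        (x : Matrix (Fin 2) (Fin 2) (Ffield ω)) *
          ((y : Matrix (Fin 2) (Fin 2) (Ffield ω)) * A *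
          ((y⁻¹ : SL(2, Ffield ω)) : Matrix (Fin 2) (Fin 2) (Ffield ω))) *
          ((x⁻¹ : SL(2, Ffield ω)) : Matrix (Fin 2) (Fin 2) (Ffield ω)) := by
      intro x y A
      rw [_root_.mul_inv_rev, Matrix.SpecialLinearGroup.coe_mul, Matrix.SpecialLinearGroup.coe_mul]
      simp only [Matrix.mul_assoc]
    induction hg using Subgroup.closure_induction'' with
    | one => intro A hA; simpa using hA
    | mem x hx => exact hgen x hx
    | inv_mem x hx => rw [hinv x hx]; exact hgen x hx
    | mul x y _ _ ihx ihy =>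
      intro A hA
      rw [hmul]
      exact ihx _ (ihy _ hA)
  · intro W hWQ hW
    by_cases hbot : ∃ A ∈ W, A ≠ 0
    · right
      obtain ⟨A, hA, hA0⟩ := hbot
      refine Set.Subset.antisymm hWQ ?_
      obtain ⟨b0, c0, rfl⟩ := hWQ hA
      rintro _ ⟨x, y, rfl⟩
      refine aux_top (tF ω) (aux_t_ne m hm1 hmodd ω hω) (aux_gen ω) (W.comap (auxQ (tF ω)))
        ?_ ?_ b0 c0 hA ?_ x y
      · intro b c h
        have := hW _ (Subgroup.subset_closure (Or.inl rfl)) _ h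
        erw [aux_conj1 (tF ω) b c _ rfl] at this
        exact this
      · intro b c h
        have := hW _ (Subgroup.subset_closure (Or.inr rfl)) _ h
        erw [aux_conj2 (tF ω) b c _ rfl] at this
        exact this
      · by_contra! hcon
        obtain ⟨rfl, rfl⟩ := hcon
        exact hA0 (auxQ (tF ω)).map_zero
    · left
      push Not at hbot
      ext A
      constructor
      · intro h; exact hbot A h
      · rintro rfl; exact W.zero_mem

end
end

section
/- Let ζ be a primitive (2^k·m)-th root of unity with k ≥ 1 and m > 1 odd, let L = ℚ(ζ) with ring of integers O_L = ℤ[ζ], let ξ = ζ^m (a primitive 2^k-th root of unity), and let e = φ(2^k) be the ramification index of 2 in L. Let 𝔭 be a maximal ideal of O_L lying over 2 and let r ≥ 0 be an integer with 2r + 1 < e. Then: (a) the ℤ-span of the set {ζ^i − ζ^j : i, j odd integers} contains an element x with x ∈ 𝔭^{2r}, x ∉ 𝔭^{2r+1}, and x ∈ 𝔮^{2r+1} for every maximal ideal 𝔮 ≠ 𝔭 of O_L lying over 2; and (b) the ℤ-span of the set {ζ^i·(ξ^j − 1) : i, j odd integers} contains an element y with y ∈ 𝔭^{2r+1}, y ∉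 𝔭^{2r+2}, and y ∈ 𝔮^{2r+2} for every maximal ideal 𝔮 ≠ 𝔭 of O_L lying over 2. -/
set_option synthInstance.maxHeartbeats 1000000
set_option maxHeartbeats 1000000

noncomputable section

/-- The ring of integers `O_L = ℤ[ζ]` of `L = ℚ(ζ)`, realized as a subalgebra of `ℂ`. -/
abbrev OLring (ζ : ℂ) : Subalgebra ℤ ℂ := Algebra.adjoin ℤ {ζ}

open Polynomial in
theorem frob_aux {R : Type*} [CommRing R] (z : R) (hgen : ∀ a : R, ∃ P : ℤ[X], aeval z P = a)
    (m f : ℕ) (hf : m ∣ 2 ^ f - 1) (h2 : z ^ m - 1 ∣ (2 : R)) (hn : ¬ IsUnit (z ^ m - 1)) (a : R) :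
    z ^ m - 1 ∣ a ^ (2 ^ f) - a := by
  set I : Ideal R := Ideal.span {z ^ m - 1} with hI
  have hz : (Ideal.Quotient.mk I z) ^ (2 ^ f) = Ideal.Quotient.mk I z := by
    have h1 : (Ideal.Quotient.mk I z) ^ m = 1 := by
      have : Ideal.Quotient.mk I (z ^ m - 1) = 0 :=
        Ideal.Quotient.eq_zero_iff_mem.2 (Ideal.subset_span rfl)
      rw [map_sub, map_pow, map_one, sub_eq_zero] at this
      exact this
    obtain ⟨t, ht⟩ := hf
    have h3 : 2 ^ f = m * t + 1 := by
      have : 1 ≤ 2 ^ f := Nat.one_le_two_pow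
      omega
    rw [h3, pow_succ, pow_mul, h1, one_pow, one_mul]
  have hnt : Nontrivial (R ⧸ I) := by
    apply Ideal.Quotient.nontrivial_iff.2
    intro h
    exact hn (Ideal.span_singleton_eq_top.1 h)
  have h20 : (2 : R ⧸ I) = 0 := by
    have : Ideal.Quotient.mk I 2 = 0 :=
      Ideal.Quotient.eq_zero_iff_mem.2 (Ideal.mem_span_singleton.2 h2)
    rwa [map_ofNat] at this
  have : CharP (R ⧸ I) 2 := CharTwo.of_one_ne_zero_of_two_eq_zero one_ne_zero h20
  have key : ((iterateFrobenius (R ⧸ I) 2 f).comp (Ideal.Quotient.mk I)).comp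
      (aeval (R := ℤ) z).toRingHom = (Ideal.Quotient.mk I).comp (aeval (R := ℤ) z).toRingHom := by
    apply Polynomial.ringHom_ext'
    · exact RingHom.ext_int _ _
    · simp [iterateFrobenius_def, hz]
  obtain ⟨P, rfl⟩ := hgen a
  have := RingHom.congr_fun key P
  simp only [RingHom.comp_apply, iterateFrobenius_def] at this
  rw [← Ideal.mem_span_singleton, ← Ideal.Quotient.eq_zero_iff_mem, map_sub, map_pow, sub_eq_zero]
  exact this

theorem unif_aux {R : Type*} [CommRing R] [IsNoetherianRing R] (p : Ideal R) (hp : p.IsMaximal)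
    (w : R) (q : ℕ) (hq : 2 ≤ q) (h : ∀ a : R, w ∣ a ^ q - a) :
    ∃ u : R, u ∉ p ∧ ∀ a ∈ p, w ∣ u * a := by
  classical
  have := hp.isPrime
  obtain ⟨s, hs⟩ := (isNoetherianRing_iff_ideal_fg R).1 inferInstance p
  refine ⟨∏ a ∈ s, (a ^ (q - 1) - 1), ?_, ?_⟩
  · rw [Ideal.IsPrime.prod_mem_iff]
    rintro ⟨a, ha, hap⟩
    have ha' : a ∈ p := hs ▸ Ideal.subset_span ha
    have h1 : a ^ (q - 1) ∈ p := Ideal.pow_mem_of_mem _ ha' _ (by omega)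
    apply hp.ne_top
    rw [Ideal.eq_top_iff_one]
    have := p.sub_mem h1 hap
    simpa using this
  · intro a ha
    rw [← hs] at ha
    refine Submodule.span_induction ?_ ?_ ?_ ?_ ha
    · intro x hx
      rw [← Finset.prod_erase_mul _ _ hx, mul_assoc]
      apply Dvd.dvd.mul_left
      have e : x ^ q - x = (x ^ (q - 1) - 1) * x := by
        rw [sub_mul, one_mul, ← pow_succ]
        congr 2
        omega
      rw [← e]
      exact h x
    · simp
    · intro x y _ _ hx hy
      rw [mul_add]
      exact dvd_add hx hy
    · intro b x _ hx
      rw [smul_eq_mul, mul_left_comm]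
      exact hx.mul_left _

theorem notmem_aux {R : Type*} [CommRing R] [IsDomain R] (p : Ideal R) (hp : p.IsMaximal)
    (w : R) (hw0 : w ≠ 0) (hw : w ∈ p) (c d : R) (hc : c ∉ p) (hd : d ∉ p)
    (h : ∀ a ∈ p, w ∣ c * a) (n : ℕ) : d * w ^ n ∉ p ^ (n + 1) := by
  have hpp := hp.isPrime
  have key : ∀ n : ℕ, ∀ a ∈ p ^ n, w ^ n ∣ c ^ n * a := by
    intro n
    induction n with
    | zero => simp
    | succ n ih =>
      intro a ha
      rw [pow_succ] at ha
      refine Submodule.mul_induction_on ha ?_ ?_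
      · intro x hx y hy
        have := mul_dvd_mul (ih x hx) (h y hy)
        rw [pow_succ, pow_succ]
        convert this using 1
        ring
      · intro x y hx hy
        rw [mul_add]
        exact dvd_add hx hy
  intro hmem
  obtain ⟨t, ht⟩ := key _ _ hmem
  have h1 : w ^ n * (c ^ (n + 1) * d) = w ^ n * (w * t) := by
    linear_combination ht
  have h2 := mul_left_cancel₀ (pow_ne_zero n hw0) h1
  have h3 : c ^ (n + 1) * d ∈ p := h2 ▸ p.mul_mem_right t hw
  rcases hpp.mem_or_mem h3 with h4 | h4
  · exact hc (hpp.mem_of_pow_mem _ h4)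
  · exact hd h4

open Polynomial in
theorem main_aux {R : Type*} [CommRing R] [IsDomain R] [IsNoetherianRing R] (z : R)
    (hgen : ∀ a : R, ∃ P : ℤ[X], aeval z P = a) (l m : ℕ) (hm : Odd m)
    (hz : z ^ (2 ^ (l + 1) * m) = -1) (hz1 : z ^ m - 1 ≠ 0)
    (p : Ideal R) (hp : p.IsMaximal) (h2p : (2 : R) ∈ p) (r : ℕ) :
    ∃ s : ℤ[X], 
      (z * aeval (z ^ 2) s ∈ p ^ (2 * r) ∧ z * aeval (z ^ 2) s ∉ p ^ (2 * r + 1) ∧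
        ∀ q : Ideal R, q.IsMaximal → (2 : R) ∈ q → q ≠ p → z * aeval (z ^ 2) s ∈ q ^ (2 * r + 1)) ∧
      (z * aeval (z ^ 2) s * (z ^ m - 1) ∈ p ^ (2 * r + 1) ∧
        z * aeval (z ^ 2) s * (z ^ m - 1) ∉ p ^ (2 * r + 2) ∧
        ∀ q : Ideal R, q.IsMaximal → (2 : R) ∈ q → q ≠ p →
          z * aeval (z ^ 2) s * (z ^ m - 1) ∈ q ^ (2 * r + 2)) := by
  have hpp := hp.isPrime
  set w : R := z ^ m - 1 with hw
  -- two is divisible by w ^ 2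
  have h2 : w ^ 2 ∣ (2 : R) := by
    set i : R := z ^ (2 ^ l * m) with hi
    have hii : i ^ 2 = -1 := by
      rw [hi, ← pow_mul, ← hz]; congr 1; ring
    have h1 : w ∣ i - 1 := by
      have := sub_dvd_pow_sub_pow (z ^ m) 1 (2 ^ l)
      rw [one_pow, ← pow_mul, mul_comm m] at this
      exact this
    have h3 : (2 : R) = (i - 1) ^ 2 * i := by
      linear_combination (2 - i) * hii
    rw [h3]
    exact (pow_dvd_pow_of_dvd h1 2).mul_right _
  have hmemw : ∀ q : Ideal R, q.IsMaximal → (2 : R) ∈ q → w ∈ q := by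
    intro q hq h2q
    have hqp := hq.isPrime
    have hnt : Nontrivial (R ⧸ q) := Ideal.Quotient.nontrivial_iff.2 hq.ne_top
    have h20 : (2 : R ⧸ q) = 0 := by
      have : Ideal.Quotient.mk q 2 = 0 := Ideal.Quotient.eq_zero_iff_mem.2 h2q
      rwa [map_ofNat] at this
    have : CharP (R ⧸ q) 2 := CharTwo.of_one_ne_zero_of_two_eq_zero one_ne_zero h20
    have h3 : (Ideal.Quotient.mk q w) ^ (2 ^ (l + 1)) = 0 := by
      rw [hw, map_sub, sub_pow_char_pow, map_pow, ← pow_mul, mul_comm m, ← map_pow, hz]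
      simp only [map_neg, map_one, one_pow]
      linear_combination -h20
    rw [← map_pow, Ideal.Quotient.eq_zero_iff_mem] at h3
    exact hqp.mem_of_pow_mem _ h3
  have hwp := hmemw p hp h2p
  have hwu : ¬ IsUnit w := fun h => hp.ne_top (Ideal.eq_top_of_isUnit_mem _ hwp h)
  have hzp : z ∉ p := by
    intro h
    have h1 : z ^ (2 ^ (l + 1) * m) ∈ p := Ideal.pow_mem_of_mem _ h _
      (Nat.mul_pos (by positivity) hm.pos)
    rw [hz] at h1
    exact hp.ne_top ((Ideal.eq_top_iff_one _).2 (by simpa using h1))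
  have hcop : Nat.Coprime 2 m := (Nat.coprime_two_left).2 hm
  obtain ⟨u, hup, hu⟩ := unif_aux p hp w (2 ^ m.totient)
    (by
      have : 0 < m.totient := Nat.totient_pos.2 hm.pos
      calc 2 = 2 ^ 1 := rfl
        _ ≤ _ := Nat.pow_le_pow_right (by norm_num) this)
    (frob_aux z hgen m m.totient
      ((Nat.modEq_iff_dvd' Nat.one_le_two_pow).1 (Nat.ModEq.pow_totient hcop).symm)
      ((dvd_pow_self w two_ne_zero).trans h2) hwu)
  obtain ⟨P, hP⟩ := hgen u
  obtain ⟨g, hg⟩ : ∃ g, m + 1 = 2 * g := by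
    obtain ⟨g, hg⟩ := hm; exact ⟨g + 1, by omega⟩
  set c : R := aeval (z ^ (m + 1)) P with hc
  have hcu : w ∣ c - u := by
    have h1 : z ^ (m + 1) - z ∣ c - u := by
      rw [hc, ← hP, aeval_def, aeval_def, ← eval_map, ← eval_map]
      exact sub_dvd_eval_sub _ _ _
    have h3 : w ∣ z ^ (m + 1) - z := ⟨z, by rw [hw]; ring⟩
    exact h3.trans h1
  have hcp : c ∉ p := by
    intro h
    apply hup
    have := p.sub_mem h (p.mem_of_dvd hcu hwp)
    simpa using this
  have hcd : ∀ a ∈ p, w ∣ c * a := by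
    intro a ha
    have := dvd_add (hcu.mul_right a) (hu a ha)
    rwa [← add_mul, sub_add_cancel] at this
  have hcq : ∀ q : Ideal R, q.IsMaximal → (2 : R) ∈ q → q ≠ p → c ∈ q := by
    intro q hq h2q hne
    have hqp := hq.isPrime
    obtain ⟨a, hap, haq⟩ : ∃ a ∈ p, a ∉ q := by
      by_contra! hcon
      exact hne (hp.eq_of_le hq.ne_top hcon).symm
    exact (hqp.mem_or_mem (q.mem_of_dvd (hcd a hap) (hmemw q hq h2q))).resolve_right haq
  obtain ⟨t, ht⟩ := h2
  have hv : 1 + w * t ∉ p := by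
    intro h
    have := p.sub_mem h (p.mul_mem_right t hwp)
    rw [add_sub_cancel_right] at this
    exact hp.ne_top ((Ideal.eq_top_iff_one _).2 this)
  have hvw : (z ^ 2) ^ m - 1 = w ^ 2 * (1 + w * t) := by
    have : (z ^ 2) ^ m = (w + 1) ^ 2 := by rw [hw, ← pow_mul, mul_comm, pow_mul]; ring
    rw [this]
    linear_combination w * ht
  have hx : z * aeval (z ^ 2) (P.comp (X ^ g) * (X ^ m - 1) ^ r) =
      (z * c * (1 + w * t) ^ r) * w ^ (2 * r) := by
    have h1 : aeval (z ^ 2) (P.comp (X ^ g)) = c := by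
      rw [aeval_comp, hc, hg, pow_mul]; simp
    rw [map_mul, h1]
    simp only [map_pow, map_sub, aeval_X, map_one]
    rw [hvw, mul_pow, ← pow_mul]
    ring
  have hd : z * c * (1 + w * t) ^ r ∉ p := by
    intro h
    rcases hpp.mem_or_mem h with h | h
    · rcases hpp.mem_or_mem h with h | h
      · exact hzp h
      · exact hcp h
    · exact hv (hpp.mem_of_pow_mem _ h)
  have hdq : ∀ q : Ideal R, q.IsMaximal → (2 : R) ∈ q → q ≠ p → z * c * (1 + w * t) ^ r ∈ q :=
    fun q h1 h2 h3 => q.mul_mem_right _ (q.mul_mem_left _ (hcq q h1 h2 h3))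
  refine ⟨P.comp (X ^ g) * (X ^ m - 1) ^ r, ?_⟩
  rw [hx, mul_assoc _ (w ^ (2 * r)) w, ← pow_succ]
  refine ⟨⟨?_, ?_, ?_⟩, ?_, ?_, ?_⟩
  · exact Ideal.mul_mem_left _ _ (Ideal.pow_mem_pow hwp _)
  · exact notmem_aux p hp w hz1 hwp c _ hcp hd hcd _
  · intro q h1 h2 h3
    rw [pow_succ' q]
    exact Ideal.mul_mem_mul (hdq q h1 h2 h3) (Ideal.pow_mem_pow (hmemw q h1 h2) _)
  · exact Ideal.mul_mem_left _ _ (Ideal.pow_mem_pow hwp _)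
  · exact notmem_aux p hp w hz1 hwp c _ hcp hd hcd _
  · intro q h1 h2 h3
    rw [pow_succ' q]
    exact Ideal.mul_mem_mul (hdq q h1 h2 h3) (Ideal.pow_mem_pow (hmemw q h1 h2) _)

theorem span_of_roots_of_unity_hits_prescribed_valuations
    (k m : ℕ) (hk : 1 ≤ k) (hm1 : 1 < m) (hmodd : Odd m)
    (ζ : ℂ) (hζ : IsPrimitiveRoot ζ (2 ^ k * m))
    (𝔭 : Ideal (OLring ζ)) (h𝔭 : 𝔭.IsMaximal) (h2𝔭 : (2 : OLring ζ) ∈ 𝔭)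
    (r : ℕ) (hr : 2 * r + 1 < Nat.totient (2 ^ k)) :
    (∃ x ∈ Submodule.span ℤ
        {x : OLring ζ | ∃ i j : ℤ, Odd i ∧ Odd j ∧ (x : ℂ) = ζ ^ i - ζ ^ j},
      x ∈ 𝔭 ^ (2 * r) ∧ x ∉ 𝔭 ^ (2 * r + 1) ∧
      ∀ 𝔮 : Ideal (OLring ζ), 𝔮.IsMaximal → (2 : OLring ζ) ∈ 𝔮 → 𝔮 ≠ 𝔭 →
        x ∈ 𝔮 ^ (2 * r + 1)) ∧
    (∃ y ∈ Submodule.span ℤ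
        {x : OLring ζ | ∃ i j : ℤ, Odd i ∧ Odd j ∧ (x : ℂ) = ζ ^ i * ((ζ ^ m) ^ j - 1)},
      y ∈ 𝔭 ^ (2 * r + 1) ∧ y ∉ 𝔭 ^ (2 * r + 2) ∧
      ∀ 𝔮 : Ideal (OLring ζ), 𝔮.IsMaximal → (2 : OLring ζ) ∈ 𝔮 → 𝔮 ≠ 𝔭 →
        y ∈ 𝔮 ^ (2 * r + 2)) := by
  obtain ⟨l, rfl⟩ : ∃ l, k = l + 2 := by
    have : k ≠ 1 := by
      rintro rfl
      simp at hr
    exact ⟨k - 2, by omega⟩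
  set z : OLring ζ := ⟨ζ, Algebra.subset_adjoin rfl⟩ with hzdef
  have hzc : (z : ℂ) = ζ := rfl
  have hgen : ∀ a : OLring ζ, ∃ P : Polynomial ℤ, Polynomial.aeval z P = a := by
    rintro ⟨a, ha⟩
    rw [OLring, Algebra.adjoin_singleton_eq_range_aeval] at ha
    obtain ⟨P, rfl⟩ := ha
    refine ⟨P, Subtype.ext ?_⟩
    exact (Polynomial.aeval_algHom_apply (OLring ζ).val z P).symm
  have hnoeth : IsNoetherianRing (OLring ζ) :=
    isNoetherianRing_of_surjective (Polynomial ℤ) (OLring ζ)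
      (Polynomial.aeval z).toRingHom hgen
  have hmpos : 0 < m := by omega
  have hz : z ^ (2 ^ (l + 1) * m) = -1 := by
    have h1 : IsPrimitiveRoot (ζ ^ (2 ^ (l + 1) * m)) 2 :=
      hζ.pow (by positivity) (by ring)
    apply Subtype.ext
    push_cast
    exact h1.eq_neg_one_of_two_right
  have hz1 : z ^ m - 1 ≠ 0 := by
    intro h
    have h1 : ζ ^ m = 1 := by
      have := congrArg (Subtype.val) (sub_eq_zero.1 h)
      simpa using this
    have h2 := Nat.le_of_dvd hmpos (hζ.dvd_of_pow_eq_one _ h1)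
    have h3 : 2 ^ 1 ≤ 2 ^ (l + 2) := Nat.pow_le_pow_right (by norm_num) (by omega)
    nlinarith
  obtain ⟨s, hA, hB⟩ := main_aux z hgen l m hmodd hz hz1 𝔭 h𝔭 h2𝔭 r
  refine ⟨⟨_, ?_, hA⟩, ⟨_, ?_, hB⟩⟩
  · -- unit argument
    have hprim : IsPrimitiveRoot (ζ ^ 2) (2 ^ (l + 1) * m) :=
      hζ.pow (by positivity) (by ring)
    have hev : Polynomial.eval 1 (Polynomial.cyclotomic (2 ^ (l + 1) * m) ℤ) = 1 := by
      apply Polynomial.eval_one_cyclotomic_not_prime_pow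
      intro p hp n hn
      have h2 : 2 ∣ p ^ n := hn ▸ Dvd.dvd.mul_right (dvd_pow_self 2 (by omega)) m
      have h2p := (Nat.prime_dvd_prime_iff_eq Nat.prime_two hp).1 (Nat.prime_two.dvd_of_dvd_pow h2)
      subst h2p
      have hmd : m ∣ 2 ^ n := hn ▸ Dvd.intro_left _ rfl
      have hcop : Nat.Coprime m (2 ^ n) :=
        Nat.Coprime.pow_right n ((Nat.coprime_two_right).2 hmodd)
      have := Nat.eq_one_of_dvd_coprimes hcop dvd_rfl hmd
      omega
    obtain ⟨G, hG⟩ : (Polynomial.X - Polynomial.C 1) ∣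
        Polynomial.cyclotomic (2 ^ (l + 1) * m) ℤ - 1 := by
      rw [Polynomial.dvd_iff_isRoot]
      simp [hev]
    have hcyc : Polynomial.aeval (z ^ 2) (Polynomial.cyclotomic (2 ^ (l + 1) * m) ℤ) = 0 := by
      apply Subtype.ext
      have h1 := Polynomial.aeval_algHom_apply (OLring ζ).val (z ^ 2)
        (Polynomial.cyclotomic (2 ^ (l + 1) * m) ℤ)
      refine h1.symm.trans ?_
      have h2 := hprim.isRoot_cyclotomic (by positivity)
      rw [Polynomial.IsRoot.def, ← Polynomial.map_cyclotomic_int, Polynomial.eval_map] at h2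
      simpa [Polynomial.aeval_def, hzc] using h2
    have hG2 : (z ^ 2 - 1) * Polynomial.aeval (z ^ 2) G = -1 := by
      have := congrArg (Polynomial.aeval (z ^ 2)) hG
      rw [map_sub, hcyc] at this
      simpa using this.symm
    have key : ∀ Q : Polynomial ℤ, z * (z ^ 2 - 1) * Polynomial.aeval (z ^ 2) Q ∈
        Submodule.span ℤ
        {x : OLring ζ | ∃ i j : ℤ, Odd i ∧ Odd j ∧ (x : ℂ) = ζ ^ i - ζ ^ j} := by
      intro Q
      induction Q using Polynomial.induction_on' with
      | add p q hp hq =>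
        rw [map_add, mul_add]
        exact Submodule.add_mem _ hp hq
      | monomial n a =>
        have e : z * (z ^ 2 - 1) * Polynomial.aeval (z ^ 2) (Polynomial.monomial n a) =
            a • (z ^ (2 * n + 3) - z ^ (2 * n + 1)) := by
          rw [Polynomial.aeval_monomial, zsmul_eq_mul, eq_intCast]
          ring
        rw [e]
        apply Submodule.smul_mem
        apply Submodule.subset_span
        refine ⟨(2 * n + 3 : ℕ), (2 * n + 1 : ℕ), ?_, ?_, ?_⟩
        · exact ⟨(n : ℤ) + 1, by push_cast; ring⟩
        · exact ⟨(n : ℤ), by push_cast; ring⟩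
        · rw [zpow_natCast, zpow_natCast]
          simp [hzc]
    have e2 : z * Polynomial.aeval (z ^ 2) s =
        z * (z ^ 2 - 1) * Polynomial.aeval (z ^ 2) (-(G * s)) := by
      rw [map_neg, map_mul]
      linear_combination (z * Polynomial.aeval (z ^ 2) s) * hG2
    rw [e2]
    exact key _
  · clear hA hB
    induction s using Polynomial.induction_on' with
    | add p q hp hq =>
      rw [map_add, mul_add, add_mul]
      exact Submodule.add_mem _ hp hq
    | monomial n a =>
      have e : z * Polynomial.aeval (z ^ 2) (Polynomial.monomial n a) * (z ^ m - 1) =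
          a • (z ^ (2 * n + 1) * (z ^ m - 1)) := by
        rw [Polynomial.aeval_monomial, zsmul_eq_mul, eq_intCast]
        ring
      rw [e]
      apply Submodule.smul_mem
      apply Submodule.subset_span
      refine ⟨(2 * n + 1 : ℕ), 1, ?_, odd_one, ?_⟩
      · exact ⟨(n : ℤ), by push_cast; ring⟩
      · rw [zpow_natCast, zpow_one]
        simp [hzc]

end
end

section
/- Suppose n = 2m with m > 1 odd. Then for every integer k ≥ 1 there exists an element γ ∈ Δ whose (1,1)-entry (upper-left entry) lies in the ideal 2^k O. -/
open Matrix
open scoped MatrixGroups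

set_option synthInstance.maxHeartbeats 1000000
set_option maxHeartbeats 1000000

noncomputable section

/-- `y` is reached at level `N`: some `γ ∈ Δ` is `1` mod `N` with upper right entry
`N * y` mod `2 * N`. -/
def Reach (ζ : ℂ) (N y : Oring ζ) : Prop :=
  ∃ γ ∈ Delta ζ, ∃ p q r s : Oring ζ,
    γ.1 0 0 = 1 + N * p ∧ γ.1 0 1 = N * (y + 2 * q) ∧ γ.1 1 0 = N * r ∧ γ.1 1 1 = 1 + N * s

lemma coe_two_O (ζ : ℂ) : ((2 : Oring ζ) : ℂ) = 2 := rfl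

lemma Reach.zero (ζ : ℂ) (N : Oring ζ) : Reach ζ N 0 :=
  ⟨1, one_mem _, 0, 0, 0, 0, by simp, by simp, by simp, by simp⟩

lemma Reach.add {ζ : ℂ} {K y z : Oring ζ} (hy : Reach ζ (2 * K) y) (hz : Reach ζ (2 * K) z) :
    Reach ζ (2 * K) (y + z) := by
  obtain ⟨γ, hγ, p, q, r, s, h1, h2, h3, h4⟩ := hy
  obtain ⟨δ, hδ, p', q', r', s', k1, k2, k3, k4⟩ := hz
  refine ⟨γ * δ, mul_mem hγ hδ,
    p + p' + (2 * K) * p * p' + (2 * K) * (y + 2 * q) * r',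
    q + q' + K * p * (z + 2 * q') + K * s' * (y + 2 * q),
    r + r' + (2 * K) * r * p' + (2 * K) * s * r',
    s + s' + (2 * K) * s * s' + (2 * K) * r * (z + 2 * q'), ?_, ?_, ?_, ?_⟩ <;>
  · rw [Matrix.SpecialLinearGroup.coe_mul, Matrix.mul_apply, Fin.sum_univ_two]
    simp only [h1, h2, h3, h4, k1, k2, k3, k4]
    ring

lemma Reach.neg {ζ : ℂ} {N y : Oring ζ} (hy : Reach ζ N y) : Reach ζ N (-y) := by
  obtain ⟨γ, hγ, p, q, r, s, h1, h2, h3, h4⟩ := hy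
  refine ⟨γ⁻¹, inv_mem hγ, s, -q, -r, p, ?_, ?_, ?_, ?_⟩ <;>
  · rw [Matrix.SpecialLinearGroup.coe_inv, Matrix.adjugate_fin_two]
    simp [h1, h2, h3, h4]
    try ring

lemma Reach.congr {ζ : ℂ} {N y z w : Oring ζ} (hy : Reach ζ N y) (h : z = y + 2 * w) :
    Reach ζ N z := by
  obtain ⟨γ, hγ, p, q, r, s, h1, h2, h3, h4⟩ := hy
  exact ⟨γ, hγ, p, q - w, r, s, h1, by rw [h2, h]; ring, h3, h4⟩

lemma Tmat_pow (ζ : ℂ) (N : ℕ) :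
    ((Tmat ζ ^ N : SL(2, Oring ζ)) : Matrix (Fin 2) (Fin 2) (Oring ζ))
      = !![1, (N : Oring ζ) * (2 + lamO ζ); 0, 1] := by
  induction N with
  | zero => ext i j; fin_cases i <;> fin_cases j <;> simp
  | succ N ih =>
    rw [pow_succ, Matrix.SpecialLinearGroup.coe_mul, ih]
    ext i j
    fin_cases i <;> fin_cases j <;> simp [Tmat, Matrix.mul_apply, Fin.sum_univ_two]
    ring

lemma Tmat_mem (ζ : ℂ) : Tmat ζ ∈ Delta ζ := Subgroup.subset_closure (by simp)

lemma Umat_mem (ζ : ℂ) : Umat ζ ∈ Delta ζ := Subgroup.subset_closure (by simp)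

lemma Rmat_mem (ζ : ℂ) : Rmat ζ ∈ Delta ζ := mul_mem (Umat_mem ζ) (Tmat_mem ζ)

lemma Reach.conj {ζ : ℂ} (N : ℕ) {A : SL(2, Oring ζ)} (hA : A ∈ Delta ζ) :
    Reach ζ N ((2 + lamO ζ) * A.1 0 0 ^ 2) := by
  have hd : A.1 0 0 * A.1 1 1 - A.1 0 1 * A.1 1 0 = 1 := by
    rw [← Matrix.det_fin_two]; exact A.2
  refine ⟨A * Tmat ζ ^ N * A⁻¹, mul_mem (mul_mem hA (pow_mem (Tmat_mem ζ) N)) (inv_mem hA),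
    - (2 + lamO ζ) * A.1 0 0 * A.1 1 0, 0, - (2 + lamO ζ) * A.1 1 0 ^ 2,
    (2 + lamO ζ) * A.1 0 0 * A.1 1 0, ?_, ?_, ?_, ?_⟩ <;>
  · rw [Matrix.SpecialLinearGroup.coe_mul, Matrix.SpecialLinearGroup.coe_mul, Tmat_pow,
      Matrix.SpecialLinearGroup.coe_inv, Matrix.adjugate_fin_two]
    simp [Matrix.mul_apply, Fin.sum_univ_two]
    first
      | linear_combination hd
      | ring

/-- First column of `R ^ j`. -/
lemma Rmat_col (ζ : ℂ) (hz : ζ ≠ 0) (j : ℕ) :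
    (ζ - ζ⁻¹) * (((Rmat ζ ^ j).1 0 0 : Oring ζ) : ℂ)
      = - (ζ ^ j - ζ⁻¹ ^ j + ζ ^ j * ζ⁻¹ - ζ⁻¹ ^ j * ζ) ∧
    (ζ - ζ⁻¹) * (((Rmat ζ ^ j).1 1 0 : Oring ζ) : ℂ) = ζ ^ j - ζ⁻¹ ^ j := by
  have hzw : ζ * ζ⁻¹ = 1 := mul_inv_cancel₀ hz
  induction j with
  | zero => simp
  | succ j ih =>
    obtain ⟨h0, h1⟩ := ih
    have hR : (Rmat ζ).1 = !![-1, -(2 + lamO ζ); 1, 1 + lamO ζ] := by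
      rw [Rmat, Matrix.SpecialLinearGroup.coe_mul]
      ext i j
      fin_cases i <;> fin_cases j <;> simp [Umat, Tmat, Matrix.mul_apply, Fin.sum_univ_two, coe_two_O]
      ring
    have e0 : (Rmat ζ ^ (j + 1)).1 0 0
        = - (Rmat ζ ^ j).1 0 0 - (2 + lamO ζ) * (Rmat ζ ^ j).1 1 0 := by
      rw [pow_succ', Matrix.SpecialLinearGroup.coe_mul, Matrix.mul_apply, Fin.sum_univ_two]
      rw [hR]
      simp
      ring
    have e1 : (Rmat ζ ^ (j + 1)).1 1 0
        = (Rmat ζ ^ j).1 0 0 + (1 + lamO ζ) * (Rmat ζ ^ j).1 1 0 := by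
      rw [pow_succ', Matrix.SpecialLinearGroup.coe_mul, Matrix.mul_apply, Fin.sum_univ_two]
      rw [hR]
      simp
    have hl : ((lamO ζ : Oring ζ) : ℂ) = ζ + ζ⁻¹ := rfl
    rw [e0, e1]
    push_cast
    rw [hl, coe_two_O]
    generalize (((Rmat ζ ^ j).1 0 0 : Oring ζ) : ℂ) = x at *
    generalize (((Rmat ζ ^ j).1 1 0 : Oring ζ) : ℂ) = y at *
    rw [pow_succ, pow_succ]
    generalize ζ ^ j = a at *
    generalize ζ⁻¹ ^ j = b at *
    constructor
    · linear_combination -h0 - (2 + ζ + ζ⁻¹) * h1 + (a - b) * hzw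
    · linear_combination h0 + (1 + ζ + ζ⁻¹) * h1

/-- The element `ζ ^ j + ζ ^ (-j)` of `O`. -/
def lamSeq (ζ : ℂ) : ℕ → Oring ζ
  | 0 => 2
  | 1 => lamO ζ
  | (j + 2) => lamO ζ * lamSeq ζ (j + 1) - lamSeq ζ j

lemma lamSeq_coe (ζ : ℂ) (hz : ζ ≠ 0) (j : ℕ) :
    ((lamSeq ζ j : Oring ζ) : ℂ) = ζ ^ j + ζ⁻¹ ^ j := by
  have hzw : ζ * ζ⁻¹ = 1 := mul_inv_cancel₀ hz
  have hl : ((lamO ζ : Oring ζ) : ℂ) = ζ + ζ⁻¹ := rfl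
  induction j using Nat.twoStepInduction with
  | zero => simp only [lamSeq, pow_zero, coe_two_O]; norm_num
  | one => simp [lamSeq, hl]
  | more j h0 h1 =>
    simp only [lamSeq]
    push_cast
    rw [h0, h1, hl]
    simp only [pow_succ]
    linear_combination (ζ ^ j + ζ⁻¹ ^ j) * hzw

/-- The additive group of reached elements. -/
def reachGroup (ζ : ℂ) (K : Oring ζ) : AddSubgroup (Oring ζ) where
  carrier := {y | Reach ζ (2 * K) y}
  zero_mem' := Reach.zero _ _
  add_mem' := Reach.add
  neg_mem' := Reach.neg

lemma span_lamSeq (ζ : ℂ) (h : ℕ) (hz : ζ ≠ 0) (hne : ζ - ζ⁻¹ ≠ 0)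
    (hpow : ζ ^ (2 * h + 1) = -1) (W : AddSubgroup (Oring ζ)) (hW : ∀ j, lamSeq ζ j ∈ W)
    (x : Oring ζ) : x ∈ W := by
  have hzw : ζ * ζ⁻¹ = 1 := mul_inv_cancel₀ hz
  let V : AddSubgroup (Oring ζ) := AddSubgroup.closure (Set.range (lamSeq ζ))
  have hVW : V ≤ W := (AddSubgroup.closure_le _).2 (by rintro _ ⟨j, rfl⟩; exact hW j)
  have hV : ∀ j, lamSeq ζ j ∈ V := fun j => AddSubgroup.subset_closure ⟨j, rfl⟩
  have h1 : (1 : Oring ζ) ∈ V := by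
    have hs : ∀ g : ℕ, (ζ - ζ⁻¹) * ((∑ i ∈ Finset.range g, lamSeq ζ (2 * i + 1) : Oring ζ) : ℂ)
        = ζ ^ (2 * g) - ζ⁻¹ ^ (2 * g) := by
      intro g
      induction g with
      | zero => simp
      | succ g ih =>
        rw [Finset.sum_range_succ]
        push_cast at ih ⊢
        rw [mul_add, ih, lamSeq_coe ζ hz, show 2 * (g + 1) = 2 * g + 1 + 1 by ring]
        simp only [pow_succ]
        linear_combination (ζ⁻¹ ^ (2 * g) - ζ ^ (2 * g)) * hzw
    have : (1 : Oring ζ) = ∑ i ∈ Finset.range h, lamSeq ζ (2 * i + 1) := by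
      apply Subtype.ext
      apply mul_left_cancel₀ hne
      rw [hs h]
      have hpow' : ζ⁻¹ ^ (2 * h + 1) = -1 := by rw [inv_pow, hpow]; norm_num
      rw [pow_succ] at hpow hpow'
      simp only [OneMemClass.coe_one]
      linear_combination (-ζ⁻¹) * hpow + ζ * hpow' + (ζ ^ (2 * h) - ζ⁻¹ ^ (2 * h)) * hzw
    rw [this]
    exact sum_mem fun i _ => hV _
  have hlam : ∀ v ∈ V, lamO ζ * v ∈ V := by
    intro v hv
    induction hv using AddSubgroup.closure_induction with
    | mem v hv =>
      obtain ⟨j, rfl⟩ := hv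
      cases j with
      | zero =>
        have : lamO ζ * lamSeq ζ 0 = lamSeq ζ 1 + lamSeq ζ 1 := by simp only [lamSeq]; ring
        rw [this]; exact add_mem (hV _) (hV _)
      | succ j =>
        have : lamO ζ * lamSeq ζ (j + 1) = lamSeq ζ (j + 2) + lamSeq ζ j := by
          simp only [lamSeq]; ring
        rw [this]; exact add_mem (hV _) (hV _)
    | zero => simp
    | add a b _ _ ha hb => rw [mul_add]; exact add_mem ha hb
    | neg a _ ha => rw [mul_neg]; exact neg_mem ha
  have key : ∀ (y : ℂ) (hy : y ∈ Oring ζ), ∀ v ∈ V, (⟨y, hy⟩ : Oring ζ) * v ∈ V := by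
    intro y hy
    induction hy using Algebra.adjoin_induction with
    | mem y hy =>
      obtain rfl : y = ζ + ζ⁻¹ := hy
      exact hlam
    | algebraMap r =>
      intro v hv
      have e : (⟨algebraMap ℤ ℂ r, Subalgebra.algebraMap_mem _ r⟩ : Oring ζ) * v = r • v := by
        apply Subtype.ext
        simp
      rw [e]
      exact zsmul_mem hv r
    | add a b ha hb iha ihb =>
      intro v hv
      have e : (⟨a + b, add_mem ha hb⟩ : Oring ζ) * v = ⟨a, ha⟩ * v + ⟨b, hb⟩ * v :=
        Subtype.ext (add_mul a b v.1)
      rw [e]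
      exact add_mem (iha v hv) (ihb v hv)
    | mul a b ha hb iha ihb =>
      intro v hv
      have e : (⟨a * b, mul_mem ha hb⟩ : Oring ζ) * v = ⟨a, ha⟩ * (⟨b, hb⟩ * v) :=
        Subtype.ext (mul_assoc a b v.1)
      rw [e]
      exact iha _ (ihb v hv)
  apply hVW
  have := key x.1 x.2 1 h1
  rwa [mul_one] at this

lemma reach_all (ζ : ℂ) (h : ℕ) (hz : ζ ≠ 0) (hne : ζ - ζ⁻¹ ≠ 0)
    (hpow : ζ ^ (2 * h + 1) = -1) (k : ℕ) (y : Oring ζ) : Reach ζ (2 * 2 ^ k) y := by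
  have hzw : ζ * ζ⁻¹ = 1 := mul_inv_cancel₀ hz
  have hodd : ∀ i, Reach ζ (2 * 2 ^ k) (lamSeq ζ (2 * i + 1)) := by
    intro i
    have h1 := Reach.conj (2 * 2 ^ k) (pow_mem (Rmat_mem ζ) (i + 1))
    push_cast at h1
    refine h1.congr (w := 1 - 2 * (Rmat ζ ^ (i + 1)).1 0 0 ^ 2) ?_
    obtain ⟨h0, -⟩ := Rmat_col ζ hz (i + 1)
    apply Subtype.ext
    apply mul_left_cancel₀ (pow_ne_zero 2 hne)
    have hl : ((lamO ζ : Oring ζ) : ℂ) = ζ + ζ⁻¹ := rfl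
    push_cast
    rw [lamSeq_coe ζ hz, hl, coe_two_O]
    have hab : ζ ^ i * ζ⁻¹ ^ i = 1 := by rw [← mul_pow, hzw, one_pow]
    generalize (((Rmat ζ ^ (i + 1)).1 0 0 : Oring ζ) : ℂ) = x at *
    rw [pow_succ, pow_succ] at h0
    rw [pow_succ ζ (2 * i), pow_succ ζ⁻¹ (2 * i), mul_comm 2 i, pow_mul, pow_mul]
    generalize ζ ^ i = a at *
    generalize ζ⁻¹ ^ i = b at *
    have h0' : (ζ - ζ⁻¹) * x = -(a * ζ - b * ζ⁻¹ + a - b) := by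
      linear_combination h0 + (b - a) * hzw
    have hsq : (ζ - ζ⁻¹) ^ 2 * x ^ 2 = (a * ζ - b * ζ⁻¹ + a - b) ^ 2 := by
      rw [← mul_pow, h0', neg_sq]
    have hw : (ζ - ζ⁻¹) ^ 2 = (ζ + ζ⁻¹ - 2) * (ζ + ζ⁻¹ + 2) := by linear_combination (-4) * hzw
    have hx : (a * ζ - b * ζ⁻¹ + a - b) ^ 2 = (ζ + ζ⁻¹ + 2) * (a ^ 2 * ζ + b ^ 2 * ζ⁻¹ - 2) := by
      linear_combination (-(a ^ 2 + b ^ 2) - 2 * a * b) * hzw + (-4 - 2 * ζ - 2 * ζ⁻¹) * hab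
    linear_combination (2 - ζ - ζ⁻¹) * hsq + (2 - ζ - ζ⁻¹) * hx
      + (a ^ 2 * ζ + b ^ 2 * ζ⁻¹ - 2) * hw
  refine span_lamSeq ζ h hz hne hpow (reachGroup ζ (2 ^ k)) (fun j => ?_) y
  change Reach ζ (2 * 2 ^ k) _
  rcases Nat.even_or_odd' j with ⟨i, rfl | rfl⟩
  · have h1 := (hodd (i + h)).neg
    have e : lamSeq ζ (2 * i) = - lamSeq ζ (2 * (i + h) + 1) := by
      apply Subtype.ext
      push_cast
      rw [lamSeq_coe ζ hz, lamSeq_coe ζ hz, show 2 * (i + h) + 1 = 2 * i + (2 * h + 1) by ring,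
        pow_add ζ (2 * i) (2 * h + 1), pow_add ζ⁻¹ (2 * i) (2 * h + 1),
        inv_pow ζ (2 * h + 1), hpow]
      norm_num
      ring
    rw [e]; exact h1
  · exact hodd i

lemma main_aux_s17 (ζ : ℂ) (h : ℕ) (hz : ζ ≠ 0) (hne : ζ - ζ⁻¹ ≠ 0)
    (hpow : ζ ^ (2 * h + 1) = -1) (k : ℕ) :
    ∃ γ ∈ Delta ζ, ∃ u : Oring ζ, γ.1 0 0 = 2 * 2 ^ k * u := by
  have hzw : ζ * ζ⁻¹ = 1 := mul_inv_cancel₀ hz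
  induction k with
  | zero =>
    refine ⟨Rmat ζ ^ (h + 1), pow_mem (Rmat_mem ζ) _, - (Rmat ζ ^ (h + 1)).1 1 0, ?_⟩
    obtain ⟨h0, h1⟩ := Rmat_col ζ hz (h + 1)
    apply Subtype.ext
    apply mul_left_cancel₀ hne
    push_cast
    have hab : ζ ^ h * ζ⁻¹ ^ h = 1 := by rw [← mul_pow, hzw, one_pow]
    have hp : ζ ^ h * ζ ^ h * ζ = -1 := by rw [← hpow]; ring
    rw [h0, coe_two_O]
    generalize (((Rmat ζ ^ (h + 1)).1 1 0 : Oring ζ) : ℂ) = y at *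
    rw [pow_succ ζ, pow_succ ζ⁻¹] at h1 ⊢
    generalize ζ ^ h = a at *
    generalize ζ⁻¹ ^ h = b at *
    have hb : b = - (a * ζ) := by linear_combination b * hp - (a * ζ) * hab
    have hbw : b * ζ⁻¹ = - a := by rw [hb]; linear_combination (-a) * hzw
    linear_combination 2 * h1 + (b - a) * hzw - hbw + hb
  | succ k ih =>
    obtain ⟨γ, hγ, u, hu⟩ := ih
    have hd : γ.1 0 0 * γ.1 1 1 - γ.1 0 1 * γ.1 1 0 = 1 := by
      rw [← Matrix.det_fin_two]; exact γ.2
    obtain ⟨δ, hδ, p, q, r, s, h1, h2, h3, h4⟩ :=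
      reach_all ζ h hz hne hpow k (u * γ.1 0 1)
    refine ⟨δ * γ, mul_mem hδ hγ,
      2 ^ k * u * p + q * γ.1 1 0 + 2 ^ k * u * u * γ.1 1 1, ?_⟩
    rw [Matrix.SpecialLinearGroup.coe_mul, Matrix.mul_apply, Fin.sum_univ_two, h1, h2]
    rw [hu] at hd ⊢
    rw [pow_succ]
    linear_combination (-(2 * 2 ^ k * u)) * hd

theorem exists_element_with_upper_left_divisible_by_two_pow
    (n m : ℕ) (hm1 : 1 < m) (hmodd : Odd m) (hn : n = 2 * m)
    (ζ : ℂ) (hζ : IsPrimitiveRoot ζ n)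
    (k : ℕ) (hk : 1 ≤ k) :
    ∃ γ ∈ Delta ζ,
      (γ : Matrix (Fin 2) (Fin 2) (Oring ζ)) 0 0 ∈ Ideal.span {(2 : Oring ζ) ^ k} := by
  obtain ⟨h, rfl⟩ := hmodd
  subst hn
  have hz : ζ ≠ 0 := hζ.ne_zero (by omega)
  have hne : ζ - ζ⁻¹ ≠ 0 := by
    intro h0
    have h2 : ζ ^ 2 = 1 := by
      have := mul_inv_cancel₀ hz
      rw [← sub_eq_zero.1 h0] at this
      rw [sq]; exact this
    have := Nat.le_of_dvd (by norm_num) (hζ.dvd_of_pow_eq_one 2 h2)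
    omega
  have hpow : ζ ^ (2 * h + 1) = -1 := by
    have h1 : (ζ ^ (2 * h + 1)) ^ 2 = 1 := by
      rw [← pow_mul, mul_comm (2 * h + 1) 2]; exact hζ.pow_eq_one
    rcases eq_or_eq_neg_of_sq_eq_sq (ζ ^ (2 * h + 1)) 1 (by rw [h1, one_pow]) with h2 | h2
    · exact absurd h2 (hζ.pow_ne_one_of_pos_of_lt (by omega) (by omega))
    · exact h2
  obtain ⟨j, rfl⟩ : ∃ j, k = j + 1 := ⟨k - 1, by omega⟩
  obtain ⟨γ, hγ, u, hu⟩ := main_aux_s17 ζ h hz hne hpow j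
  refine ⟨γ, hγ, Ideal.mem_span_singleton.2 ⟨u, ?_⟩⟩
  rw [pow_succ, mul_comm (2 ^ j) 2]
  exact hu

end
end
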